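/- arXiv:1906.07667 — 2 statements merged into one kernel-verified Lean document; each statement's English description precedes it below -/
import Mathlib

section
/- Let Ω ⊂ ℝ^d (d ≥ 2) be a bounded domain with boundary of class C^{2,γ}, let f ∈ C^∞(cl(Ω)×ℝ×ℝ^d, ℝ), and let p ∈ C^∞(Ω×ℝ, ℝ) be a time-periodic classical solution of ∂_t u = Δu + f(x, u, ∇u) with homogeneous Dirichlet boundary condition, of minimal period ω > 0, with p and ∇p uniformly bounded. Let V ∈ C^∞(Ω×[0,ω], ℝ^{d+1}) be a function that is not everywhere colinear to (∂_t p(x,t), ∇∂_t p(x,t)). Then there exists g ∈ C^∞(cl(Ω)×ℝ×ℝ^d, ℝ) such that: (i) g(x, p(x,t), ∇p(x,t)) = 0 for all (x,t) ∈ Ω×ℝ; and (ii) ∫_0^ω ∫_Ω (D_u g, D_{∇u} g)(x, p(x,t), ∇p(x,t)) · V(x,t) dx dt ≠ 0. -/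
open Set MeasureTheory

/-- The partial derivative of `f` in the `i`-th coordinate direction. -/
noncomputable def pd {d : ℕ} (i : Fin d) (f : (Fin d → ℝ) → ℝ) (x : Fin d → ℝ) : ℝ :=
  fderiv ℝ f x (Pi.single i 1)

/-- The Laplacian of `f`. -/
noncomputable def lap {d : ℕ} (f : (Fin d → ℝ) → ℝ) (x : Fin d → ℝ) : ℝ :=
  ∑ i, pd i (pd i f) x

/-- `Ω` is a domain with boundary of class `C^{2,γ}`: it admits a global defining
function `φ` of class `C²` whose second derivative is `γ`-Hölder continuous, with
nonvanishing gradient on the boundary. -/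
def HasC2HolderBoundary {d : ℕ} (Ω : Set (Fin d → ℝ)) (γ : NNReal) : Prop :=
  ∃ (φ : (Fin d → ℝ) → ℝ) (C : NNReal),
    ContDiff ℝ 2 φ ∧ HolderWith C γ (iteratedFDeriv ℝ 2 φ) ∧
    Ω = {x | φ x < 0} ∧ ∀ x ∈ frontier Ω, fderiv ℝ φ x ≠ 0

section Helpers

open Filter Topology
open scoped ContDiff

/-- Directional derivative along a fixed vector. -/
noncomputable def Dd {E : Type*} [NormedAddCommGroup E] [NormedSpace ℝ E] (e : E) (F : E → ℝ)
    (q : E) : ℝ := fderiv ℝ F q e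

section gen
variable {E : Type*} [NormedAddCommGroup E] [NormedSpace ℝ E]

theorem Dd_contDiff {e : E} {F : E → ℝ} (hF : ContDiff ℝ ∞ F) : ContDiff ℝ ∞ (Dd e F) := by
  have h : ContDiff ℝ ∞ (fderiv ℝ F) := hF.fderiv_right (by norm_num)
  exact h.clm_apply contDiff_const

theorem Dd_mul {e : E} {F G : E → ℝ} {q : E} (hF : DifferentiableAt ℝ F q)
    (hG : DifferentiableAt ℝ G q) :
    Dd e (fun x => F x * G x) q = Dd e F q * G q + F q * Dd e G q := by
  unfold Dd
  rw [fderiv_fun_mul hF hG]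
  simp; ring

theorem Dd_contDiffAt {e : E} {F : E → ℝ} {q : E} (hF : ContDiffAt ℝ ∞ F q) :
    ContDiffAt ℝ ∞ (Dd e F) q := by
  have h : ContDiffAt ℝ ∞ (fderiv ℝ F) q := hF.fderiv_right (by norm_num)
  exact h.clm_apply contDiffAt_const

theorem Dd_commAt {e f : E} {F : E → ℝ} {q : E} (hF : ContDiffAt ℝ ∞ F q) :
    Dd e (Dd f F) q = Dd f (Dd e F) q := by
  have h : ContDiffAt ℝ ∞ (fderiv ℝ F) q := hF.fderiv_right (by norm_num)
  have hd : DifferentiableAt ℝ (fderiv ℝ F) q := h.differentiableAt (by norm_num)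
  have key : ∀ a b : E, Dd a (Dd b F) q = fderiv ℝ (fderiv ℝ F) q a b := by
    intro a b
    unfold Dd
    rw [fderiv_clm_apply hd (differentiableAt_const _)]
    simp
  rw [key, key]
  exact (hF.isSymmSndFDerivAt (by simp; exact ENat.LEInfty.out)).eq e f

theorem Dd_comm {e f : E} {F : E → ℝ} (hF : ContDiff ℝ ∞ F) (q : E) :
    Dd e (Dd f F) q = Dd f (Dd e F) q := Dd_commAt hF.contDiffAt

theorem Dd_compact {e : E} {F : E → ℝ} (hF : HasCompactSupport F) : HasCompactSupport (Dd e F) :=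
  hF.fderiv_apply (𝕜 := ℝ) e

variable [FiniteDimensional ℝ E] [MeasurableSpace E] [BorelSpace E] {μ : Measure E}
  [μ.IsAddHaarMeasure]

set_option linter.unusedSectionVars false in
theorem int_cc {F : E → ℝ} (hF : Continuous F) (hc : HasCompactSupport F) : Integrable F μ :=
  hF.integrable_of_hasCompactSupport hc

theorem ibp {e : E} {F G : E → ℝ} (hF : ContDiff ℝ ∞ F) (hG : ContDiff ℝ ∞ G)
    (hc : HasCompactSupport F) :
    ∫ x, F x * Dd e G x ∂μ = - ∫ x, Dd e F x * G x ∂μ := by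
  unfold Dd
  apply integral_mul_fderiv_eq_neg_fderiv_mul_of_integrable
  · exact int_cc ((Dd_contDiff hF (e := e)).continuous.mul hG.continuous) ((Dd_compact hc).mul_right)
  · exact int_cc (hF.continuous.mul (Dd_contDiff hG (e := e)).continuous) hc.mul_right
  · exact int_cc (hF.continuous.mul hG.continuous) hc.mul_right
  · intro x _; exact (hF.differentiable (by norm_num)).differentiableAt
  · intro x _; exact (hG.differentiable (by norm_num)).differentiableAt

theorem ibp_b {f : E} {b z : E → ℝ} (hz : ContDiff ℝ ∞ z) (hb : ContDiff ℝ ∞ b)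
    (hc : HasCompactSupport z) :
    ∫ x, b x * z x * Dd f z x ∂μ = - (1/2) * ∫ x, Dd f b x * z x ^ 2 ∂μ := by
  have h := ibp (μ := μ) (e := f) (F := fun x => z x * z x) (G := b) (hz.mul hz) hb hc.mul_right
  have hd : Differentiable ℝ z := hz.differentiable (by norm_num)
  have e1 : ∀ x, Dd f (fun x => z x * z x) x * b x = 2 * (b x * z x * Dd f z x) := by
    intro x; rw [Dd_mul hd.differentiableAt hd.differentiableAt]; ring
  simp_rw [e1] at h
  rw [integral_const_mul] at h
  have e2 : (fun x => z x * z x * Dd f b x) = fun x => Dd f b x * z x ^ 2 := by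
    ext x; ring
  rw [e2] at h
  linarith

theorem ibp_a {e f : E} {a z : E → ℝ} (hz : ContDiff ℝ ∞ z) (ha : ContDiff ℝ ∞ a)
    (hc : HasCompactSupport z) :
    ∫ x, a x * Dd f z x * Dd e (Dd e z) x ∂μ
      = - (∫ x, Dd e a x * Dd e z x * Dd f z x ∂μ) + (1/2) * ∫ x, Dd f a x * Dd e z x ^ 2 ∂μ := by
  have hze := Dd_contDiff (e := e) hz
  have hzf := Dd_contDiff (e := f) hz
  have h := ibp (μ := μ) (e := e) (F := fun x => a x * Dd f z x) (G := Dd e z)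
    (ha.mul hzf) hze (Dd_compact hc).mul_left
  have hb := ibp_b (μ := μ) (f := f) (b := a) (z := Dd e z) hze ha (Dd_compact hc)
  have e1 : ∀ x, Dd e (fun x => a x * Dd f z x) x * Dd e z x
      = Dd e a x * Dd e z x * Dd f z x + a x * Dd e z x * Dd f (Dd e z) x := by
    intro x
    rw [Dd_mul (ha.differentiable (by norm_num)).differentiableAt
      (hzf.differentiable (by norm_num)).differentiableAt, Dd_comm hz]
    ring
  simp_rw [e1] at h
  rw [integral_add, hb] at h
  · rw [h]; ring
  · refine int_cc ?_ ?_
    · exact ((Dd_contDiff ha (e := e)).continuous.mul hze.continuous).mul hzf.continuous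
    · exact (Dd_compact hc).mul_left
  · refine int_cc ?_ ?_
    · exact (ha.continuous.mul hze.continuous).mul (Dd_contDiff hze).continuous
    · exact (Dd_compact (Dd_compact hc)).mul_left

theorem ibp_c {e : E} {z : E → ℝ} (hz : ContDiff ℝ ∞ z) (hc : HasCompactSupport z) :
    ∫ x, z x * Dd e (Dd e z) x ∂μ = - ∫ x, Dd e z x ^ 2 ∂μ := by
  rw [ibp hz (Dd_contDiff hz) hc]
  simp_rw [sq]

end gen

section gen
variable {E : Type*} [NormedAddCommGroup E] [NormedSpace ℝ E]
variable [FiniteDimensional ℝ E] [MeasurableSpace E] [BorelSpace E] {μ : Measure E}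
  [μ.IsAddHaarMeasure]

theorem carl_core {ι : Type*} [Fintype ι] (ei : ι → E) (et : E) (z : E → ℝ) (hz : ContDiff ℝ ∞ z)
    (hc : HasCompactSupport z) (a : ι → E → ℝ) (ha : ∀ i, ContDiff ℝ ∞ (a i)) (H : ι → ι → ℝ)
    (hH : ∀ i j x, Dd (ei j) (a i) x = H i j) 
    (Q : E → ℝ) (hQ : ContDiff ℝ ∞ Q) (s m : ℝ) :
    ∫ x, (-(∑ i, Dd (ei i) (Dd (ei i) z) x) - Q x * z x) *
      (Dd et z x + 2 * s * ∑ i, a i x * Dd (ei i) z x + (s * (∑ i, H i i) - s * m) * z x) ∂μ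
    = ∫ x, (2 * s * (∑ i, ∑ j, H j i * Dd (ei i) z x * Dd (ei j) z x)
        - s * m * ∑ i, Dd (ei i) z x ^ 2
        + ((1/2) * Dd et Q x + s * (∑ j, a j x * Dd (ei j) Q x) + s * m * Q x) * z x ^ 2) ∂μ := by
  have cz := hz.continuous
  have czi : ∀ e, Continuous (Dd e z) := fun e => (Dd_contDiff hz).continuous
  have czz : ∀ e f, Continuous (Dd e (Dd f z)) := fun e f =>
    (Dd_contDiff (Dd_contDiff hz)).continuous
  have ca := fun i => (ha i).continuous
  have cQ := hQ.continuous
  have cQi : ∀ e, Continuous (Dd e Q) := fun e => (Dd_contDiff hQ).continuous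
  have kz : ∀ e, HasCompactSupport (Dd e z) := fun e => Dd_compact hc
  -- the five zero integrals
  have T1 : ∀ i, (Integrable (fun x => 1 * Dd et z x * Dd (ei i) (Dd (ei i) z) x) μ) ∧
      ∫ x, 1 * Dd et z x * Dd (ei i) (Dd (ei i) z) x ∂μ = 0 := by
    intro i
    refine ⟨int_cc (by fun_prop) (Dd_compact (kz _)).mul_left, ?_⟩
    rw [ibp_a (a := fun _ => (1:ℝ)) hz contDiff_const hc]
    have : ∀ (e x : E), Dd e (fun _ => (1:ℝ)) x = 0 := by intro e x; simp [Dd]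
    simp [this]
  have T2 : ∀ i j, (Integrable (fun x => a j x * Dd (ei j) z x * Dd (ei i) (Dd (ei i) z) x
        + H j i * Dd (ei i) z x * Dd (ei j) z x - (1/2) * (H j j * Dd (ei i) z x ^ 2)) μ) ∧
      ∫ x, (a j x * Dd (ei j) z x * Dd (ei i) (Dd (ei i) z) x
        + H j i * Dd (ei i) z x * Dd (ei j) z x - (1/2) * (H j j * Dd (ei i) z x ^ 2)) ∂μ = 0 := by
    intro i j
    have i1 : Integrable (fun x => a j x * Dd (ei j) z x * Dd (ei i) (Dd (ei i) z) x) μ :=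
      int_cc (by fun_prop) (Dd_compact (kz _)).mul_left
    have i2 : Integrable (fun x => H j i * Dd (ei i) z x * Dd (ei j) z x) μ :=
      int_cc (by fun_prop) (kz _).mul_left
    have i3 : Integrable (fun x => (1/2) * (H j j * Dd (ei i) z x ^ 2)) μ := by
      refine Integrable.const_mul (Integrable.const_mul ?_ _) _
      simp_rw [sq]
      exact int_cc (by fun_prop) (kz _).mul_left
    refine ⟨(i1.add i2).sub i3, ?_⟩
    rw [integral_sub (by exact i1.add i2) i3, integral_add i1 i2, ibp_a hz (ha j) hc]
    simp only [hH, integral_const_mul]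
    ring
  have T3 : ∀ i, (Integrable (fun x => z x * Dd (ei i) (Dd (ei i) z) x + Dd (ei i) z x ^ 2) μ) ∧
      ∫ x, (z x * Dd (ei i) (Dd (ei i) z) x + Dd (ei i) z x ^ 2) ∂μ = 0 := by
    intro i
    have i1 : Integrable (fun x => z x * Dd (ei i) (Dd (ei i) z) x) μ :=
      int_cc (by fun_prop) (Dd_compact (kz _)).mul_left
    have i3 : Integrable (fun x => Dd (ei i) z x ^ 2) μ := by
      simp_rw [sq]
      exact int_cc (by fun_prop) (kz _).mul_left
    refine ⟨i1.add i3, ?_⟩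
    rw [integral_add i1 i3, ibp_c hz hc]; ring
  have TB : ∀ (f : E) (b : E → ℝ), ContDiff ℝ ∞ b →
      (Integrable (fun x => b x * z x * Dd f z x + (1/2) * (Dd f b x * z x ^ 2)) μ) ∧
      ∫ x, (b x * z x * Dd f z x + (1/2) * (Dd f b x * z x ^ 2)) ∂μ = 0 := by
    intro f b hb
    have cb := hb.continuous
    have cbf : Continuous (Dd f b) := (Dd_contDiff hb).continuous
    have i1 : Integrable (fun x => b x * z x * Dd f z x) μ :=
      int_cc (by fun_prop) ((kz _)).mul_left
    have i3 : Integrable (fun x => (1/2) * (Dd f b x * z x ^ 2)) μ := by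
      refine Integrable.const_mul ?_ _
      have : (fun x => Dd f b x * z x ^ 2) = fun x => Dd f b x * z x * z x := by ext x; ring
      rw [this]
      exact int_cc (by fun_prop) hc.mul_left
    refine ⟨i1.add i3, ?_⟩
    rw [integral_add i1 i3, ibp_b hz hb hc, integral_const_mul]; ring
  have T4 := TB et Q hQ
  have T5 : ∀ j, (Integrable (fun x => Q x * a j x * z x * Dd (ei j) z x +
        (1/2) * ((Dd (ei j) Q x * a j x + Q x * H j j) * z x ^ 2)) μ) ∧
      ∫ x, (Q x * a j x * z x * Dd (ei j) z x +
        (1/2) * ((Dd (ei j) Q x * a j x + Q x * H j j) * z x ^ 2)) ∂μ = 0 := by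
    intro j
    have := TB (ei j) (fun x => Q x * a j x) (hQ.mul (ha j))
    have e : ∀ x, Dd (ei j) (fun x => Q x * a j x) x = Dd (ei j) Q x * a j x + Q x * H j j := by
      intro x
      rw [Dd_mul (hQ.differentiable (by norm_num)).differentiableAt
        ((ha j).differentiable (by norm_num)).differentiableAt, hH]
    simpa only [e] using this
  rw [← sub_eq_zero, ← integral_sub]
  rotate_left
  · refine int_cc (by fun_prop) ?_
    refine HasCompactSupport.intro hc ?_
    intro x hx
    have z0 : z x = 0 := image_eq_zero_of_notMem_tsupport hx
    have zi : ∀ e, Dd e z x = 0 := fun e => by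
      have : x ∉ tsupport (Dd e z) := fun h => hx (tsupport_fderiv_apply_subset ℝ e h)
      exact image_eq_zero_of_notMem_tsupport this
    simp [z0, zi]
  · refine int_cc (by fun_prop) ?_
    refine HasCompactSupport.intro hc ?_
    intro x hx
    have z0 : z x = 0 := image_eq_zero_of_notMem_tsupport hx
    have zi : ∀ e, Dd e z x = 0 := fun e => by
      have : x ∉ tsupport (Dd e z) := fun h => hx (tsupport_fderiv_apply_subset ℝ e h)
      exact image_eq_zero_of_notMem_tsupport this
    simp [z0, zi]
  have hS1 : Integrable (fun x => ∑ i, 1 * Dd et z x * Dd (ei i) (Dd (ei i) z) x) μ :=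
    integrable_finsetSum _ fun i _ => (T1 i).1
  have hS2 : Integrable (fun x => ∑ i, ∑ j, (a j x * Dd (ei j) z x * Dd (ei i) (Dd (ei i) z) x
        + H j i * Dd (ei i) z x * Dd (ei j) z x - (1/2) * (H j j * Dd (ei i) z x ^ 2))) μ :=
    integrable_finsetSum _ fun i _ => integrable_finsetSum _ fun j _ => (T2 i j).1
  have hS3 : Integrable (fun x => ∑ i, (z x * Dd (ei i) (Dd (ei i) z) x + Dd (ei i) z x ^ 2)) μ :=
    integrable_finsetSum _ fun i _ => (T3 i).1
  have hS5 : Integrable (fun x => ∑ j, (Q x * a j x * z x * Dd (ei j) z x +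
        (1/2) * ((Dd (ei j) Q x * a j x + Q x * H j j) * z x ^ 2))) μ :=
    integrable_finsetSum _ fun i _ => (T5 i).1
  have Z1 : ∫ x, (∑ i, 1 * Dd et z x * Dd (ei i) (Dd (ei i) z) x) ∂μ = 0 := by
    rw [integral_finsetSum _ fun i _ => (T1 i).1]
    exact Finset.sum_eq_zero fun i _ => (T1 i).2
  have Z2 : ∫ x, (∑ i, ∑ j, (a j x * Dd (ei j) z x * Dd (ei i) (Dd (ei i) z) x
        + H j i * Dd (ei i) z x * Dd (ei j) z x - (1/2) * (H j j * Dd (ei i) z x ^ 2))) ∂μ = 0 := by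
    rw [integral_finsetSum _ fun i _ => integrable_finsetSum _ fun j _ => (T2 i j).1]
    refine Finset.sum_eq_zero fun i _ => ?_
    rw [integral_finsetSum _ fun j _ => (T2 i j).1]
    exact Finset.sum_eq_zero fun j _ => (T2 i j).2
  have Z3 : ∫ x, (∑ i, (z x * Dd (ei i) (Dd (ei i) z) x + Dd (ei i) z x ^ 2)) ∂μ = 0 := by
    rw [integral_finsetSum _ fun i _ => (T3 i).1]
    exact Finset.sum_eq_zero fun i _ => (T3 i).2
  have Z5 : ∫ x, (∑ j, (Q x * a j x * z x * Dd (ei j) z x +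
        (1/2) * ((Dd (ei j) Q x * a j x + Q x * H j j) * z x ^ 2))) ∂μ = 0 := by
    rw [integral_finsetSum _ fun i _ => (T5 i).1]
    exact Finset.sum_eq_zero fun i _ => (T5 i).2
  have J1 := hS1.const_mul (-1)
  have J2 := hS2.const_mul (-(2*s))
  have J3 := hS3.const_mul (-(s * (∑ i, H i i) - s * m))
  have J4 := T4.1.const_mul (-1)
  have J5 := hS5.const_mul (-(2*s))
  have tot : ∫ x, (-1 * (∑ i, 1 * Dd et z x * Dd (ei i) (Dd (ei i) z) x)
      + (-(2*s)) * (∑ i, ∑ j, (a j x * Dd (ei j) z x * Dd (ei i) (Dd (ei i) z) x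
        + H j i * Dd (ei i) z x * Dd (ei j) z x - (1/2) * (H j j * Dd (ei i) z x ^ 2)))
      + (-(s * (∑ i, H i i) - s * m)) * 
        (∑ i, (z x * Dd (ei i) (Dd (ei i) z) x + Dd (ei i) z x ^ 2))
      + -1 * (Q x * z x * Dd et z x + (1/2) * (Dd et Q x * z x ^ 2))
      + (-(2*s)) * (∑ j, (Q x * a j x * z x * Dd (ei j) z x +
        (1/2) * ((Dd (ei j) Q x * a j x + Q x * H j j) * z x ^ 2)))) ∂μ = 0 := by
    rw [integral_add (by exact ((J1.add J2).add J3).add J4) J5,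
      integral_add (by exact (J1.add J2).add J3) J4, integral_add (by exact J1.add J2) J3,
      integral_add J1 J2, integral_const_mul, integral_const_mul, integral_const_mul,
      integral_const_mul, integral_const_mul, Z1, Z2, Z3, T4.2, Z5]
    ring
  rw [← tot]
  congr 1
  ext x
  have e1 : ∑ i, 1 * Dd et z x * Dd (ei i) (Dd (ei i) z) x
      = Dd et z x * ∑ i, Dd (ei i) (Dd (ei i) z) x := by
    rw [Finset.mul_sum]; simp
  have e2 : ∑ i, ∑ j, (a j x * Dd (ei j) z x * Dd (ei i) (Dd (ei i) z) x
        + H j i * Dd (ei i) z x * Dd (ei j) z x - (1/2) * (H j j * Dd (ei i) z x ^ 2))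
      = (∑ i, Dd (ei i) (Dd (ei i) z) x) * (∑ j, a j x * Dd (ei j) z x)
        + (∑ i, ∑ j, H j i * Dd (ei i) z x * Dd (ei j) z x)
        - (1/2) * ((∑ j, H j j) * ∑ i, Dd (ei i) z x ^ 2) := by
    rw [Finset.sum_mul_sum, Finset.sum_mul_sum, Finset.sum_comm (f := fun i j => H i i * _),
      Finset.mul_sum, ← Finset.sum_add_distrib,
      ← Finset.sum_sub_distrib]
    refine Finset.sum_congr rfl fun i _ => ?_
    rw [Finset.mul_sum, ← Finset.sum_add_distrib, ← Finset.sum_sub_distrib]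
    refine Finset.sum_congr rfl fun j _ => ?_
    ring
  have e3 : ∑ i, (z x * Dd (ei i) (Dd (ei i) z) x + Dd (ei i) z x ^ 2)
      = z x * (∑ i, Dd (ei i) (Dd (ei i) z) x) + ∑ i, Dd (ei i) z x ^ 2 := by
    rw [Finset.mul_sum, ← Finset.sum_add_distrib]
  have e5 : ∑ j, (Q x * a j x * z x * Dd (ei j) z x +
        (1/2) * ((Dd (ei j) Q x * a j x + Q x * H j j) * z x ^ 2))
      = Q x * z x * (∑ j, a j x * Dd (ei j) z x) + (1/2) * z x ^ 2 *
        (∑ j, a j x * Dd (ei j) Q x) + (1/2) * z x ^ 2 * Q x * ∑ j, H j j := by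
    rw [Finset.mul_sum, Finset.mul_sum, Finset.mul_sum, ← Finset.sum_add_distrib,
      ← Finset.sum_add_distrib]
    refine Finset.sum_congr rfl fun j _ => ?_
    ring
  rw [e1, e2, e3, e5]
  ring
end gen

section rules
variable {E : Type*} [NormedAddCommGroup E] [NormedSpace ℝ E]

theorem Dd_exp_mul {e : E} {φ w : E → ℝ} (s : ℝ) {q : E} (hφ : DifferentiableAt ℝ φ q)
    (hw : DifferentiableAt ℝ w q) :
    Dd e (fun q => Real.exp (s * φ q) * w q) q
      = Real.exp (s * φ q) * (Dd e w q + s * Dd e φ q * w q) := by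
  have h1 : DifferentiableAt ℝ (fun q => s * φ q) q := hφ.const_mul s
  rw [Dd_mul h1.exp hw]
  unfold Dd
  rw [fderiv_exp h1, fderiv_const_mul hφ]
  simp; ring

theorem Dd_add {e : E} {F G : E → ℝ} {q : E} (hF : DifferentiableAt ℝ F q)
    (hG : DifferentiableAt ℝ G q) :
    Dd e (fun x => F x + G x) q = Dd e F q + Dd e G q := by
  unfold Dd
  rw [fderiv_fun_add hF hG]; simp

theorem Dd_sub {e : E} {F G : E → ℝ} {q : E} (hF : DifferentiableAt ℝ F q)
    (hG : DifferentiableAt ℝ G q) :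
    Dd e (fun x => F x - G x) q = Dd e F q - Dd e G q := by
  unfold Dd
  rw [fderiv_fun_sub hF hG]; simp

theorem Dd_of {e : E} {F : E → ℝ} {F' : E →L[ℝ] ℝ} {q : E} (h : HasFDerivAt F F' q) :
    Dd e F q = F' e := by unfold Dd; rw [h.fderiv]
end rules

/-- spatial basis vector in space-time -/
noncomputable def ex {d : ℕ} (i : Fin d) : (Fin d → ℝ) × ℝ := (Pi.single i 1, 0)
/-- time basis vector in space-time -/
noncomputable def et {d : ℕ} : (Fin d → ℝ) × ℝ := (0, 1)

instance instHaarST (d : ℕ) : (volume : Measure ((Fin d → ℝ) × ℝ)).IsAddHaarMeasure :=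
  inferInstanceAs ((volume : Measure (Fin d → ℝ)).prod (volume : Measure ℝ)).IsAddHaarMeasure

section weight
variable {d : ℕ} (n x0 : Fin d → ℝ) (t0 b K : ℝ)

noncomputable def wN (q : (Fin d → ℝ) × ℝ) : ℝ := ∑ i, n i * (q.1 i - x0 i)
noncomputable def wR (q : (Fin d → ℝ) × ℝ) : ℝ := ∑ i, (q.1 i - x0 i) ^ 2
noncomputable def wphi (q : (Fin d → ℝ) × ℝ) : ℝ :=
  -b * wN n x0 q + 5 / 2 * wN n x0 q ^ 2 - wR x0 q / 2 - K * (q.2 - t0) ^ 2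
noncomputable def wa (i : Fin d) (q : (Fin d → ℝ) × ℝ) : ℝ :=
  -b * n i + 5 * wN n x0 q * n i - (q.1 i - x0 i)
noncomputable def wft (q : (Fin d → ℝ) × ℝ) : ℝ := -2 * K * (q.2 - t0)

theorem wN_contDiff : ContDiff ℝ ∞ (wN n x0) := by unfold wN; fun_prop
theorem wR_contDiff : ContDiff ℝ ∞ (wR x0) := by unfold wR; fun_prop
theorem wphi_contDiff : ContDiff ℝ ∞ (wphi n x0 t0 b K) := by
  have := wN_contDiff n x0
  have := wR_contDiff x0
  unfold wphi; fun_prop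
theorem wa_contDiff (i : Fin d) : ContDiff ℝ ∞ (wa n x0 b i) := by
  have := wN_contDiff n x0
  unfold wa; fun_prop
theorem wft_contDiff : ContDiff ℝ ∞ (wft (d := d) t0 K) := by unfold wft; fun_prop

/-- line-derivative way to compute `Dd`. -/
theorem Dd_line {E : Type*} [NormedAddCommGroup E] [NormedSpace ℝ E] {e : E} {F : E → ℝ} {q : E}
    {c : ℝ} (hF : DifferentiableAt ℝ F q) (h : HasDerivAt (fun r : ℝ => F (q + r • e)) c 0) :
    Dd e F q = c := by
  have := hF.hasFDerivAt.hasLineDerivAt e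
  exact this.unique h

theorem xl_hd (q : (Fin d → ℝ) × ℝ) (i j : Fin d) :
    HasDerivAt (fun r : ℝ => (q + r • ex j).1 i - x0 i) (if i = j then 1 else 0) 0 := by
  have : (fun r : ℝ => (q + r • ex j).1 i - x0 i)
      = fun r : ℝ => q.1 i + r * (if i = j then 1 else 0) - x0 i := by
    ext r; simp [ex, Pi.single_apply]
  rw [this]
  simpa using ((((hasDerivAt_id (0:ℝ)).mul_const (if i = j then (1:ℝ) else 0)).const_add
    (q.1 i)).sub_const (x0 i))

theorem wN_hd (q : (Fin d → ℝ) × ℝ) (j : Fin d) :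
    HasDerivAt (fun r : ℝ => wN n x0 (q + r • ex j)) (n j) 0 := by
  unfold wN
  have := HasDerivAt.fun_sum (u := Finset.univ) (fun i _ => (xl_hd x0 q i j).const_mul (n i))
  simpa using this

theorem wR_hd (q : (Fin d → ℝ) × ℝ) (j : Fin d) :
    HasDerivAt (fun r : ℝ => wR x0 (q + r • ex j)) (2 * (q.1 j - x0 j)) 0 := by
  unfold wR
  have := HasDerivAt.fun_sum (u := Finset.univ) (fun i _ => (xl_hd x0 q i j).pow 2)
  simpa [ex] using this

theorem wphi_dx (q : (Fin d → ℝ) × ℝ) (j : Fin d) :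
    Dd (ex j) (wphi n x0 t0 b K) q = wa n x0 b j q := by
  apply Dd_line ((wphi_contDiff n x0 t0 b K).differentiable (by norm_num)).differentiableAt
  have h1 := wN_hd n x0 q j
  have h2 := wR_hd x0 q j
  have := (((h1.const_mul (-b)).add ((h1.pow 2).const_mul (5/2))).sub (h2.div_const 2)).sub_const
    (K * (q.2 - t0)^2)
  have hf : (fun r : ℝ => wphi n x0 t0 b K (q + r • ex j)) = fun r : ℝ =>
      -b * wN n x0 (q + r • ex j) + 5 / 2 * wN n x0 (q + r • ex j) ^ 2
       - wR x0 (q + r • ex j) / 2 - K * (q.2 - t0) ^ 2 := by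
    ext r; simp [wphi, ex]
  rw [hf]
  refine HasDerivAt.congr_deriv this ?_
  simp [wa]; ring

theorem wphi_dt (q : (Fin d → ℝ) × ℝ) :
    Dd et (wphi n x0 t0 b K) q = wft t0 K q := by
  apply Dd_line ((wphi_contDiff n x0 t0 b K).differentiable (by norm_num)).differentiableAt
  have h : HasDerivAt (fun r : ℝ => (-b * wN n x0 q + 5 / 2 * wN n x0 q ^ 2 - wR x0 q / 2)
      - K * (q.2 + r - t0) ^ 2) (-(K * (2 * (q.2 + 0 - t0)))) 0 := by
    have := (((((hasDerivAt_id (0:ℝ)).const_add q.2).sub_const t0).pow 2).const_mul K).const_sub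
      (-b * wN n x0 q + 5 / 2 * wN n x0 q ^ 2 - wR x0 q / 2)
    refine HasDerivAt.congr_deriv this ?_
    simp
  have hf : (fun r : ℝ => wphi n x0 t0 b K (q + r • et)) = fun r : ℝ =>
      (-b * wN n x0 q + 5 / 2 * wN n x0 q ^ 2 - wR x0 q / 2) - K * (q.2 + r - t0) ^ 2 := by
    ext r; simp [wphi, et, wN, wR]
  rw [hf]
  refine HasDerivAt.congr_deriv h ?_
  simp [wft]; ring

theorem wa_dx (q : (Fin d → ℝ) × ℝ) (i j : Fin d) :
    Dd (ex j) (wa n x0 b i) q = 5 * n j * n i - (if i = j then 1 else 0) := by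
  apply Dd_line ((wa_contDiff n x0 b i).differentiable (by norm_num)).differentiableAt
  exact ((((wN_hd n x0 q j).const_mul 5).mul_const (n i)).const_add (-b * n i)).sub (xl_hd x0 q i j)

theorem wa_dt (q : (Fin d → ℝ) × ℝ) (i : Fin d) :
    Dd et (wa n x0 b i) q = 0 := by
  apply Dd_line ((wa_contDiff n x0 b i).differentiable (by norm_num)).differentiableAt
  have : (fun r : ℝ => wa n x0 b i (q + r • et)) = fun _ => wa n x0 b i q := by
    ext r; simp [wa, wN, et]
  rw [this]; exact hasDerivAt_const _ _

theorem wft_dx (q : (Fin d → ℝ) × ℝ) (i : Fin d) :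
    Dd (ex i) (wft t0 K) q = 0 := by
  apply Dd_line ((wft_contDiff t0 K).differentiable (by norm_num)).differentiableAt
  have : (fun r : ℝ => wft t0 K (q + r • ex i)) = fun _ => wft t0 K q := by
    ext r; simp [wft, ex]
  rw [this]; exact hasDerivAt_const _ _

theorem wft_dt (q : (Fin d → ℝ) × ℝ) :
    Dd et (wft t0 K) q = -2 * K := by
  apply Dd_line ((wft_contDiff t0 K).differentiable (by norm_num)).differentiableAt
  have : (fun r : ℝ => wft t0 K (q + r • et)) = fun r => -2 * K * (q.2 + r - t0) := by
    ext r; simp [wft, et]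
  rw [this]
  simpa using ((((hasDerivAt_id (0:ℝ)).const_add q.2).sub_const t0).const_mul (-2 * K))

/-- the zeroth order coefficient `Q`. -/
noncomputable def wQ (s : ℝ) (q : (Fin d → ℝ) × ℝ) : ℝ :=
  s ^ 2 * (∑ i, wa n x0 b i q ^ 2) + s * wft t0 K q + 3 * s

theorem wQ_contDiff (s : ℝ) : ContDiff ℝ ∞ (wQ n x0 t0 b K s) := by
  have := wa_contDiff n x0 b
  have := wft_contDiff (d := d) t0 K
  unfold wQ; fun_prop

theorem Dd_wQ (s : ℝ) (e q : (Fin d → ℝ) × ℝ) :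
    Dd e (wQ n x0 t0 b K s) q = s ^ 2 * (∑ i, 2 * wa n x0 b i q * Dd e (wa n x0 b i) q)
      + s * Dd e (wft t0 K) q := by
  have h1 : ∀ i, HasFDerivAt (wa n x0 b i) (fderiv ℝ (wa n x0 b i) q) q := fun i =>
    ((wa_contDiff n x0 b i).differentiable (by norm_num)).differentiableAt.hasFDerivAt
  have h2 : HasFDerivAt (wft t0 K) (fderiv ℝ (wft t0 K) q) q :=
    ((wft_contDiff t0 K).differentiable (by norm_num)).differentiableAt.hasFDerivAt
  have h3 := ((((HasFDerivAt.fun_sum (u := Finset.univ) (fun i _ => (h1 i).pow 2)).const_mul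
    (s^2)).add (h2.const_mul s)).add_const (3 * s))
  rw [Dd_of (F := wQ n x0 t0 b K s) h3]
  simp [Dd, mul_assoc]

theorem wQ_dx (s : ℝ) (q : (Fin d → ℝ) × ℝ) (j : Fin d) :
    Dd (ex j) (wQ n x0 t0 b K s) q
      = 2 * s ^ 2 * (5 * n j * (∑ i, n i * wa n x0 b i q) - wa n x0 b j q) := by
  rw [Dd_wQ, wft_dx]
  simp_rw [wa_dx]
  have : ∑ i, 2 * wa n x0 b i q * (5 * n j * n i - (if i = j then 1 else 0))
      = 2 * (5 * n j * (∑ i, n i * wa n x0 b i q) - wa n x0 b j q) := by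
    simp_rw [mul_sub, Finset.sum_sub_distrib, Finset.mul_sum]
    congr 1
    · refine Finset.sum_congr rfl fun i _ => by ring
    · simp
  rw [this]; ring

theorem wQ_dt (s : ℝ) (q : (Fin d → ℝ) × ℝ) :
    Dd et (wQ n x0 t0 b K s) q = -2 * K * s := by
  rw [Dd_wQ, wft_dt]
  simp_rw [wa_dt]
  simp; ring

theorem carleman (s : ℝ) (hs : 0 ≤ s) (w : (Fin d → ℝ) × ℝ → ℝ)
    (hw : ContDiff ℝ ∞ w) (hc : HasCompactSupport w) (c : ℝ)
    (hcoef : ∀ q, w q ≠ 0 → c ≤ s ^ 3 * (10 * (∑ i, n i * wa n x0 b i q) ^ 2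
      - 5 * ∑ i, wa n x0 b i q ^ 2) - 3 * s ^ 2 * wft t0 K q - 9 * s ^ 2 - K * s) :
    4 * ∫ q, (s * ∑ i, Dd (ex i) (fun q => Real.exp (s * wphi n x0 t0 b K q) * w q) q ^ 2
      + c * (Real.exp (s * wphi n x0 t0 b K q) * w q) ^ 2)
    ≤ ∫ q, (Real.exp (s * wphi n x0 t0 b K q) * (Dd et w q - ∑ i, Dd (ex i) (Dd (ex i) w) q)) ^ 2 := by
  set φ := wphi n x0 t0 b K with hφ
  have cφ : ContDiff ℝ ∞ φ := wphi_contDiff n x0 t0 b K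
  set z : (Fin d → ℝ) × ℝ → ℝ := fun q => Real.exp (s * φ q) * w q with hzdef
  have hz : ContDiff ℝ ∞ z := by fun_prop
  have hzc : HasCompactSupport z := hc.mul_left
  have dφ : Differentiable ℝ φ := cφ.differentiable (by norm_num)
  have dw : Differentiable ℝ w := hw.differentiable (by norm_num)
  have zx : ∀ i, Dd (ex i) z = fun q => Real.exp (s * φ q) *
      (Dd (ex i) w q + s * (wa n x0 b i q * w q)) := by
    intro i; ext q
    rw [hzdef, Dd_exp_mul s dφ.differentiableAt dw.differentiableAt, hφ, wphi_dx]
    ring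
  have zt : ∀ q, Dd et z q = Real.exp (s * φ q) * (Dd et w q + s * wft t0 K q * w q) := by
    intro q
    rw [hzdef, Dd_exp_mul s dφ.differentiableAt dw.differentiableAt, hφ, wphi_dt]
  have da : ∀ i, Differentiable ℝ (wa n x0 b i) := fun i =>
    (wa_contDiff n x0 b i).differentiable (by norm_num)
  have dwx : ∀ i, Differentiable ℝ (Dd (ex i) w) := fun i =>
    (Dd_contDiff hw).differentiable (by norm_num)
  have zxx : ∀ i q, Dd (ex i) (Dd (ex i) z) q = Real.exp (s * φ q) *
      (Dd (ex i) (Dd (ex i) w) q + 2 * s * wa n x0 b i q * Dd (ex i) w q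
        + s * (5 * n i * n i - 1) * w q + s ^ 2 * wa n x0 b i q ^ 2 * w q) := by
    intro i q
    have hd2 : DifferentiableAt ℝ (fun q => s * (wa n x0 b i q * w q)) q :=
      (((da i).fun_mul dw).const_mul s).differentiableAt
    rw [zx i, Dd_exp_mul s dφ.differentiableAt
      ((dwx i).differentiableAt.fun_add hd2),
      Dd_add (dwx i).differentiableAt hd2]
    have : Dd (ex i) (fun q => s * (wa n x0 b i q * w q)) q
      = s * ((5 * n i * n i - 1) * w q + wa n x0 b i q * Dd (ex i) w q) := by
      have h := Dd_mul (e := ex i) (F := fun _ => s) (G := fun q => wa n x0 b i q * w q) (q := q)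
        (differentiableAt_const _) ((da i).mul dw).differentiableAt
      rw [h, Dd_mul (da i).differentiableAt dw.differentiableAt, wa_dx]
      simp [Dd]
    rw [this, hφ, wphi_dx]
    ring
  have core := carl_core (μ := volume) ex et z hz hzc (wa n x0 b) (wa_contDiff n x0 b)
    (fun i j => 5 * n j * n i - (if i = j then 1 else 0)) (fun i j q => wa_dx n x0 b q i j)
    (wQ n x0 t0 b K s) (wQ_contDiff n x0 t0 b K s) s (-3)
  have hcz : Continuous z := hz.continuous
  have hczi : ∀ e, Continuous (Dd e z) := fun e => (Dd_contDiff hz).continuous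
  have hczz : ∀ e f, Continuous (Dd e (Dd f z)) := fun e f =>
    (Dd_contDiff (Dd_contDiff hz)).continuous
  have hwe : ∀ e, Continuous (Dd e w) := fun e => (Dd_contDiff hw).continuous
  have hwee : ∀ e f, Continuous (Dd e (Dd f w)) := fun e f =>
    (Dd_contDiff (Dd_contDiff hw)).continuous
  have hca : ∀ i, Continuous (wa n x0 b i) := fun i => (wa_contDiff n x0 b i).continuous
  have hcQ : Continuous (wQ n x0 t0 b K s) := (wQ_contDiff n x0 t0 b K s).continuous
  have hcQe : ∀ e, Continuous (Dd e (wQ n x0 t0 b K s)) := fun e =>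
    (Dd_contDiff (wQ_contDiff n x0 t0 b K s)).continuous
  have hcφ := cφ.continuous
  have zsupp : ∀ q, q ∉ tsupport z → z q = 0 ∧ ∀ e, Dd e z q = 0 := by
    intro q hq
    refine ⟨image_eq_zero_of_notMem_tsupport hq, fun e => ?_⟩
    have : q ∉ tsupport (Dd e z) := fun h => hq (tsupport_fderiv_apply_subset ℝ e h)
    exact image_eq_zero_of_notMem_tsupport this
  have wsupp : ∀ q, q ∉ tsupport w → w q = 0 ∧ ∀ e, Dd e w q = 0 := by
    intro q hq
    refine ⟨image_eq_zero_of_notMem_tsupport hq, fun e => ?_⟩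
    have : q ∉ tsupport (Dd e w) := fun h => hq (tsupport_fderiv_apply_subset ℝ e h)
    exact image_eq_zero_of_notMem_tsupport this
  have wsupp2 : ∀ q, q ∉ tsupport w → ∀ e f, Dd e (Dd f w) q = 0 := by
    intro q hq e f
    have h1 : q ∉ tsupport (Dd f w) := fun h => hq (tsupport_fderiv_apply_subset ℝ f h)
    have : q ∉ tsupport (Dd e (Dd f w)) := fun h => h1 (tsupport_fderiv_apply_subset ℝ e h)
    exact image_eq_zero_of_notMem_tsupport this
  have trH : ∑ i : Fin d, (5 * n i * n i - (if i = i then 1 else 0)) = ∑ i, (5 * n i * n i - 1) := by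
    simp
  -- lower bound of the right-hand side of core
  have low : ∫ q, (s * ∑ i, Dd (ex i) z q ^ 2 + c * z q ^ 2) ≤
     ∫ x, (2 * s * (∑ i, ∑ j, (5 * n i * n j - (if j = i then 1 else 0)) * Dd (ex i) z x * Dd (ex j) z x)
        - s * (-3) * ∑ i, Dd (ex i) z x ^ 2
        + ((1/2) * Dd et (wQ n x0 t0 b K s) x + s * (∑ j, wa n x0 b j x * Dd (ex j) (wQ n x0 t0 b K s) x)
          + s * (-3) * wQ n x0 t0 b K s x) * z x ^ 2) := by
    apply integral_mono
    · refine int_cc (by fun_prop) (HasCompactSupport.intro hzc ?_)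
      intro q hq
      simp [zsupp q hq]
    · refine int_cc (by fun_prop) (HasCompactSupport.intro hzc ?_)
      intro q hq
      simp [zsupp q hq]
    · intro q
      have e1 : ∑ i, ∑ j, (5 * n i * n j - (if j = i then 1 else 0)) * Dd (ex i) z q * Dd (ex j) z q
          = 5 * (∑ i, n i * Dd (ex i) z q) ^ 2 - ∑ i, Dd (ex i) z q ^ 2 := by
        rw [sq, Finset.sum_mul_sum, Finset.mul_sum, ← Finset.sum_sub_distrib]
        refine Finset.sum_congr rfl fun i _ => ?_
        rw [Finset.mul_sum]
        have : ∀ j, (5 * n i * n j - (if j = i then 1 else 0)) * Dd (ex i) z q * Dd (ex j) z q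
          = 5 * (n i * Dd (ex i) z q * (n j * Dd (ex j) z q)) - (if j = i then Dd (ex i) z q * Dd (ex j) z q else 0) := by
          intro j; split_ifs <;> ring
        simp_rw [this, Finset.sum_sub_distrib]
        simp [sq]
      have e2 : ∑ j, wa n x0 b j q * Dd (ex j) (wQ n x0 t0 b K s) q
          = 2 * s ^ 2 * (5 * (∑ i, n i * wa n x0 b i q) ^ 2 - ∑ i, wa n x0 b i q ^ 2) := by
        simp_rw [wQ_dx]
        rw [mul_sub, Finset.mul_sum (f := fun i => wa n x0 b i q ^ 2)]
        set S := ∑ i, n i * wa n x0 b i q with hS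
        have : 2 * s ^ 2 * (5 * S ^ 2) = ∑ i, 2 * s ^ 2 * 5 * S * (n i * wa n x0 b i q) := by
          rw [← Finset.mul_sum, ← hS]; ring
        rw [this, ← Finset.sum_sub_distrib]
        refine Finset.sum_congr rfl fun i _ => ?_
        ring
      beta_reduce
      rw [e1, e2, wQ_dt]
      have e3 : c * z q ^ 2 ≤ (s ^ 3 * (10 * (∑ i, n i * wa n x0 b i q) ^ 2
          - 5 * ∑ i, wa n x0 b i q ^ 2) - 3 * s ^ 2 * wft t0 K q - 9 * s ^ 2 - K * s) * z q ^ 2 := by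
        by_cases hq : w q = 0
        · simp [hzdef, hq]
        · exact mul_le_mul_of_nonneg_right (hcoef q hq) (sq_nonneg _)
      have e4 : 0 ≤ s * (∑ i, n i * Dd (ex i) z q) ^ 2 := mul_nonneg hs (sq_nonneg _)
      unfold wQ
      nlinarith [e3, e4]
  have up : 4 * ∫ x, (-(∑ i, Dd (ex i) (Dd (ex i) z) x) - wQ n x0 t0 b K s x * z x) *
      (Dd et z x + 2 * s * ∑ i, wa n x0 b i x * Dd (ex i) z x
        + (s * (∑ i, (5 * n i * n i - (if i = i then 1 else 0))) - s * (-3)) * z x)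
      ≤ ∫ q, (Real.exp (s * φ q) * (Dd et w q - ∑ i, Dd (ex i) (Dd (ex i) w) q)) ^ 2 := by
    rw [← integral_const_mul]
    apply integral_mono
    · refine int_cc (by fun_prop) (HasCompactSupport.intro hzc ?_)
      intro q hq
      simp [zsupp q hq]
    · refine int_cc (by fun_prop) (HasCompactSupport.intro hc ?_)
      intro q hq
      simp [wsupp q hq, wsupp2 q hq]
    · intro q
      beta_reduce
      have key : Real.exp (s * φ q) * (Dd et w q - ∑ i, Dd (ex i) (Dd (ex i) w) q)
        = (-(∑ i, Dd (ex i) (Dd (ex i) z) q) - wQ n x0 t0 b K s q * z q) +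
      (Dd et z q + 2 * s * ∑ i, wa n x0 b i q * Dd (ex i) z q
        + (s * (∑ i, (5 * n i * n i - (if i = i then 1 else 0))) - s * (-3)) * z q) := by
        rw [trH]
        have k1 : ∑ i, Dd (ex i) (Dd (ex i) z) q = Real.exp (s * φ q) *
          ((∑ i, Dd (ex i) (Dd (ex i) w) q) + 2 * s * (∑ i, wa n x0 b i q * Dd (ex i) w q)
          + s * (∑ i, (5 * n i * n i - 1)) * w q + s ^ 2 * (∑ i, wa n x0 b i q ^ 2) * w q) := by
          simp_rw [zxx]
          simp only [Finset.mul_sum, Finset.sum_mul, ← Finset.sum_add_distrib]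
          refine Finset.sum_congr rfl fun i _ => ?_
          ring
        have k2 : ∑ i, wa n x0 b i q * Dd (ex i) z q = Real.exp (s * φ q) *
          ((∑ i, wa n x0 b i q * Dd (ex i) w q) + s * (∑ i, wa n x0 b i q ^ 2) * w q) := by
          simp_rw [zx]
          simp only [Finset.mul_sum, Finset.sum_mul, ← Finset.sum_add_distrib]
          refine Finset.sum_congr rfl fun i _ => ?_
          ring
        rw [k1, k2, zt, wQ]
        simp only [hzdef]
        ring
      rw [key]
      generalize (-(∑ i, Dd (ex i) (Dd (ex i) z) q) - wQ n x0 t0 b K s q * z q) = S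
      generalize (Dd et z q + 2 * s * ∑ i, wa n x0 b i q * Dd (ex i) z q
        + (s * (∑ i, (5 * n i * n i - (if i = i then 1 else 0))) - s * (-3)) * z q) = A
      nlinarith [sq_nonneg (S - A)]
  calc _ ≤ _ := mul_le_mul_of_nonneg_left low (by norm_num)
    _ = _ := by rw [← core]
    _ ≤ _ := up
end weight

theorem ucp_quant {d : ℕ} (n x0 : Fin d → ℝ) (t0 b K : ℝ) (w : (Fin d → ℝ) × ℝ → ℝ)
    (hw : ContDiff ℝ ∞ w) (hc : HasCompactSupport w) (β κ C1 : ℝ) (hβ : 0 < β) (hC1 : 0 ≤ C1)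
    (h1 : ∀ q, w q ≠ 0 → β ≤ 10 * (∑ i, n i * wa n x0 b i q) ^ 2 - 5 * ∑ i, wa n x0 b i q ^ 2)
    (h2 : ∀ q, (Dd et w q - ∑ i, Dd (ex i) (Dd (ex i) w) q) ^ 2
        ≤ C1 * (w q ^ 2 + ∑ i, Dd (ex i) w q ^ 2) ∨ wphi n x0 t0 b K q ≤ -κ) :
    ∃ M s0 : ℝ, ∀ s ≥ s0, ∫ q, (Real.exp (s * wphi n x0 t0 b K q) * w q) ^ 2
      ≤ M * Real.exp (-(2 * s * κ)) := by
  set φ := wphi n x0 t0 b K with hφ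
  have cφ : ContDiff ℝ ∞ φ := wphi_contDiff n x0 t0 b K
  have hcφ := cφ.continuous
  have hcw := hw.continuous
  have hwe : ∀ e, Continuous (Dd e w) := fun e => (Dd_contDiff hw).continuous
  have hwee : ∀ e f, Continuous (Dd e (Dd f w)) := fun e f =>
    (Dd_contDiff (Dd_contDiff hw)).continuous
  have hca : ∀ i, Continuous (wa n x0 b i) := fun i => (wa_contDiff n x0 b i).continuous
  have hcf : Continuous (wft (d := d) t0 K) := (wft_contDiff t0 K).continuous
  set L : (Fin d → ℝ) × ℝ → ℝ := fun q => Dd et w q - ∑ i, Dd (ex i) (Dd (ex i) w) q with hL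
  have hcL : Continuous L := by fun_prop
  have hcpt : IsCompact (tsupport w) := hc
  have wsupp : ∀ q, q ∉ tsupport w → w q = 0 ∧ ∀ e, Dd e w q = 0 := by
    intro q hq
    refine ⟨image_eq_zero_of_notMem_tsupport hq, fun e => ?_⟩
    have : q ∉ tsupport (Dd e w) := fun h => hq (tsupport_fderiv_apply_subset ℝ e h)
    exact image_eq_zero_of_notMem_tsupport this
  have Lsupp : ∀ q, q ∉ tsupport w → L q = 0 := by
    intro q hq
    have h2 : ∀ e f, Dd e (Dd f w) q = 0 := by
      intro e f
      have h1 : q ∉ tsupport (Dd f w) := fun h => hq (tsupport_fderiv_apply_subset ℝ f h)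
      have : q ∉ tsupport (Dd e (Dd f w)) := fun h => h1 (tsupport_fderiv_apply_subset ℝ e h)
      exact image_eq_zero_of_notMem_tsupport this
    simp [hL, (wsupp q hq).2, h2]
  obtain ⟨M0, hM0⟩ := hcpt.exists_bound_of_continuousOn (f := fun q => L q ^ 2)
    (by fun_prop)
  obtain ⟨A2, hA2⟩ := hcpt.exists_bound_of_continuousOn (f := fun q => ∑ i, wa n x0 b i q ^ 2)
    (by fun_prop)
  obtain ⟨B, hB⟩ := hcpt.exists_bound_of_continuousOn (f := wft (d := d) t0 K) (by fun_prop)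
  set A := max A2 0
  set M1 := max M0 0
  have hA0 : 0 ≤ A := le_max_right _ _
  have hA : ∀ q ∈ tsupport w, ∑ i, wa n x0 b i q ^ 2 ≤ A := fun q hq =>
    (le_abs_self _).trans ((hA2 q hq).trans (le_max_left _ _))
  have hM10 : 0 ≤ M1 := le_max_right _ _
  have hM : ∀ q ∈ tsupport w, L q ^ 2 ≤ M1 := fun q hq =>
    (le_abs_self _).trans ((hM0 q hq).trans (le_max_left _ _))
  set Z := 3 * |B| + 9 + |K| with hZ
  have hZ0 : 0 ≤ Z := by positivity
  set s0 := 1 + C1 + (4 * Z + C1 * (1 + 2 * A) + 1) / (4 * β) with hs0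
  refine ⟨M1 * volume.real (tsupport w), s0, fun s hs => ?_⟩
  have hfr : 0 ≤ (4 * Z + C1 * (1 + 2 * A) + 1) / (4 * β) := by positivity
  have hs1 : 1 ≤ s := by linarith
  have hsC : C1 ≤ s := by linarith
  have hsβ : 4 * Z + C1 * (1 + 2 * A) + 1 ≤ 4 * β * s := by
    have : (4 * Z + C1 * (1 + 2 * A) + 1) / (4 * β) ≤ s := by linarith
    rw [div_le_iff₀ (by positivity)] at this
    linarith
  set z : (Fin d → ℝ) × ℝ → ℝ := fun q => Real.exp (s * φ q) * w q with hzdef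
  have hz : ContDiff ℝ ∞ z := by fun_prop
  have hzc : HasCompactSupport z := hc.mul_left
  have hcz := hz.continuous
  have hczi : ∀ e, Continuous (Dd e z) := fun e => (Dd_contDiff hz).continuous
  have dφ : Differentiable ℝ φ := cφ.differentiable (by norm_num)
  have dw : Differentiable ℝ w := hw.differentiable (by norm_num)
  have zx : ∀ i q, Dd (ex i) z q = Real.exp (s * φ q) *
      (Dd (ex i) w q + s * (wa n x0 b i q * w q)) := by
    intro i q
    rw [hzdef, Dd_exp_mul s dφ.differentiableAt dw.differentiableAt, hφ, wphi_dx]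
    ring
  have car := carleman n x0 t0 b K s (by linarith) w hw hc (β * s ^ 3 - Z * s ^ 2) (by
    intro q hq
    have hqs : q ∈ tsupport w := subset_tsupport _ hq
    have g1 := mul_le_mul_of_nonneg_left (h1 q hq) (by positivity : 0 ≤ s ^ 3)
    have g2 : wft t0 K q ≤ |B| := (le_abs_self _).trans ((hB q hqs).trans (le_abs_self _))
    have g3 : K ≤ |K| := le_abs_self _
    have g4 : K * s ≤ |K| * s ^ 2 := by
      calc K * s ≤ |K| * s := mul_le_mul_of_nonneg_right g3 (by linarith)
        _ ≤ |K| * s ^ 2 := mul_le_mul_of_nonneg_left (by nlinarith) (abs_nonneg _)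
    have g5 := mul_le_mul_of_nonneg_left g2 (by positivity : 0 ≤ 3 * s ^ 2)
    rw [hZ]
    nlinarith)
  have zsupp : ∀ q, q ∉ tsupport w → z q = 0 ∧ ∀ i, Dd (ex i) z q = 0 := by
    intro q hq
    refine ⟨by simp [hzdef, wsupp q hq], fun i => ?_⟩
    rw [zx]; simp [wsupp q hq]
  have I1 : Integrable (fun q => ∑ i, Dd (ex i) z q ^ 2) := by
    refine int_cc (by fun_prop) (HasCompactSupport.intro hc ?_)
    intro q hq
    simp [zsupp q hq]
  have I2 : Integrable (fun q => z q ^ 2) := by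
    refine int_cc (by fun_prop) (HasCompactSupport.intro hc ?_)
    intro q hq
    simp [zsupp q hq]
  have hfin : volume (tsupport w) ≠ ⊤ := hcpt.measure_lt_top.ne
  have I3 : Integrable ((tsupport w).indicator (fun _ => M1 * Real.exp (-(2 * s * κ)))) volume := by
    rw [integrable_indicator_iff hcpt.measurableSet]
    exact integrableOn_const hfin
  have up : ∫ q, (Real.exp (s * φ q) * L q) ^ 2 ≤ 
      ∫ q, (2 * C1 * (∑ i, Dd (ex i) z q ^ 2) + C1 * (1 + 2 * s ^ 2 * A) * z q ^ 2
        + (tsupport w).indicator (fun _ => M1 * Real.exp (-(2 * s * κ))) q) := by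
    apply integral_mono
    · refine int_cc (by fun_prop) (HasCompactSupport.intro hc ?_)
      intro q hq
      simp [Lsupp q hq]
    · exact ((I1.const_mul _).add (I2.const_mul _)).add I3
    · intro q
      beta_reduce
      by_cases hq : q ∈ tsupport w
      · rw [indicator_of_mem hq]
        have hS0 : 0 ≤ ∑ i, Dd (ex i) z q ^ 2 := Finset.sum_nonneg fun i _ => sq_nonneg _
        rcases h2 q with h | h
        · have hx : Real.exp (s * φ q) ^ 2 * (∑ i, Dd (ex i) w q ^ 2) ≤
            2 * (∑ i, Dd (ex i) z q ^ 2) + 2 * s ^ 2 * A * z q ^ 2 := by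
            have : ∀ i, Real.exp (s * φ q) ^ 2 * Dd (ex i) w q ^ 2 ≤
                2 * Dd (ex i) z q ^ 2 + 2 * s ^ 2 * z q ^ 2 * wa n x0 b i q ^ 2 := by
              intro i
              rw [zx]
              simp only [hzdef]
              nlinarith [sq_nonneg (Real.exp (s * φ q) * (Dd (ex i) w q + 2 * s * (wa n x0 b i q * w q)))]
            calc _ = ∑ i, Real.exp (s * φ q) ^ 2 * Dd (ex i) w q ^ 2 := by rw [Finset.mul_sum]
              _ ≤ ∑ i, (2 * Dd (ex i) z q ^ 2 + 2 * s ^ 2 * z q ^ 2 * wa n x0 b i q ^ 2) :=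
                Finset.sum_le_sum fun i _ => this i
              _ = 2 * (∑ i, Dd (ex i) z q ^ 2) + 2 * s ^ 2 * z q ^ 2 * (∑ i, wa n x0 b i q ^ 2) := by
                rw [Finset.sum_add_distrib, Finset.mul_sum, Finset.mul_sum]
              _ ≤ _ := by
                have := mul_le_mul_of_nonneg_left (hA q hq) (by positivity : 0 ≤ 2 * s ^ 2 * z q ^ 2)
                linarith
          have h' := mul_le_mul_of_nonneg_left h (sq_nonneg (Real.exp (s * φ q)))
          have hx' := mul_le_mul_of_nonneg_left hx hC1
          have e1 : (Real.exp (s * φ q) * L q) ^ 2 = Real.exp (s * φ q) ^ 2 * L q ^ 2 := by ring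
          have e2 : Real.exp (s * φ q) ^ 2 * (C1 * (w q ^ 2 + ∑ i, Dd (ex i) w q ^ 2))
            = C1 * z q ^ 2 + C1 * (Real.exp (s * φ q) ^ 2 * (∑ i, Dd (ex i) w q ^ 2)) := by
            simp only [hzdef]; ring
          have e3 : 0 ≤ M1 * Real.exp (-(2 * s * κ)) := by positivity
          have h'' : Real.exp (s * φ q) ^ 2 * L q ^ 2 ≤ 
            Real.exp (s * φ q) ^ 2 * (C1 * (w q ^ 2 + ∑ i, Dd (ex i) w q ^ 2)) := h'
          rw [e1]
          rw [e2] at h''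
          nlinarith
        · have e1 : (Real.exp (s * φ q) * L q) ^ 2 = Real.exp (2 * s * φ q) * L q ^ 2 := by
            rw [mul_pow, ← Real.exp_nat_mul]; congr 2; push_cast; ring
          have e2 : Real.exp (2 * s * φ q) ≤ Real.exp (-(2 * s * κ)) := by
            apply Real.exp_le_exp.2
            nlinarith
          have e3 : Real.exp (2 * s * φ q) * L q ^ 2 ≤ Real.exp (-(2 * s * κ)) * M1 :=
            mul_le_mul e2 (hM q hq) (sq_nonneg _) (Real.exp_pos _).le
          have e4 : 0 ≤ 2 * C1 * (∑ i, Dd (ex i) z q ^ 2) := by positivity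
          have e5 : 0 ≤ C1 * (1 + 2 * s ^ 2 * A) * z q ^ 2 := by positivity
          rw [e1]; linarith
      · rw [indicator_of_notMem hq]
        simp [Lsupp q hq, zsupp q hq]
  rw [integral_add (by exact (I1.const_mul _).add (I2.const_mul _)) I3,
    integral_add (I1.const_mul _) (I2.const_mul _), integral_const_mul, integral_const_mul,
    integral_indicator hcpt.measurableSet, setIntegral_const] at up
  have car' : 4 * (s * (∫ q, ∑ i, Dd (ex i) z q ^ 2) + (β * s ^ 3 - Z * s ^ 2) * ∫ q, z q ^ 2)
      ≤ ∫ q, (Real.exp (s * φ q) * L q) ^ 2 := by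
    rw [← integral_const_mul, ← integral_const_mul, ← integral_add (I1.const_mul _) (I2.const_mul _)]
    exact car
  have J1 : 0 ≤ ∫ q, ∑ i, Dd (ex i) z q ^ 2 :=
    integral_nonneg fun q => Finset.sum_nonneg fun i _ => sq_nonneg _
  have J2 : 0 ≤ ∫ q, z q ^ 2 := integral_nonneg fun q => sq_nonneg _
  have fin : 4 * (s * (∫ q, ∑ i, Dd (ex i) z q ^ 2) + (β * s ^ 3 - Z * s ^ 2) * ∫ q, z q ^ 2)
    ≤ _ := car'.trans up
  have k1 : C1 * (∫ q, ∑ i, Dd (ex i) z q ^ 2) ≤ s * ∫ q, ∑ i, Dd (ex i) z q ^ 2 :=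
    mul_le_mul_of_nonneg_right hsC J1
  have k1' : 0 ≤ s * ∫ q, ∑ i, Dd (ex i) z q ^ 2 := by positivity
  have k2 : 1 ≤ 4 * (β * s ^ 3 - Z * s ^ 2) - C1 * (1 + 2 * s ^ 2 * A) := by
    have a1 := mul_le_mul_of_nonneg_right hsβ (sq_nonneg s)
    have a2 : 1 ≤ s ^ 2 := by nlinarith
    nlinarith
  have k3 := mul_le_mul_of_nonneg_right k2 J2
  rw [smul_eq_mul] at fin
  show (∫ q, z q ^ 2) ≤ _
  nlinarith

theorem ucp_quant2 {d : ℕ} (n x0 : Fin d → ℝ) (t0 b K : ℝ) (w : (Fin d → ℝ) × ℝ → ℝ)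
    (hw : ContDiff ℝ ∞ w) (hc : HasCompactSupport w) (β κ C1 : ℝ) (hβ : 0 < β) (hC1 : 0 ≤ C1)
    (hκ : 0 < κ)
    (h1 : ∀ q, w q ≠ 0 → β ≤ 10 * (∑ i, n i * wa n x0 b i q) ^ 2 - 5 * ∑ i, wa n x0 b i q ^ 2)
    (h2 : ∀ q, (Dd et w q - ∑ i, Dd (ex i) (Dd (ex i) w) q) ^ 2
        ≤ C1 * (w q ^ 2 + ∑ i, Dd (ex i) w q ^ 2) ∨ wphi n x0 t0 b K q ≤ -κ)
    (q0 : (Fin d → ℝ) × ℝ) (hq0 : -(κ / 2) < wphi n x0 t0 b K q0) : w q0 = 0 := by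
  obtain ⟨M, s0, hM⟩ := ucp_quant n x0 t0 b K w hw hc β κ C1 hβ hC1 h1 h2
  set φ := wphi n x0 t0 b K with hφ
  have cφ : ContDiff ℝ ∞ φ := wphi_contDiff n x0 t0 b K
  have hcφ := cφ.continuous
  have hcw := hw.continuous
  by_contra hne
  set ε := w q0 ^ 2 / 2 with hε
  have hε0 : 0 < ε := by positivity
  set O : Set ((Fin d → ℝ) × ℝ) := {q | -(κ/2) < φ q} ∩ {q | ε < w q ^ 2} with hO
  have hOo : IsOpen O := (isOpen_lt continuous_const hcφ).inter
    (isOpen_lt continuous_const (by fun_prop))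
  have hq0O : q0 ∈ O := ⟨hq0, by show ε < w q0 ^ 2; have : 0 < w q0 ^ 2 := by positivity
                                 linarith⟩
  have hOsub : O ⊆ tsupport w := by
    intro q hq
    apply subset_tsupport
    have : 0 < w q ^ 2 := hε0.trans hq.2
    intro h; rw [h] at this; simp at this
  have hcpt : IsCompact (tsupport w) := hc
  have hfin : volume O ≠ ⊤ := ((measure_mono hOsub).trans_lt hcpt.measure_lt_top).ne
  have hpos : 0 < volume.real O := by
    rw [measureReal_def, ENNReal.toReal_pos_iff]
    exact ⟨hOo.measure_pos volume ⟨q0, hq0O⟩, hfin.lt_top⟩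
  have key : ∀ s ≥ max s0 0, ε * volume.real O * Real.exp (s * κ) ≤ M := by
    intro s hs
    have hs0 : s0 ≤ s := (le_max_left _ _).trans hs
    have hsp : 0 ≤ s := (le_max_right _ _).trans hs
    have h := hM s hs0
    have low : ∫ q, O.indicator (fun _ => Real.exp (-(s * κ)) * ε) q ≤
        ∫ q, (Real.exp (s * φ q) * w q) ^ 2 := by
      apply integral_mono
      · rw [integrable_indicator_iff hOo.measurableSet]
        exact integrableOn_const hfin
      · refine int_cc (by fun_prop) (HasCompactSupport.intro hc ?_)
        intro q hq
        simp [image_eq_zero_of_notMem_tsupport hq]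
      · intro q
        by_cases hq : q ∈ O
        · rw [indicator_of_mem hq]
          have e1 : (Real.exp (s * φ q) * w q) ^ 2 = Real.exp (2 * s * φ q) * w q ^ 2 := by
            rw [mul_pow, ← Real.exp_nat_mul]; congr 2; push_cast; ring
          beta_reduce
          rw [e1]
          have e2 : Real.exp (-(s * κ)) ≤ Real.exp (2 * s * φ q) := by
            apply Real.exp_le_exp.2
            have := hq.1
            simp only [mem_setOf_eq] at this
            nlinarith
          exact mul_le_mul e2 (le_of_lt hq.2) hε0.le (Real.exp_pos _).le
        · rw [indicator_of_notMem hq]; positivity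
    rw [integral_indicator hOo.measurableSet, setIntegral_const, smul_eq_mul] at low
    have h3 := low.trans h
    have h4 := mul_le_mul_of_nonneg_right h3 (Real.exp_pos (2 * s * κ)).le
    have e1 : M * Real.exp (-(2 * s * κ)) * Real.exp (2 * s * κ) = M := by
      rw [mul_assoc, ← Real.exp_add]; simp
    have e2 : volume.real O * (Real.exp (-(s * κ)) * ε) * Real.exp (2 * s * κ)
        = ε * volume.real O * Real.exp (s * κ) := by
      have : Real.exp (s * κ) = Real.exp (-(s * κ)) * Real.exp (2 * s * κ) := by
        rw [← Real.exp_add]; congr 1; ring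
      rw [this]; ring
    rw [e1, e2] at h4
    exact h4
  have ht : Tendsto (fun s : ℝ => ε * volume.real O * Real.exp (s * κ)) atTop atTop := by
    apply Tendsto.const_mul_atTop (by positivity)
    exact Real.tendsto_exp_atTop.comp (tendsto_id.atTop_mul_const hκ)
  obtain ⟨s, hs, hs'⟩ := ((ht.eventually_gt_atTop M).and (eventually_ge_atTop (max s0 0))).exists
  exact absurd (key s hs') (not_le.2 hs)

theorem Dd_congr {E : Type*} [NormedAddCommGroup E] [NormedSpace ℝ E] {e : E} {F G : E → ℝ} {q : E}
    (h : F =ᶠ[𝓝 q] G) : Dd e F =ᶠ[𝓝 q] Dd e G := by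
  filter_upwards [h.fderiv (𝕜 := ℝ)] with x hx
  unfold Dd; rw [hx]

theorem Dd_zero {E : Type*} [NormedAddCommGroup E] [NormedSpace ℝ E] {e : E} (q : E) :
    Dd e (fun _ : E => (0:ℝ)) q = 0 := by
  unfold Dd; simp

theorem ucp_local {d : ℕ} {Ω : Set (Fin d → ℝ)} (hΩ : IsOpen Ω) {v : (Fin d → ℝ) × ℝ → ℝ}
    (hv : ∀ q : (Fin d → ℝ) × ℝ, q.1 ∈ Ω → ContDiffAt ℝ ∞ v q) {C : ℝ} (hC : 0 ≤ C)
    (hineq : ∀ q : (Fin d → ℝ) × ℝ, q.1 ∈ Ω →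
      |Dd et v q - ∑ i, Dd (ex i) (Dd (ex i) v) q| ≤ C * (|v q| + ∑ i, |Dd (ex i) v q|))
    {a b : ℝ} {x0 : Fin d → ℝ} (hx0 : x0 ∈ Ω) {n : Fin d → ℝ} (hn : ∑ i, n i ^ 2 = 1)
    {r : ℝ} (hr : 0 < r)
    (hz : ∀ x ∈ Ω, ∀ t ∈ Ioo a b,
      ∑ i, (x i - x0 i) ^ 2 + 2 * r * ∑ i, n i * (x i - x0 i) < 0 → v (x, t) = 0) :
    ∃ U ∈ 𝓝 x0, ∀ x ∈ U, ∀ t ∈ Ioo a b, v (x, t) = 0 := by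
  set β := r / 4 with hβ
  have hβ0 : 0 < β := by positivity
  -- good radius
  have ev : ∀ᶠ x in 𝓝 x0, x ∈ Ω ∧ |wN n x0 (x, 0)| < r / 10 ∧
      β ^ 2 < 10 * (∑ i, n i * wa n x0 β i (x, 0)) ^ 2 - 5 * ∑ i, wa n x0 β i (x, 0) ^ 2 := by
    refine Eventually.and (hΩ.mem_nhds hx0) (Eventually.and ?_ ?_)
    · have hc : Continuous fun x : Fin d → ℝ => |wN n x0 (x, 0)| := by
        have := (wN_contDiff n x0).continuous
        fun_prop
      refine (hc.continuousAt.eventually_lt continuousAt_const ?_)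
      simp [wN]; positivity
    · have hc : Continuous fun x : Fin d → ℝ =>
          10 * (∑ i, n i * wa n x0 β i (x, 0)) ^ 2 - 5 * ∑ i, wa n x0 β i (x, 0) ^ 2 := by
        have := fun i => (wa_contDiff n x0 β i).continuous
        fun_prop
      refine (continuousAt_const.eventually_lt hc.continuousAt ?_)
      have e1 : ∀ i, wa n x0 β i (x0, 0) = -β * n i := by intro i; simp [wa, wN]
      simp only [e1]
      have e2 : ∑ i, n i * (-β * n i) = -β := by
        calc ∑ i, n i * (-β * n i) = -β * ∑ i, n i ^ 2 := by
              rw [Finset.mul_sum]; exact Finset.sum_congr rfl fun i _ => by ring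
          _ = -β := by rw [hn]; ring
      have e3 : ∑ i, (-β * n i) ^ 2 = β ^ 2 := by
        calc ∑ i, (-β * n i) ^ 2 = β ^ 2 * ∑ i, n i ^ 2 := by
              rw [Finset.mul_sum]; exact Finset.sum_congr rfl fun i _ => by ring
          _ = β ^ 2 := by rw [hn]; ring
      rw [e2, e3]; nlinarith [sq_pos_of_pos hβ0]
  obtain ⟨ρ, hρ, hball⟩ := Metric.nhds_basis_closedBall.eventually_iff.1 ev
  set κ := ρ ^ 2 / 16 with hκ
  have hκ0 : 0 < κ := by positivity
  -- bound for the weight where `v` is nonzero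
  have hφ : ∀ (t0 K : ℝ) (q : (Fin d → ℝ) × ℝ), q.1 ∈ Metric.closedBall x0 ρ → q.2 ∈ Ioo a b →
      v q ≠ 0 → wphi n x0 t0 β K q ≤ - wR x0 q / 4 - K * (q.2 - t0) ^ 2 := by
    intro t0 K q hq1 hq2 hvq
    have h1 : 0 ≤ wR x0 q + 2 * r * wN n x0 q := by
      by_contra h
      push Not at h
      exact hvq (hz q.1 (hball hq1).1 q.2 hq2 h)
    have h2 : |wN n x0 q| < r / 10 := (hball hq1).2.1
    rw [abs_lt] at h2
    unfold wphi
    rcases le_or_gt 0 (wN n x0 q) with h | h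
    · have hR : 0 ≤ wR x0 q := Finset.sum_nonneg fun i _ => sq_nonneg _
      nlinarith [mul_nonneg h (sub_nonneg.2 h2.2.le)]
    · have : wN n x0 q ^ 2 ≤ r / 10 * (-wN n x0 q) := by nlinarith
      nlinarith
  refine ⟨{x | dist x x0 < ρ / 2 ∧ -(κ/2) < wphi n x0 0 β 0 (x, 0)}, ?_, ?_⟩
  · refine IsOpen.mem_nhds ?_ ?_
    · have := (wphi_contDiff n x0 0 β 0).continuous
      have h1 : IsOpen {x : Fin d → ℝ | dist x x0 < ρ / 2} := isOpen_lt (by fun_prop) (by fun_prop)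
      have h2 : IsOpen {x : Fin d → ℝ | -(κ/2) < wphi n x0 0 β 0 (x, 0)} :=
        isOpen_lt (by fun_prop) (by fun_prop)
      exact h1.inter h2
    · constructor
      · simpa using hρ
      · simp [wphi, wN, wR]; positivity
  rintro x ⟨hx, hxφ⟩ ts hts
  obtain ⟨δ, hδ, hδs⟩ := Metric.nhds_basis_closedBall.mem_iff.1 (isOpen_Ioo.mem_nhds hts)
  set K := 4 * κ / δ ^ 2 with hK
  have hK0 : 0 < K := by positivity
  let f1 : ContDiffBump x0 := ⟨ρ / 2, ρ, by positivity, by linarith⟩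
  let f2 : ContDiffBump ts := ⟨δ / 2, δ, by positivity, by linarith⟩
  set w : (Fin d → ℝ) × ℝ → ℝ := fun q => f1 q.1 * f2 q.2 * v q with hw
  have f1s : ContDiff ℝ ∞ (fun q : (Fin d → ℝ) × ℝ => f1 q.1) := f1.contDiff.comp contDiff_fst
  have f2s : ContDiff ℝ ∞ (fun q : (Fin d → ℝ) × ℝ => f2 q.2) := f2.contDiff.comp contDiff_snd
  have hne : ∀ q, w q ≠ 0 → q.1 ∈ Metric.ball x0 ρ ∧ q.2 ∈ Metric.ball ts δ ∧ v q ≠ 0 := by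
    intro q hq
    simp only [hw, ne_eq, mul_eq_zero, not_or] at hq
    refine ⟨?_, ?_, hq.2⟩
    · have : q.1 ∈ Function.support f1 := hq.1.1
      rwa [f1.support_eq] at this
    · have : q.2 ∈ Function.support f2 := hq.1.2
      rwa [f2.support_eq] at this
  have hwsm : ContDiff ℝ ∞ w := by
    rw [contDiff_iff_contDiffAt]
    intro q
    by_cases hq : q.1 ∈ Ω
    · exact (f1s.contDiffAt.mul f2s.contDiffAt).mul (hv q hq)
    · have hq' : q.1 ∈ (Metric.closedBall x0 ρ)ᶜ := fun h => hq (hball h).1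
      have : w =ᶠ[𝓝 q] fun _ => 0 := by
        have := continuous_fst.continuousAt.eventually
          ((Metric.isClosed_closedBall.isOpen_compl).mem_nhds hq')
        filter_upwards [this] with y hy
        by_contra h
        exact hy (Metric.ball_subset_closedBall (hne y h).1)
      exact contDiffAt_const.congr_of_eventuallyEq this
  have hsub : ∀ q, q ∈ tsupport w → wphi n x0 ts β K q ≤ - wR x0 q / 4 - K * (q.2 - ts) ^ 2 := by
    intro q hq
    have hcl : IsClosed {q | wphi n x0 ts β K q ≤ - wR x0 q / 4 - K * (q.2 - ts) ^ 2} := by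
      have := (wphi_contDiff n x0 ts β K).continuous
      have := (wR_contDiff x0).continuous
      exact isClosed_le (by fun_prop) (by fun_prop)
    refine closure_minimal ?_ hcl hq
    intro y hy
    obtain ⟨h1, h2, h3⟩ := hne y hy
    exact hφ ts K y (Metric.ball_subset_closedBall h1) (hδs (Metric.ball_subset_closedBall h2)) h3
  have hwc : HasCompactSupport w := by
    refine HasCompactSupport.intro
      ((isCompact_closedBall x0 ρ).prod (isCompact_closedBall ts δ)) ?_
    intro q hq
    by_contra h
    obtain ⟨h1, h2, h3⟩ := hne q h
    exact hq ⟨Metric.ball_subset_closedBall h1, Metric.ball_subset_closedBall h2⟩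
  have hconc := ucp_quant2 n x0 ts β K w hwsm hwc (β ^ 2) κ (C ^ 2 * (d + 1)) (by positivity)
    (by positivity) hκ0 (fun q hq => (hball (Metric.ball_subset_closedBall (hne q hq).1)).2.2.le)
    ?_ (x, ts) ?_
  · have : w (x, ts) = v (x, ts) := by
      simp only [hw]
      rw [f1.one_of_mem_closedBall (Metric.mem_closedBall.2 hx.le),
        f2.one_of_mem_closedBall (Metric.mem_closedBall_self (by positivity))]
      ring
    rw [← this]; exact hconc
  · intro q
    by_cases hin : q.1 ∈ Metric.ball x0 (ρ / 2) ∧ q.2 ∈ Metric.ball ts (δ / 2)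
    · left
      have hwv : w =ᶠ[𝓝 q] v := by
        have : Metric.ball x0 (ρ / 2) ×ˢ Metric.ball ts (δ / 2) ∈ 𝓝 q :=
          (Metric.isOpen_ball.prod Metric.isOpen_ball).mem_nhds hin
        filter_upwards [this] with y hy
        simp only [hw]
        rw [f1.one_of_mem_closedBall (Metric.ball_subset_closedBall hy.1),
          f2.one_of_mem_closedBall (Metric.ball_subset_closedBall hy.2)]
        ring
      have hqΩ : q.1 ∈ Ω :=
        (hball (Metric.closedBall_subset_closedBall (by linarith)
          (Metric.ball_subset_closedBall hin.1))).1
      rw [hwv.self_of_nhds, (Dd_congr hwv).self_of_nhds]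
      simp only [fun i => (Dd_congr (e := ex i) hwv).self_of_nhds,
        fun i => (Dd_congr (e := ex i) (Dd_congr (e := ex i) hwv)).self_of_nhds]
      have h := hineq q hqΩ
      have h1 : (|v q| + ∑ i, |Dd (ex i) v q|) ^ 2
          ≤ (d + 1) * (v q ^ 2 + ∑ i, Dd (ex i) v q ^ 2) := by
        have := sq_sum_le_card_mul_sum_sq (s := (Finset.univ : Finset (Option (Fin d))))
          (f := fun o => o.elim |v q| fun i => |Dd (ex i) v q|)
        simpa [Fintype.sum_option] using this
      have h2 := pow_le_pow_left₀ (abs_nonneg _) h 2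
      rw [sq_abs, mul_pow] at h2
      calc _ ≤ _ := h2
        _ ≤ C ^ 2 * ((d + 1) * (v q ^ 2 + ∑ i, Dd (ex i) v q ^ 2)) := by gcongr
        _ = _ := by ring
    by_cases hts' : q ∈ tsupport w
    · right
      have h := hsub q hts'
      have hR : 0 ≤ wR x0 q := Finset.sum_nonneg fun i _ => sq_nonneg _
      by_cases h1 : q.1 ∈ Metric.ball x0 (ρ / 2)
      · have h2 : ¬ q.2 ∈ Metric.ball ts (δ / 2) := fun h2 => hin ⟨h1, h2⟩
        rw [Metric.mem_ball, Real.dist_eq, not_lt] at h2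
        have h3 : (δ / 2) ^ 2 ≤ (q.2 - ts) ^ 2 := by
          rw [← sq_abs (q.2 - ts)]; gcongr
        have h4 : κ = K * (δ / 2) ^ 2 := by rw [hK]; field_simp; ring
        nlinarith
      · have h3 : (ρ / 2) ^ 2 ≤ wR x0 q := by
          rw [Metric.mem_ball, dist_pi_lt_iff (by positivity)] at h1
          push Not at h1
          obtain ⟨i, hi⟩ := h1
          rw [Real.dist_eq] at hi
          calc (ρ / 2) ^ 2 ≤ |q.1 i - x0 i| ^ 2 := by gcongr
            _ = (q.1 i - x0 i) ^ 2 := sq_abs _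
            _ ≤ wR x0 q := Finset.single_le_sum (f := fun i => (q.1 i - x0 i) ^ 2)
              (fun i _ => sq_nonneg _) (Finset.mem_univ i)
        nlinarith [mul_nonneg hK0.le (sq_nonneg (q.2 - ts))]
    · left
      have h0 : w =ᶠ[𝓝 q] fun _ => 0 := notMem_tsupport_iff_eventuallyEq.1 hts'
      rw [h0.self_of_nhds, (Dd_congr h0).self_of_nhds]
      simp only [fun i => (Dd_congr (e := ex i) h0).self_of_nhds,
        fun i => (Dd_congr (e := ex i) (Dd_congr (e := ex i) h0)).self_of_nhds]
      have : ∀ i : Fin d, Dd (ex i) (fun _ => (0:ℝ)) = fun _ => 0 := fun i => funext Dd_zero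
      simp [this, Dd_zero]
  · have : wphi n x0 ts β K (x, ts) = wphi n x0 0 β 0 (x, 0) := by simp [wphi, wN, wR]
    rw [this]; exact hxφ

theorem ucp_global {d : ℕ} {Ω : Set (Fin d → ℝ)} (hΩ : IsOpen Ω) (hΩc : IsPreconnected Ω)
    {v : (Fin d → ℝ) × ℝ → ℝ}
    (hv : ∀ q : (Fin d → ℝ) × ℝ, q.1 ∈ Ω → ContDiffAt ℝ ∞ v q) {C : ℝ} (hC : 0 ≤ C)
    (hineq : ∀ q : (Fin d → ℝ) × ℝ, q.1 ∈ Ω →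
      |Dd et v q - ∑ i, Dd (ex i) (Dd (ex i) v) q| ≤ C * (|v q| + ∑ i, |Dd (ex i) v q|))
    {a b : ℝ} {x1 : Fin d → ℝ} (hx1 : x1 ∈ Ω)
    (h1 : ∃ U ∈ 𝓝 x1, ∀ x ∈ U, ∀ t ∈ Ioo a b, v (x, t) = 0) :
    ∀ x ∈ Ω, ∀ t ∈ Ioo a b, v (x, t) = 0 := by
  set Nz : Set (Fin d → ℝ) := {x | ∃ U ∈ 𝓝 x, ∀ x ∈ U, ∀ t ∈ Ioo a b, v (x, t) = 0} with hNz
  have hNo : IsOpen Nz := by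
    rw [isOpen_iff_mem_nhds]
    rintro x ⟨U, hU, h⟩
    filter_upwards [eventually_mem_nhds_iff.2 hU] with y hy
    exact ⟨U, hy, h⟩
  suffices hsub : Ω ⊆ Nz by
    intro x hx t ht
    obtain ⟨U, hU, h⟩ := hsub hx
    exact h x (mem_of_mem_nhds hU) t ht
  refine hΩc.subset_of_closure_inter_subset hNo ⟨x1, hx1, h1⟩ ?_
  rintro x ⟨hxc, hxΩ⟩
  by_contra hxN
  obtain ⟨ε, hε, hεΩ⟩ := Metric.nhds_basis_closedBall.mem_iff.1 (hΩ.mem_nhds hxΩ)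
  set Q : (Fin d → ℝ) → (Fin d → ℝ) → ℝ := fun y z => ∑ i, (z i - y i) ^ 2 with hQ
  have hQc : ∀ y, Continuous (Q y) := by intro y; simp only [hQ]; fun_prop
  have hQi : ∀ y z i, (z i - y i) ^ 2 ≤ Q y z := fun y z i =>
    Finset.single_le_sum (f := fun i => (z i - y i) ^ 2) (fun i _ => sq_nonneg _)
      (Finset.mem_univ i)
  have hev : ∀ᶠ y in 𝓝 x, Q x y < (ε / 4) ^ 2 := by
    refine (hQc x).continuousAt.eventually_lt continuousAt_const ?_
    simp [hQ]; positivity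
  obtain ⟨y, hyQ, hyN⟩ := (mem_closure_iff_nhds.1 hxc) _ hev
  replace hyQ : Q x y < (ε / 4) ^ 2 := hyQ
  obtain ⟨x0, ⟨hx0N, hx0b⟩, hx0min⟩ :=
    ((isCompact_closedBall x ε).inter_left hNo.isClosed_compl).exists_isMinOn
      ⟨x, hxN, Metric.mem_closedBall_self hε.le⟩ (hQc y).continuousOn
  have hxy : Q y x = Q x y := Finset.sum_congr rfl fun i _ => by ring
  have hx0y : Q y x0 < (ε / 4) ^ 2 :=
    (hx0min ⟨hxN, Metric.mem_closedBall_self hε.le⟩).trans_lt (hxy ▸ hyQ)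
  have hpos : 0 < Q y x0 := by
    refine lt_of_le_of_ne (Finset.sum_nonneg fun i _ => sq_nonneg _) ?_
    intro h
    apply hx0N
    have : x0 = y := by
      ext i
      have := hQi y x0 i
      rw [← h] at this
      nlinarith [sq_nonneg (x0 i - y i)]
    rw [this]; exact hyN
  have hnear : ∀ z, Q y z < Q y x0 → ∀ t ∈ Ioo a b, v (z, t) = 0 := by
    intro z hz t ht
    have hzb : z ∈ Metric.closedBall x ε := by
      rw [Metric.mem_closedBall, dist_pi_le_iff hε.le]
      intro i
      have h1 : |z i - y i| ≤ ε / 4 := abs_le_of_sq_le_sq (by linarith [hQi y z i]) (by positivity)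
      have h2 : |y i - x i| ≤ ε / 4 := abs_le_of_sq_le_sq (by linarith [hQi x y i]) (by positivity)
      have := abs_add_le (z i - y i) (y i - x i)
      rw [Real.dist_eq]
      have e : z i - x i = z i - y i + (y i - x i) := by ring
      rw [e]; linarith
    by_contra hne
    have : z ∉ Nz := fun ⟨U, hU, h⟩ => hne (h z (mem_of_mem_nhds hU) t ht)
    exact absurd (hx0min ⟨this, hzb⟩) (not_le.2 hz)
  set r := Real.sqrt (Q y x0) with hr
  have hr0 : 0 < r := Real.sqrt_pos.2 hpos
  have hr2 : r ^ 2 = Q y x0 := Real.sq_sqrt hpos.le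
  refine hx0N (ucp_local hΩ hv hC hineq (hεΩ hx0b) (n := fun i => (x0 i - y i) / r) ?_ hr0 ?_)
  · simp only [div_pow, ← Finset.sum_div]
    rw [hr2]; exact div_self hpos.ne'
  · intro z _ t ht hlt
    refine hnear z ?_ t ht
    have : Q y z - Q y x0
        = ∑ i, (z i - x0 i) ^ 2 + 2 * r * ∑ i, (x0 i - y i) / r * (z i - x0 i) := by
      simp only [hQ]
      rw [← Finset.sum_sub_distrib, Finset.mul_sum, ← Finset.sum_add_distrib]
      refine Finset.sum_congr rfl fun i _ => ?_
      field_simp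
      ring
    linarith

theorem slice_lip {X Y : Type*} [NormedAddCommGroup X] [NormedSpace ℝ X]
    [NormedAddCommGroup Y] [NormedSpace ℝ Y] {A : Set X} (hA : IsCompact A)
    {B : Set Y} (hB : IsCompact B) {f : X × Y → ℝ}
    (hf : ContDiffOn ℝ 1 f (A ×ˢ (univ : Set Y))) :
    ∃ K : ℝ, 0 ≤ K ∧ ∀ x ∈ A, ∀ y ∈ B, ∀ y' ∈ B, |f (x, y) - f (x, y')| ≤ K * ‖y - y'‖ := by
  have key : ∃ K : ℝ, 0 ≤ K ∧ ∀ z ∈ A ×ˢ (B ×ˢ B),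
      |f (z.1, z.2.1) - f (z.1, z.2.2)| ≤ K * ‖z.2.1 - z.2.2‖ := by
    refine (hA.prod (hB.prod hB)).induction_on
      (p := fun s => ∃ K : ℝ, 0 ≤ K ∧ ∀ z ∈ s,
      |f (z.1, z.2.1) - f (z.1, z.2.2)| ≤ K * ‖z.2.1 - z.2.2‖) ?_ ?_ ?_ ?_
    · exact ⟨0, le_rfl, by simp⟩
    · rintro s t hst ⟨K, hK, h⟩
      exact ⟨K, hK, fun z hz => h z (hst hz)⟩
    · rintro s t ⟨K, hK, h⟩ ⟨K', hK', h'⟩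
      refine ⟨max K K', hK.trans (le_max_left _ _), ?_⟩
      rintro z (hz | hz)
      · exact (h z hz).trans (by gcongr; exact le_max_left _ _)
      · exact (h' z hz).trans (by gcongr; exact le_max_right _ _)
    · rintro ⟨x, y, y'⟩ ⟨hx, hy, hy'⟩
      simp only at hx hy hy'
      by_cases hyy : y = y'
      · subst hyy
        have h1 := hf (x, y) ⟨hx, mem_univ _⟩
        have h1' : ContDiffWithinAt ℝ (0 + 1) f (A ×ˢ (univ : Set Y)) (x, y) := by simpa using h1
        obtain ⟨u, hu, -, f', hf', hc⟩ := (contDiffWithinAt_succ_iff_hasFDerivWithinAt (by simp)).1 h1'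
        rw [insert_eq_of_mem (show (x, y) ∈ A ×ˢ (univ : Set Y) from ⟨hx, mem_univ _⟩)] at hu
        have hxu : (x, y) ∈ u := mem_of_mem_nhdsWithin (⟨hx, mem_univ _⟩ : (x,y) ∈ A ×ˢ (univ : Set Y)) hu
        have hcw : ContinuousWithinAt f' u (x, y) := hc.continuousWithinAt
        have hbd : ∀ᶠ z in 𝓝[u] (x, y), ‖f' z‖ < ‖f' (x, y)‖ + 1 :=
          hcw.norm.eventually_lt continuousWithinAt_const (by linarith)
        have hbd2 : ∀ᶠ z in 𝓝[A ×ˢ (univ : Set Y)] (x, y), z ∈ u ∧ ‖f' z‖ < ‖f' (x, y)‖ + 1 := by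
          have : 𝓝[A ×ˢ (univ : Set Y)] (x, y) ≤ 𝓝[u] (x, y) := by
            rw [nhdsWithin, nhdsWithin]
            exact le_inf inf_le_left (le_principal_iff.2 hu)
          exact Eventually.and hu (this hbd)
        obtain ⟨ε, hε, hball⟩ := Metric.mem_nhdsWithin_iff.1 hbd2
        refine ⟨A ×ˢ (B ×ˢ B) ∩ (Metric.ball x ε ×ˢ (Metric.ball y ε ×ˢ Metric.ball y ε)), ?_,
          ‖f' (x, y)‖ + 1, by positivity, ?_⟩
        · refine inter_mem_nhdsWithin _ ?_
          exact prod_mem_nhds (Metric.ball_mem_nhds _ hε)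
            (prod_mem_nhds (Metric.ball_mem_nhds _ hε) (Metric.ball_mem_nhds _ hε))
        · rintro ⟨x1, y1, y2⟩ ⟨⟨hxA, hyB, hyB'⟩, hx1, hy1, hy2⟩
          simp only at *
          have hin : ∀ z ∈ Metric.ball y ε, (x1, z) ∈ u ∧ ‖f' (x1, z)‖ < ‖f' (x, y)‖ + 1 := by
            intro z hz
            refine hball ⟨?_, hxA, mem_univ _⟩
            rw [← ball_prod_same]; exact ⟨hx1, hz⟩
          have := (convex_ball y ε).norm_image_sub_le_of_norm_hasFDerivWithin_le
            (f := fun z => f (x1, z)) (f' := fun z => (f' (x1, z)).comp (ContinuousLinearMap.inr ℝ X Y))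
            (C := ‖f' (x, y)‖ + 1) (x := y2) (y := y1) ?_ ?_ hy2 hy1
          · simpa [Real.norm_eq_abs] using this
          · intro z hz
            have h2 : HasFDerivWithinAt (fun z : Y => (x1, z)) (ContinuousLinearMap.inr ℝ X Y)
                (Metric.ball y ε) z := (hasFDerivAt_prodMk_right x1 z).hasFDerivWithinAt
            exact (hf' (x1, z) (hin z hz).1).comp z h2 (fun w hw => (hin w hw).1)
          · intro z hz
            refine (ContinuousLinearMap.opNorm_comp_le _ _).trans ?_
            calc _ ≤ ‖f' (x1, z)‖ * 1 := by
                  gcongr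
                  refine ContinuousLinearMap.opNorm_le_bound _ zero_le_one fun w => ?_
                  simp [Prod.norm_def]
              _ ≤ _ := by rw [mul_one]; exact (hin z hz).2.le
      · have hc : ContinuousWithinAt (fun z : X × Y × Y => |f (z.1, z.2.1) - f (z.1, z.2.2)|)
            (A ×ˢ (B ×ˢ B)) (x, y, y') := by
          have hfc : ∀ z ∈ A ×ˢ (univ : Set Y), ContinuousWithinAt f (A ×ˢ (univ : Set Y)) z :=
            hf.continuousOn
          refine ContinuousWithinAt.abs (ContinuousWithinAt.sub ?_ ?_)
          · exact (hfc (x, y) (mk_mem_prod hx (mem_univ _))).comp (f := fun z : X × Y × Y => (z.1, z.2.1))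
              (by fun_prop) (fun z hz => mk_mem_prod hz.1 (mem_univ _))
          · exact (hfc (x, y') (mk_mem_prod hx (mem_univ _))).comp (f := fun z : X × Y × Y => (z.1, z.2.2))
              (by fun_prop) (fun z hz => mk_mem_prod hz.1 (mem_univ _))
        have hc2 : ContinuousWithinAt (fun z : X × Y × Y => ‖z.2.1 - z.2.2‖)
            (A ×ˢ (B ×ˢ B)) (x, y, y') := by fun_prop
        have hpos : 0 < ‖y - y'‖ := norm_pos_iff.2 (sub_ne_zero.2 hyy)
        set M := |f (x, y) - f (x, y')| + 1 with hM
        have e1 := hc.eventually_lt (g := fun _ => M) continuousWithinAt_const (by simp [hM])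
        have e2 := continuousWithinAt_const.eventually_lt (f := fun _ => ‖y - y'‖ / 2) hc2
          (by simp only; linarith)
        refine ⟨_, e1.and e2, M / (‖y - y'‖ / 2), by positivity, ?_⟩
        rintro z ⟨hz1, hz2⟩
        refine hz1.le.trans ?_
        rw [div_mul_eq_mul_div, le_div_iff₀ (by positivity)]
        gcongr
  obtain ⟨K, hK, h⟩ := key
  exact ⟨K, hK, fun x hx y hy y' hy' => h (x, y, y') ⟨hx, hy, hy'⟩⟩

theorem line_hd {E : Type*} [NormedAddCommGroup E] [NormedSpace ℝ E] {e : E} {F : E → ℝ} {q : E}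
    {r : ℝ} (hF : DifferentiableAt ℝ F (q + r • e)) :
    HasDerivAt (fun s : ℝ => F (q + s • e)) (Dd e F (q + r • e)) r := by
  have h1 : HasDerivAt (fun s : ℝ => q + s • e) e r := by
    simpa using ((hasDerivAt_id r).smul_const e).const_add q
  exact hF.hasFDerivAt.comp_hasDerivAt r h1

theorem second_test {E : Type*} [NormedAddCommGroup E] [NormedSpace ℝ E] {e : E} {F : E → ℝ} {q : E}
    (hF : ContDiffAt ℝ ∞ F q) (hm : IsLocalMax (fun r : ℝ => F (q + r • e)) 0) :
    Dd e F q = 0 ∧ Dd e (Dd e F) q ≤ 0 := by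
  have hq : q + (0:ℝ) • e = q := by simp
  have hcont : Continuous (fun r : ℝ => q + r • e) := by fun_prop
  have hd : ∀ᶠ r in 𝓝 (0:ℝ), DifferentiableAt ℝ F (q + r • e) := by
    have h1 : ∀ᶠ y in 𝓝 q, DifferentiableAt ℝ F y := by
      have := (hF.of_le (m := 1) (by simp)).eventually (by simp)
      filter_upwards [this] with y hy using hy.differentiableAt (by simp)
    have h2 : Tendsto (fun r : ℝ => q + r • e) (𝓝 0) (𝓝 q) := by
      have := hcont.tendsto 0; rwa [hq] at this
    exact h2.eventually h1
  have hder : deriv (fun r : ℝ => F (q + r • e)) =ᶠ[𝓝 0] fun r => Dd e F (q + r • e) := by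
    filter_upwards [hd] with r hr using (line_hd hr).deriv
  have h1 : Dd e F q = 0 := by
    have := hm.deriv_eq_zero
    rw [hder.self_of_nhds] at this
    simpa using this
  refine ⟨h1, ?_⟩
  have hdd : deriv (deriv (fun r : ℝ => F (q + r • e))) 0 = Dd e (Dd e F) q := by
    rw [hder.deriv_eq]
    have : DifferentiableAt ℝ (Dd e F) (q + (0:ℝ) • e) := by
      rw [hq]; exact (Dd_contDiffAt hF).differentiableAt (by simp)
    rw [(line_hd this).deriv, hq]
  by_contra hpos
  push Not at hpos
  rw [← hdd] at hpos
  have hmin := isLocalMin_of_deriv_deriv_pos hpos hm.deriv_eq_zero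
    (hd.self_of_nhds.continuousAt.comp (f := fun r : ℝ => q + r • e) hcont.continuousAt)
  have hconst : (fun r : ℝ => F (q + r • e)) =ᶠ[𝓝 0] fun _ => F (q + (0:ℝ) • e) := by
    filter_upwards [hm, hmin] with r h1 h2 using le_antisymm h1 h2
  have : deriv (deriv (fun r : ℝ => F (q + r • e))) 0 = 0 := by
    rw [hconst.deriv.deriv_eq]; simp
  linarith

theorem left_deriv_nonneg {h : ℝ → ℝ} {D t1 t : ℝ} (ht : t1 < t) (hd : HasDerivAt h D t)
    (hm : ∀ s ∈ Icc t1 t, h s ≤ h t) : 0 ≤ D := by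
  have h1 := (hasDerivAt_iff_tendsto_slope.1 hd).mono_left
    (nhdsWithin_mono t (fun s (hs : s ∈ Iio t) => (ne_of_lt hs : s ≠ t)))
  refine ge_of_tendsto h1 ?_
  filter_upwards [Ioo_mem_nhdsLT ht] with s hs
  rw [slope_def_field]
  exact div_nonneg_of_nonpos (by linarith [hm s ⟨hs.1.le, hs.2.le⟩]) (by linarith [hs.2])

theorem max_princ {d : ℕ} {Ω : Set (Fin d → ℝ)} (hΩ : IsOpen Ω) (hΩb : Bornology.IsBounded Ω)
    {v : (Fin d → ℝ) × ℝ → ℝ}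
    (hv : ∀ q : (Fin d → ℝ) × ℝ, q.1 ∈ Ω → ContDiffAt ℝ ∞ v q) {C : ℝ}
    (hineq : ∀ q : (Fin d → ℝ) × ℝ, q.1 ∈ Ω →
      |Dd et v q - ∑ i, Dd (ex i) (Dd (ex i) v) q| ≤ C * (|v q| + ∑ i, |Dd (ex i) v q|))
    (hc : ContinuousOn v (closure Ω ×ˢ (univ : Set ℝ)))
    (hb : ∀ x ∈ frontier Ω, ∀ t, v (x, t) = 0) {t1 : ℝ} (h0 : ∀ x ∈ Ω, v (x, t1) = 0) :
    ∀ x ∈ Ω, ∀ t, t1 ≤ t → v (x, t) ≤ 0 := by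
  intro x2 hx2 t2 ht2
  by_contra hpos
  push Not at hpos
  set w : (Fin d → ℝ) × ℝ → ℝ := fun q => Real.exp (-(C + 1) * q.2) * v q with hw
  have hcpt : IsCompact (closure Ω ×ˢ Icc t1 t2) := (hΩb.isCompact_closure).prod isCompact_Icc
  obtain ⟨⟨xs, ts⟩, ⟨hxs, hts⟩, hmax⟩ := hcpt.exists_isMaxOn
    ⟨(x2, t2), subset_closure hx2, ht2, le_rfl⟩ (f := w) (by
      refine ContinuousOn.mul (by fun_prop) (hc.mono ?_)
      exact prod_mono_right (subset_univ _))
  simp only at hxs hts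
  have hm : ∀ x ∈ closure Ω, ∀ t ∈ Icc t1 t2, w (x, t) ≤ w (xs, ts) := fun x hx t ht =>
    hmax (show (x, t) ∈ closure Ω ×ˢ Icc t1 t2 from ⟨hx, ht⟩)
  have hwpos : 0 < w (xs, ts) := by
    refine lt_of_lt_of_le ?_ (hm x2 (subset_closure hx2) t2 ⟨ht2, le_rfl⟩)
    simp only [hw]; positivity
  have hvpos : 0 < v (xs, ts) := by
    simp only [hw] at hwpos
    exact (pos_iff_pos_of_mul_pos hwpos).1 (Real.exp_pos _)
  have hxΩ : xs ∈ Ω := by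
    by_contra h
    have : xs ∈ frontier Ω := by rw [hΩ.frontier_eq]; exact ⟨hxs, h⟩
    rw [hb xs this ts] at hvpos
    exact lt_irrefl _ hvpos
  have htl : t1 < ts := by
    refine lt_of_le_of_ne hts.1 ?_
    rintro rfl
    rw [h0 xs hxΩ] at hvpos
    exact lt_irrefl _ hvpos
  have hsp : ∀ i, Dd (ex i) v (xs, ts) = 0 ∧ Dd (ex i) (Dd (ex i) v) (xs, ts) ≤ 0 := by
    intro i
    refine second_test (hv _ hxΩ) ?_
    have hcont : Continuous (fun r : ℝ => ((xs, ts) + r • ex i : (Fin d → ℝ) × ℝ).1) := by fun_prop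
    have : ∀ᶠ r in 𝓝 (0:ℝ), ((xs, ts) + r • ex i : (Fin d → ℝ) × ℝ).1 ∈ Ω :=
      hcont.continuousAt.eventually_mem (hΩ.mem_nhds (by simpa using hxΩ))
    filter_upwards [this] with r hr
    have h1 := hm _ (subset_closure hr) ts hts
    have h2 : ((xs, ts) + r • ex i : (Fin d → ℝ) × ℝ) =
      (((xs, ts) + r • ex i : (Fin d → ℝ) × ℝ).1, ts) := by ext <;> simp [ex]
    rw [h2]
    simp only [hw] at h1
    simpa using le_of_mul_le_mul_left h1 (Real.exp_pos _)
  have hti : 0 ≤ Real.exp (-(C + 1) * ts) * (Dd et v (xs, ts) - (C + 1) * v (xs, ts)) := by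
    refine left_deriv_nonneg (h := fun s => w (xs, s)) htl ?_ ?_
    · have e1 : HasDerivAt (fun s : ℝ => v (xs, s)) (Dd et v (xs, ts)) ts := by
        have h1 : HasDerivAt (fun s : ℝ => (xs, s)) ((0, 1) : (Fin d → ℝ) × ℝ) ts :=
          (hasDerivAt_const ts xs).prodMk (hasDerivAt_id ts)
        exact ((hv (xs, ts) hxΩ).differentiableAt (by simp)).hasFDerivAt.comp_hasDerivAt ts h1
      have e2 : HasDerivAt (fun s : ℝ => Real.exp (-(C + 1) * s))
          (Real.exp (-(C + 1) * ts) * (-(C + 1))) ts := by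
        simpa using ((hasDerivAt_id ts).const_mul (-(C + 1))).exp
      refine HasDerivAt.congr_deriv (e2.mul e1) ?_
      ring
    · intro s hs
      exact hm xs hxs s ⟨hs.1, hs.2.trans hts.2⟩
  have h3 : 0 ≤ Dd et v (xs, ts) - (C + 1) * v (xs, ts) :=
    nonneg_of_mul_nonneg_right hti (Real.exp_pos _)
  have h4 := hineq (xs, ts) hxΩ
  simp only [fun i => (hsp i).1] at h4
  have h5 : ∑ i, Dd (ex i) (Dd (ex i) v) (xs, ts) ≤ 0 :=
    Finset.sum_nonpos fun i _ => (hsp i).2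
  have h6 := (abs_le.1 h4).2
  rw [abs_of_pos hvpos] at h6
  simp at h6
  linarith

theorem forward_unique {d : ℕ} {Ω : Set (Fin d → ℝ)} (hΩ : IsOpen Ω) (hΩb : Bornology.IsBounded Ω)
    {v : (Fin d → ℝ) × ℝ → ℝ}
    (hv : ∀ q : (Fin d → ℝ) × ℝ, q.1 ∈ Ω → ContDiffAt ℝ ∞ v q) {C : ℝ}
    (hineq : ∀ q : (Fin d → ℝ) × ℝ, q.1 ∈ Ω →
      |Dd et v q - ∑ i, Dd (ex i) (Dd (ex i) v) q| ≤ C * (|v q| + ∑ i, |Dd (ex i) v q|))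
    (hc : ContinuousOn v (closure Ω ×ˢ (univ : Set ℝ)))
    (hb : ∀ x ∈ frontier Ω, ∀ t, v (x, t) = 0) {t1 : ℝ} (h0 : ∀ x ∈ Ω, v (x, t1) = 0) :
    ∀ x ∈ Ω, ∀ t, t1 ≤ t → v (x, t) = 0 := by
  intro x hx t ht
  refine le_antisymm (max_princ hΩ hΩb hv hineq hc hb h0 x hx t ht) ?_
  have hneg : ∀ (e : (Fin d → ℝ) × ℝ) (F : (Fin d → ℝ) × ℝ → ℝ),
      Dd e (fun q => - F q) = fun q => - Dd e F q := by
    intro e F; ext q; unfold Dd; rw [fderiv_fun_neg]; rfl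
  have := max_princ (v := fun q => - v q) hΩ hΩb (fun q hq => (hv q hq).neg) (C := C) ?_ hc.neg
    (by simpa using hb) (t1 := t1) (by simpa using h0) x hx t ht
  · simpa using this
  · intro q hq
    have := hineq q hq
    simp only [hneg, abs_neg, Finset.sum_neg_distrib]
    rw [← abs_neg]
    convert this using 2
    ring

/-- Bundled hypotheses on the periodic solution, in space-time form. -/
structure Sol {d : ℕ} (Ω : Set (Fin d → ℝ)) (f : ((Fin d → ℝ) × ℝ × (Fin d → ℝ)) → ℝ)
    (P : (Fin d → ℝ) × ℝ → ℝ) (om : ℝ) : Prop where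
  op : IsOpen Ω
  conn : IsPreconnected Ω
  bdd : Bornology.IsBounded Ω
  hf : ContDiffOn ℝ ∞ f (closure Ω ×ˢ ((univ : Set ℝ) ×ˢ (univ : Set (Fin d → ℝ))))
  sm : ∀ q : (Fin d → ℝ) × ℝ, q.1 ∈ Ω → ContDiffAt ℝ ∞ P q
  cont : ContinuousOn P (closure Ω ×ˢ (univ : Set ℝ))
  eq : ∀ q : (Fin d → ℝ) × ℝ, q.1 ∈ Ω →
    Dd et P q = ∑ i, Dd (ex i) (Dd (ex i) P) q + f (q.1, P q, fun i => Dd (ex i) P q)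
  bc : ∀ x ∈ frontier Ω, ∀ t : ℝ, P (x, t) = 0
  om_pos : 0 < om
  per : ∀ x ∈ closure Ω, ∀ t : ℝ, P (x, t + om) = P (x, t)
  min : ∀ om' : ℝ, 0 < om' → (∀ x ∈ closure Ω, ∀ t : ℝ, P (x, t + om') = P (x, t)) → om ≤ om'
  bnd : ∃ R : ℝ, ∀ q : (Fin d → ℝ) × ℝ, q.1 ∈ Ω → |P q| ≤ R ∧ ∀ i, |Dd (ex i) P q| ≤ R

theorem link_pd {d : ℕ} {F : (Fin d → ℝ) × ℝ → ℝ} {x : Fin d → ℝ} {t : ℝ} (i : Fin d)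
    (hF : DifferentiableAt ℝ F (x, t)) :
    pd i (fun y => F (y, t)) x = Dd (ex i) F (x, t) := by
  have h1 : HasFDerivAt (fun y : Fin d → ℝ => (y, t)) (ContinuousLinearMap.inl ℝ (Fin d → ℝ) ℝ) x :=
    hasFDerivAt_prodMk_left x t
  have := hF.hasFDerivAt.comp x h1
  unfold pd Dd
  have h2 : fderiv ℝ (fun y => F (y, t)) x = _ := this.fderiv
  rw [h2]; simp [ex]

theorem link_dt {d : ℕ} {F : (Fin d → ℝ) × ℝ → ℝ} {x : Fin d → ℝ} {t : ℝ}
    (hF : DifferentiableAt ℝ F (x, t)) :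
    HasDerivAt (fun s => F (x, s)) (Dd et F (x, t)) t := by
  have h1 : HasDerivAt (fun s : ℝ => (x, s)) ((0, 1) : (Fin d → ℝ) × ℝ) t :=
    (hasDerivAt_const t x).prodMk (hasDerivAt_id t)
  exact hF.hasFDerivAt.comp_hasDerivAt t h1

theorem pd_congr {d : ℕ} {F G : (Fin d → ℝ) → ℝ} {x : Fin d → ℝ} (i : Fin d)
    (h : F =ᶠ[𝓝 x] G) : pd i F x = pd i G x := by
  unfold pd; rw [h.fderiv_eq]

theorem Dd_shift {d : ℕ} {F : (Fin d → ℝ) × ℝ → ℝ} (e : (Fin d → ℝ) × ℝ) (τ : ℝ) :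
    Dd e (fun q => F (q.1, q.2 + τ)) = fun q => Dd e F (q.1, q.2 + τ) := by
  have h : ∀ q : (Fin d → ℝ) × ℝ, (q.1, q.2 + τ) = q + (0, τ) := by intro q; ext <;> simp
  ext q
  simp only [h]
  unfold Dd
  rw [fderiv_comp_add_right]

theorem Sol.noshift {d : ℕ} {Ω : Set (Fin d → ℝ)} {f : ((Fin d → ℝ) × ℝ × (Fin d → ℝ)) → ℝ}
    {P : (Fin d → ℝ) × ℝ → ℝ} {om : ℝ} (S : Sol Ω f P om) {τ : ℝ} (hτ : τ ≠ 0) (hτom : |τ| < om)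
    {x1 : Fin d → ℝ} (hx1 : x1 ∈ Ω) {a b : ℝ} (hab : a < b)
    (h : ∃ U ∈ 𝓝 x1, ∀ x ∈ U, ∀ t ∈ Ioo a b, P (x, t + τ) = P (x, t)) : False := by
  obtain ⟨R, hR⟩ := S.bnd
  have hf1 : ContDiffOn ℝ 1 f (closure Ω ×ˢ (univ : Set (ℝ × (Fin d → ℝ)))) := by
    rw [← univ_prod_univ]; exact S.hf.of_le (by simp)
  obtain ⟨K, hK, hlip⟩ := slice_lip S.bdd.isCompact_closure
    (isCompact_closedBall (0 : ℝ × (Fin d → ℝ)) R) hf1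
  set v : (Fin d → ℝ) × ℝ → ℝ := fun q => P (q.1, q.2 + τ) - P q with hvdef
  have hsh : ∀ q : (Fin d → ℝ) × ℝ, q.1 ∈ Ω → ContDiffAt ℝ ∞ (fun q => P (q.1, q.2 + τ)) q := by
    intro q hq
    exact (S.sm (q.1, q.2 + τ) hq).comp q (f := fun q : (Fin d → ℝ) × ℝ => (q.1, q.2 + τ))
      (by fun_prop)
  have hv : ∀ q : (Fin d → ℝ) × ℝ, q.1 ∈ Ω → ContDiffAt ℝ ∞ v q := fun q hq =>
    (hsh q hq).sub (S.sm q hq)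
  have hD1 : ∀ e q, q.1 ∈ Ω → Dd e v q = Dd e P (q.1, q.2 + τ) - Dd e P q := by
    intro e q hq
    have := Dd_sub (e := e) ((hsh q hq).differentiableAt (by simp))
      ((S.sm q hq).differentiableAt (by simp))
    rw [Dd_shift] at this
    exact this
  have hnear : ∀ q : (Fin d → ℝ) × ℝ, q.1 ∈ Ω → ∀ᶠ y in 𝓝 q, y.1 ∈ Ω := fun q hq =>
    continuous_fst.continuousAt.eventually_mem (S.op.mem_nhds hq)
  have hD2 : ∀ e q, q.1 ∈ Ω →
      Dd e (Dd e v) q = Dd e (Dd e P) (q.1, q.2 + τ) - Dd e (Dd e P) q := by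
    intro e q hq
    have h1 : Dd e v =ᶠ[𝓝 q] fun q => Dd e P (q.1, q.2 + τ) - Dd e P q := by
      filter_upwards [hnear q hq] with y hy using hD1 e y hy
    rw [(Dd_congr h1).self_of_nhds]
    have hsh' : ContDiffAt ℝ ∞ (fun q => Dd e P (q.1, q.2 + τ)) q :=
      (Dd_contDiffAt (S.sm (q.1, q.2 + τ) hq)).comp q
        (f := fun q : (Fin d → ℝ) × ℝ => (q.1, q.2 + τ)) (by fun_prop)
    rw [Dd_sub (hsh'.differentiableAt (by simp))
      ((Dd_contDiffAt (S.sm q hq)).differentiableAt (by simp)), Dd_shift]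
  have hbox : ∀ q : (Fin d → ℝ) × ℝ, q.1 ∈ Ω →
      ((P q, fun i => Dd (ex i) P q) : ℝ × (Fin d → ℝ)) ∈ Metric.closedBall 0 R := by
    intro q hq
    have hR0 : 0 ≤ R := (abs_nonneg _).trans (hR q hq).1
    rw [mem_closedBall_zero_iff, Prod.norm_def]
    exact max_le (hR q hq).1 ((pi_norm_le_iff_of_nonneg hR0).2 (hR q hq).2)
  have hineq : ∀ q : (Fin d → ℝ) × ℝ, q.1 ∈ Ω →
      |Dd et v q - ∑ i, Dd (ex i) (Dd (ex i) v) q| ≤ K * (|v q| + ∑ i, |Dd (ex i) v q|) := by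
    intro q hq
    have e1 := S.eq q hq
    have e2 := S.eq (q.1, q.2 + τ) hq
    have h3 := hlip q.1 (subset_closure hq) _ (hbox (q.1, q.2 + τ) hq) _ (hbox q hq)
    have e4 : Dd et v q - ∑ i, Dd (ex i) (Dd (ex i) v) q
        = f (q.1, P (q.1, q.2 + τ), fun i => Dd (ex i) P (q.1, q.2 + τ))
          - f (q.1, P q, fun i => Dd (ex i) P q) := by
      rw [hD1 et q hq]
      simp only [hD2 _ q hq]
      rw [Finset.sum_sub_distrib]
      simp only at e2
      linarith
    rw [e4]
    refine h3.trans ?_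
    gcongr
    rw [Prod.norm_def]
    have hs : 0 ≤ ∑ i, |Dd (ex i) v q| := Finset.sum_nonneg fun i _ => abs_nonneg _
    refine max_le ?_ ?_
    · have : |v q| ≤ |v q| + ∑ i, |Dd (ex i) v q| := by linarith
      exact this
    · refine (pi_norm_le_iff_of_nonneg (by positivity)).2 fun i => ?_
      have h5 := Finset.single_le_sum (f := fun i => |Dd (ex i) v q|)
        (fun i _ => abs_nonneg _) (Finset.mem_univ i)
      have h6 : |Dd (ex i) v q| ≤ |v q| + ∑ i, |Dd (ex i) v q| := by
        linarith [abs_nonneg (v q)]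
      rw [hD1 _ q hq] at h6
      exact h6
  have hz1 := ucp_global S.op S.conn hv hK hineq hx1 (a := a) (b := b) (by
    obtain ⟨U, hU, h⟩ := h
    exact ⟨U, hU, fun x hx t ht => sub_eq_zero.2 (h x hx t ht)⟩)
  have hvc : ContinuousOn v (closure Ω ×ˢ (univ : Set ℝ)) := by
    refine ContinuousOn.sub ?_ S.cont
    refine S.cont.comp (f := fun q : (Fin d → ℝ) × ℝ => (q.1, q.2 + τ)) (by fun_prop) ?_
    intro q hq
    exact ⟨hq.1, mem_univ _⟩
  have hvb : ∀ x ∈ frontier Ω, ∀ t, v (x, t) = 0 := by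
    intro x hx t
    simp [hvdef, S.bc x hx]
  have hz2 := forward_unique S.op S.bdd hv hineq hvc hvb (t1 := (a + b) / 2)
    (fun x hx => hz1 x hx _ ⟨by linarith, by linarith⟩)
  have hperk : ∀ x ∈ closure Ω, ∀ k : ℕ, ∀ t, P (x, t + k * om) = P (x, t) := by
    intro x hx k
    induction k with
    | zero => simp
    | succ k ih =>
      intro t
      rw [← ih t, ← S.per x hx (t + k * om)]
      push_cast
      congr 2
      ring
  have hz3 : ∀ x ∈ closure Ω, ∀ t, P (x, t + τ) = P (x, t) := by
    intro x hx t
    by_cases hxΩ : x ∈ Ω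
    · obtain ⟨k, hk⟩ := exists_nat_gt (((a + b) / 2 - t) / om)
      rw [div_lt_iff₀ S.om_pos] at hk
      have := sub_eq_zero.1 (hz2 x hxΩ (t + k * om) (by linarith))
      simp only at this
      rw [hperk x hx k t] at this
      rw [← this, ← hperk x hx k (t + τ)]
      congr 2
      ring
    · have : x ∈ frontier Ω := by rw [S.op.frontier_eq]; exact ⟨hx, hxΩ⟩
      rw [S.bc x this, S.bc x this]
  rcases lt_or_gt_of_ne hτ with h1 | h1
  · have := S.min (-τ) (by linarith) (fun x hx t => by
      rw [← hz3 x hx (t + -τ)]; congr 2; ring)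
    rw [abs_of_neg h1] at hτom
    linarith
  · have := S.min τ h1 hz3
    rw [abs_of_pos h1] at hτom
    linarith

theorem shear_equiv {d : ℕ} (L : (Fin d → ℝ) × ℝ →L[ℝ] ℝ) (hL : L et ≠ 0) :
    ∃ A : ((Fin d → ℝ) × ℝ) ≃L[ℝ] ((Fin d → ℝ) × ℝ),
      (A : ((Fin d → ℝ) × ℝ) →L[ℝ] ((Fin d → ℝ) × ℝ)) = (ContinuousLinearMap.fst ℝ _ _).prod L := by
  have hdec : ∀ v : (Fin d → ℝ) × ℝ, L v = L (v.1, 0) + v.2 * L et := by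
    intro v
    have : v = (v.1, 0) + v.2 • et := by ext <;> simp [et]
    conv_lhs => rw [this]
    rw [map_add, map_smul]; rfl
  let G : (Fin d → ℝ) × ℝ →L[ℝ] (Fin d → ℝ) × ℝ :=
    (ContinuousLinearMap.fst ℝ _ _).prod ((L et)⁻¹ • (ContinuousLinearMap.snd ℝ (Fin d → ℝ) ℝ
      - L.comp ((ContinuousLinearMap.inl ℝ _ _).comp (ContinuousLinearMap.fst ℝ (Fin d → ℝ) ℝ))))
  have hG : ∀ v, G v = (v.1, (L et)⁻¹ * (v.2 - L (v.1, 0))) := by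
    intro v; simp [G]
  refine ⟨ContinuousLinearEquiv.equivOfInverse ((ContinuousLinearMap.fst ℝ _ _).prod L) G ?_ ?_, ?_⟩
  · intro v
    rw [hG]
    ext
    · simp
    · simp only [ContinuousLinearMap.prod_apply, ContinuousLinearMap.coe_fst']
      rw [hdec v]; field_simp; ring
  · intro v
    rw [hG]
    ext
    · simp
    · simp only [ContinuousLinearMap.prod_apply, ContinuousLinearMap.coe_fst']
      rw [hdec]; simp only; field_simp; ring
  · ext <;> rfl

theorem branch {d : ℕ} {P : (Fin d → ℝ) × ℝ → ℝ} {a : (Fin d → ℝ) × ℝ}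
    (hP : ∀ᶠ q in 𝓝 a, ContDiffAt ℝ ∞ P q) (ha : Dd et P a ≠ 0) :
    ∃ T : (Fin d → ℝ) × ℝ → ℝ, T (a.1, P a) = a.2 ∧
      (∀ᶠ z in 𝓝 (a.1, P a), ContDiffAt ℝ ∞ T z ∧ P (z.1, T z) = z.2) ∧
      (∀ᶠ q in 𝓝 a, T (q.1, P q) = q.2) := by
  set Φ : (Fin d → ℝ) × ℝ → (Fin d → ℝ) × ℝ := fun q => (q.1, P q) with hΦ
  have hΦs : ∀ q, ContDiffAt ℝ ∞ P q → ContDiffAt ℝ ∞ Φ q := fun q h =>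
    contDiffAt_fst.prodMk h
  have hΦd : ∀ q, ContDiffAt ℝ ∞ P q → Dd et P q ≠ 0 →
      ∃ A : ((Fin d → ℝ) × ℝ) ≃L[ℝ] ((Fin d → ℝ) × ℝ),
        HasFDerivAt Φ (A : ((Fin d → ℝ) × ℝ) →L[ℝ] ((Fin d → ℝ) × ℝ)) q := by
    intro q h hne
    obtain ⟨A, hA⟩ := shear_equiv (fderiv ℝ P q) hne
    refine ⟨A, ?_⟩
    rw [hA]
    exact hasFDerivAt_fst.prodMk (h.differentiableAt (by simp)).hasFDerivAt
  have hPa := hP.self_of_nhds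
  obtain ⟨A, hA⟩ := hΦd a hPa ha
  set e := (hΦs a hPa).toOpenPartialHomeomorph Φ hA (by simp) with he
  have heΦ : ∀ q, e q = Φ q := fun q => rfl
  have hsrc : a ∈ e.source := (hΦs a hPa).mem_toOpenPartialHomeomorph_source hA (by simp)
  have htgt : Φ a ∈ e.target := (hΦs a hPa).image_mem_toOpenPartialHomeomorph_target hA (by simp)
  have hsym : e.symm (Φ a) = a := e.left_inv hsrc
  refine ⟨fun z => (e.symm z).2, by simp only; rw [show (a.1, P a) = Φ a from rfl, hsym], ?_, ?_⟩
  · have hc : Tendsto e.symm (𝓝 (Φ a)) (𝓝 a) := by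
      have := e.continuousAt_symm htgt
      rwa [ContinuousAt, hsym] at this
    have hne : ∀ᶠ q in 𝓝 a, Dd et P q ≠ 0 :=
      (Dd_contDiffAt hPa).continuousAt.eventually_ne ha
    filter_upwards [e.open_target.mem_nhds htgt, hc.eventually hP, hc.eventually hne] with z h1 h2 h3
    obtain ⟨B, hB⟩ := hΦd _ h2 h3
    have hr : Φ (e.symm z) = z := e.right_inv h1
    refine ⟨?_, ?_⟩
    · exact contDiffAt_snd.comp z (e.contDiffAt_symm h1 hB (hΦs _ h2))
    · have e1 : (Φ (e.symm z)).1 = z.1 := by rw [hr]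
      replace e1 : (e.symm z).1 = z.1 := e1
      have e2 : (Φ (e.symm z)).2 = z.2 := by rw [hr]
      rw [← e1]; exact e2
  · filter_upwards [e.open_source.mem_nhds hsrc] with q hq
    have : e.symm (Φ q) = q := e.left_inv hq
    exact congrArg Prod.snd this

theorem Dd_comp_sig {d : ℕ} {F σ : (Fin d → ℝ) × ℝ → ℝ} {q : (Fin d → ℝ) × ℝ} (e : (Fin d → ℝ) × ℝ)
    (hF : DifferentiableAt ℝ F (q.1, σ q)) (hσ : DifferentiableAt ℝ σ q) :
    Dd e (fun q => F (q.1, σ q)) q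
      = Dd (e.1, 0) F (q.1, σ q) + Dd e σ q * Dd et F (q.1, σ q) := by
  have h1 : HasFDerivAt (fun q : (Fin d → ℝ) × ℝ => (q.1, σ q))
    ((ContinuousLinearMap.fst ℝ _ _).prod (fderiv ℝ σ q)) q := hasFDerivAt_fst.prodMk hσ.hasFDerivAt
  have h2 := hF.hasFDerivAt.comp q h1
  rw [show Dd e (fun q => F (q.1, σ q)) q = _ from Dd_of h2]
  have : ((ContinuousLinearMap.fst ℝ (Fin d → ℝ) ℝ).prod (fderiv ℝ σ q)) e
      = (e.1, 0) + (fderiv ℝ σ q e) • et := by ext <;> simp [et]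
  rw [ContinuousLinearMap.comp_apply, this, map_add, map_smul]
  rfl

theorem clm_zero {d : ℕ} {L : (Fin d → ℝ) × ℝ →L[ℝ] ℝ} (h1 : ∀ i, L (ex i) = 0) (h2 : L et = 0) :
    L = 0 := by
  refine ContinuousLinearMap.ext fun v => ?_
  have hv : v = ∑ i, v.1 i • ex i + v.2 • et := by
    ext j
    · simp [ex, et, Prod.fst_sum, Finset.sum_apply, Pi.single_apply]
    · simp [ex, et, Prod.snd_sum]
  rw [hv, map_add, map_sum]
  simp [h1, h2]

theorem Sol.core {d : ℕ} {Ω : Set (Fin d → ℝ)} {f : ((Fin d → ℝ) × ℝ × (Fin d → ℝ)) → ℝ}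
    {P : (Fin d → ℝ) × ℝ → ℝ} {om : ℝ} (S : Sol Ω f P om) {W : Set ((Fin d → ℝ) × ℝ)}
    (hW : IsOpen W) {q0 : (Fin d → ℝ) × ℝ} (hq0 : q0 ∈ W) (hWΩ : ∀ q ∈ W, q.1 ∈ Ω)
    {σ : (Fin d → ℝ) × ℝ → ℝ} (hσ : ∀ q ∈ W, DifferentiableAt ℝ σ q)
    (hσ1 : ∀ q ∈ W, P (q.1, σ q) = P q)
    (hσ2 : ∀ q ∈ W, ∀ i, Dd (ex i) P (q.1, σ q) = Dd (ex i) P q)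
    (hne : ∀ q ∈ W, Dd et P (q.1, σ q) ≠ 0) (hσ3 : ∀ q ∈ W, σ q ≠ q.2)
    (hσ4 : ∀ q ∈ W, |σ q - q.2| < om) : False := by
  have hx : ∀ q ∈ W, ∀ i, Dd (ex i) σ q = 0 := by
    intro q hq i
    have hev : (fun q => P (q.1, σ q)) =ᶠ[𝓝 q] P := by
      filter_upwards [hW.mem_nhds hq] with y hy using hσ1 y hy
    have h1 := (Dd_congr (e := ex i) hev).self_of_nhds
    rw [Dd_comp_sig _ ((S.sm (q.1, σ q) (hWΩ q hq)).differentiableAt (by simp)) (hσ q hq),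
      show ((ex i : (Fin d → ℝ) × ℝ).1, (0:ℝ)) = ex i from rfl, hσ2 q hq i] at h1
    have : Dd (ex i) σ q * Dd et P (q.1, σ q) = 0 := by linarith
    exact (mul_eq_zero.1 this).resolve_right (hne q hq)
  have hxx : ∀ q ∈ W, ∀ i, Dd (ex i) (Dd (ex i) P) (q.1, σ q) = Dd (ex i) (Dd (ex i) P) q := by
    intro q hq i
    have hev : (fun q => Dd (ex i) P (q.1, σ q)) =ᶠ[𝓝 q] Dd (ex i) P := by
      filter_upwards [hW.mem_nhds hq] with y hy using hσ2 y hy i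
    have h1 := (Dd_congr (e := ex i) hev).self_of_nhds
    rw [Dd_comp_sig _ ((Dd_contDiffAt (S.sm (q.1, σ q) (hWΩ q hq))).differentiableAt (by simp))
      (hσ q hq), show ((ex i : (Fin d → ℝ) × ℝ).1, (0:ℝ)) = ex i from rfl, hx q hq i] at h1
    linarith
  have ht : ∀ q ∈ W, Dd et σ q = 1 := by
    intro q hq
    have hev : (fun q => P (q.1, σ q)) =ᶠ[𝓝 q] P := by
      filter_upwards [hW.mem_nhds hq] with y hy using hσ1 y hy
    have h1 := (Dd_congr (e := et) hev).self_of_nhds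
    rw [Dd_comp_sig _ ((S.sm (q.1, σ q) (hWΩ q hq)).differentiableAt (by simp)) (hσ q hq)] at h1
    have h0 : Dd ((et : (Fin d → ℝ) × ℝ).1, (0:ℝ)) P (q.1, σ q) = 0 := by
      unfold Dd
      rw [show ((et : (Fin d → ℝ) × ℝ).1, (0:ℝ)) = 0 from rfl, map_zero]
    have e1 := S.eq q (hWΩ q hq)
    have e2 := S.eq (q.1, σ q) (hWΩ q hq)
    simp only [hxx q hq, hσ2 q hq, hσ1 q hq] at e2
    rw [h0, zero_add] at h1
    have e3 : Dd et P (q.1, σ q) = Dd et P q := by rw [e1, e2]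
    have hn := hne q hq
    rw [e3] at h1 hn
    field_simp at h1
    exact h1
  -- local constancy
  obtain ⟨ε, hε, hball⟩ := Metric.isOpen_iff.1 hW q0 hq0
  have hcst : ∀ q ∈ Metric.ball q0 ε, σ q - q.2 = σ q0 - q0.2 := by
    intro q hq
    refine (convex_ball q0 ε).is_const_of_fderivWithin_eq_zero (𝕜 := ℝ)
      (f := fun q : (Fin d → ℝ) × ℝ => σ q - q.2) ?_ ?_ hq
      (Metric.mem_ball_self hε)
    · intro y hy
      exact ((hσ y (hball hy)).sub differentiableAt_snd).differentiableWithinAt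
    · intro y hy
      rw [fderivWithin_of_isOpen Metric.isOpen_ball hy]
      apply clm_zero
      · intro i
        rw [fderiv_fun_sub (hσ y (hball hy)) differentiableAt_snd]
        have := hx y (hball hy) i
        unfold Dd at this
        rw [ContinuousLinearMap.sub_apply, this, fderiv_snd]
        simp [ex]
      · rw [fderiv_fun_sub (hσ y (hball hy)) differentiableAt_snd]
        have := ht y (hball hy)
        unfold Dd at this
        rw [ContinuousLinearMap.sub_apply, this, fderiv_snd]
        simp [et]
  refine S.noshift (τ := σ q0 - q0.2) (sub_ne_zero.2 (hσ3 q0 hq0)) (hσ4 q0 hq0) (hWΩ q0 hq0)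
    (a := q0.2 - ε) (b := q0.2 + ε) (by linarith) ⟨Metric.ball q0.1 ε, Metric.ball_mem_nhds _ hε, ?_⟩
  intro x hx t ht
  have hq : (x, t) ∈ Metric.ball q0 ε := by
    rw [show q0 = (q0.1, q0.2) from rfl, ← ball_prod_same]
    refine ⟨hx, ?_⟩
    rw [Real.ball_eq_Ioo]; exact ht
  have h1 := hcst _ hq
  have h2 := hσ1 _ (hball hq)
  rw [← h1]
  simp only at h2 ⊢
  rw [← h2]
  congr 2
  ring

theorem sard1 {h h' : ℝ → ℝ} (hd : ∀ s, HasDerivAt h (h' s) s) {t1 a b : ℝ} (ht : t1 ∈ Ioo a b)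
    (h1 : h' t1 ≠ 0) : ∃ t ∈ Ioo a b, ∀ s, h s = h t → h' s ≠ 0 := by
  by_contra hcon
  push Not at hcon
  have hnull : volume (h '' {s | h' s = 0}) = 0 := by
    refine addHaar_image_eq_zero_of_det_fderivWithin_eq_zero volume
      (f' := fun s => ContinuousLinearMap.toSpanSingleton ℝ (h' s))
      (fun s _ => (hd s).hasFDerivAt.hasFDerivWithinAt) ?_
    intro s hs
    have hs' : h' s = 0 := hs
    simp [hs']
  obtain ⟨t2, ht2, hne⟩ : ∃ t2 ∈ Ioo a b, h t2 ≠ h t1 := by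
    by_contra hc
    push Not at hc
    have : h =ᶠ[𝓝 t1] fun _ => h t1 := by
      filter_upwards [isOpen_Ioo.mem_nhds ht] with s hs using hc s hs
    have h2 := (hd t1).deriv
    rw [this.deriv_eq] at h2
    simp at h2
    exact h1 h2.symm
  have hcont : Continuous h := continuous_iff_continuousAt.2 fun s => (hd s).continuousAt
  have hsub : uIcc (h t1) (h t2) ⊆ h '' {s | h' s = 0} := by
    intro y hy
    obtain ⟨t, ht', rfl⟩ := intermediate_value_uIcc hcont.continuousOn hy
    have hto : t ∈ Ioo a b := (ordConnected_Ioo.uIcc_subset ht ht2) ht'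
    obtain ⟨s, hs, hs0⟩ := hcon t hto
    exact ⟨s, hs0, hs⟩
  have := measure_mono_null hsub hnull
  rw [Real.volume_interval, ENNReal.ofReal_eq_zero] at this
  exact hne (sub_eq_zero.1 (abs_nonpos_iff.1 this))

theorem Sol.key {d : ℕ} {Ω : Set (Fin d → ℝ)} {f : ((Fin d → ℝ) × ℝ × (Fin d → ℝ)) → ℝ}
    {P : (Fin d → ℝ) × ℝ → ℝ} {om : ℝ} (S : Sol Ω f P om) {O : Set ((Fin d → ℝ) × ℝ)}
    (hO : IsOpen O) (hne : O.Nonempty) (hOΩ : ∀ q ∈ O, q.1 ∈ Ω ∧ q.2 ∈ Ioo 0 om)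
    (hpt : ∀ q ∈ O, Dd et P q ≠ 0) :
    ∃ q ∈ O, ∀ s ∈ Icc 0 om, s ≠ q.2 →
      ¬ (P (q.1, s) = P q ∧ ∀ i, Dd (ex i) P (q.1, s) = Dd (ex i) P q) := by
  obtain ⟨⟨x1, t1⟩, hq1⟩ := hne
  obtain ⟨ε, hε, hball⟩ := Metric.isOpen_iff.1 hO _ hq1
  have hx1 : x1 ∈ Ω := (hOΩ _ hq1).1
  obtain ⟨t', ht', hreg⟩ := sard1 (h := fun s => P (x1, s)) (h' := fun s => Dd et P (x1, s))
    (fun s => link_dt ((S.sm (x1, s) hx1).differentiableAt (by simp)))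
    (t1 := t1) (a := t1 - ε) (b := t1 + ε) ⟨by linarith, by linarith⟩ (hpt _ hq1)
  set a : (Fin d → ℝ) × ℝ := (x1, t') with ha
  have haO : a ∈ O := hball (by
    rw [← ball_prod_same]
    exact ⟨Metric.mem_ball_self hε, by rw [Real.ball_eq_Ioo]; exact ht'⟩)
  have hevsm : ∀ q : (Fin d → ℝ) × ℝ, q.1 ∈ Ω → ∀ᶠ y in 𝓝 q, ContDiffAt ℝ ∞ P y := by
    intro q hq
    filter_upwards [continuous_fst.continuousAt.eventually_mem (S.op.mem_nhds hq)] with y hy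
      using S.sm y hy
  set bad : (Fin d → ℝ) × ℝ → ℝ → Prop := fun q s =>
    P (q.1, s) = P q ∧ ∀ i, Dd (ex i) P (q.1, s) = Dd (ex i) P q with hbad
  set good : Set ℝ → Prop := fun A => ∃ N ∈ 𝓝 a, ∀ W, IsOpen W → W.Nonempty → W ⊆ N →
    ∃ W' ⊆ W, IsOpen W' ∧ W'.Nonempty ∧ ∀ q ∈ W', ∀ s ∈ A, s ≠ q.2 → ¬ bad q s with hgood
  have hmain : good (Icc 0 om) := by
    refine isCompact_Icc.induction_on (p := good) ?_ ?_ ?_ ?_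
    · exact ⟨univ, univ_mem, fun W h1 h2 _ => ⟨W, Subset.rfl, h1, h2, by simp⟩⟩
    · rintro A B hAB ⟨N, hN, h⟩
      refine ⟨N, hN, fun W h1 h2 h3 => ?_⟩
      obtain ⟨W', k1, k2, k3, k4⟩ := h W h1 h2 h3
      exact ⟨W', k1, k2, k3, fun q hq s hs => k4 q hq s (hAB hs)⟩
    · rintro A B ⟨N, hN, h⟩ ⟨N', hN', h'⟩
      refine ⟨N ∩ N', inter_mem hN hN', fun W h1 h2 h3 => ?_⟩
      obtain ⟨W', k1, k2, k3, k4⟩ := h W h1 h2 (h3.trans inter_subset_left)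
      obtain ⟨W'', l1, l2, l3, l4⟩ := h' W' k2 k3 (k1.trans (h3.trans inter_subset_right))
      refine ⟨W'', l1.trans k1, l2, l3, ?_⟩
      rintro q hq s (hs | hs)
      · exact k4 q (l1 hq) s hs
      · exact l4 q hq s hs
    · intro s hs
      -- it suffices to find a product neighbourhood
      have hcP : ContinuousAt P a := (S.sm a hx1).continuousAt
      have hmapc : ContinuousAt (fun z : ((Fin d → ℝ) × ℝ) × ℝ => (z.1.1, z.2)) (a, s) := by
        fun_prop
      by_cases hZ : P (x1, s) = P a
      swap
      · have hc1 : ContinuousAt (fun z : ((Fin d → ℝ) × ℝ) × ℝ => P (z.1.1, z.2) - P z.1) (a, s) := by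
          refine ContinuousAt.sub ?_ ?_
          · exact ContinuousAt.comp (g := P) (f := fun z : ((Fin d → ℝ) × ℝ) × ℝ => (z.1.1, z.2))
              (S.sm (x1, s) hx1).continuousAt hmapc
          · exact ContinuousAt.comp (g := P) (f := fun z : ((Fin d → ℝ) × ℝ) × ℝ => z.1)
              hcP (by fun_prop)
        have hev := hc1.eventually_ne (sub_ne_zero.2 hZ)
        rw [nhds_prod_eq] at hev
        obtain ⟨N, hN, A, hA, hNA⟩ := mem_prod_iff.1 hev
        refine ⟨A, mem_nhdsWithin_of_mem_nhds hA, N, hN, fun W h1 h2 h3 =>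
          ⟨W, Subset.rfl, h1, h2, ?_⟩⟩
        intro q hq s' hs' _ hb
        have : P (q.1, s') - P q ≠ 0 := hNA (mk_mem_prod (h3 hq) hs')
        exact this (sub_eq_zero.2 hb.1)
      · have hregs : Dd et P (x1, s) ≠ 0 := hreg s hZ
        obtain ⟨T, hT0, hT1, hT2⟩ := branch (hevsm (x1, s) hx1) hregs
        simp only at hT0 hT1
        have hev2 : ∀ᶠ z : ((Fin d → ℝ) × ℝ) × ℝ in 𝓝 (a, s),
            T (z.1.1, P (z.1.1, z.2)) = z.2 := hmapc.eventually hT2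
        rw [nhds_prod_eq] at hev2
        obtain ⟨N, hN, A, hA, hNA⟩ := mem_prod_iff.1 hev2
        have huniq : ∀ q ∈ N, ∀ s' ∈ A, P (q.1, s') = P q → s' = T (q.1, P q) := by
          intro q hq s' hs' hP
          have : T (q.1, P (q.1, s')) = s' := hNA (mk_mem_prod hq hs')
          rw [← this, hP]
        by_cases hst : s = t'
        · subst hst
          refine ⟨A, mem_nhdsWithin_of_mem_nhds hA, N ∩ {q | T (q.1, P q) = q.2},
            inter_mem hN hT2, fun W h1 h2 h3 => ⟨W, Subset.rfl, h1, h2, ?_⟩⟩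
          intro q hq s' hs' hne hb
          apply hne
          rw [huniq q (h3 hq).1 s' hs' hb.1]
          exact (h3 hq).2
        · set σ : (Fin d → ℝ) × ℝ → ℝ := fun q => T (q.1, P q) with hσ
          have hσa : σ a = s := by simp only [hσ]; rw [← hZ]; exact hT0
          have hmap : ContinuousAt (fun q : (Fin d → ℝ) × ℝ => (q.1, P q)) a :=
            continuousAt_fst.prodMk hcP
          rw [hZ] at hT1
          have hT1' := hmap.eventually hT1
          have hσc : ContinuousAt σ a :=
            ContinuousAt.comp (g := T) (f := fun q : (Fin d → ℝ) × ℝ => (q.1, P q))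
              hT1.self_of_nhds.1.continuousAt hmap
          have ev1 : ∀ᶠ q in 𝓝 a, σ q - q.2 ≠ 0 :=
            (hσc.sub continuousAt_snd).eventually_ne (by
              show σ a - a.2 ≠ 0
              rw [hσa]; exact sub_ne_zero.2 hst)
          have ev2 : ∀ᶠ q in 𝓝 a, |σ q - q.2| < om := by
            refine (hσc.sub continuousAt_snd).abs.eventually_lt continuousAt_const ?_
            show |σ a - a.2| < om
            rw [hσa, abs_lt]
            have := (hOΩ a haO).2
            exact ⟨by linarith [hs.1, this.2], by linarith [hs.2, this.1]⟩
          have ev3 : ∀ᶠ q in 𝓝 a, Dd et P (q.1, σ q) ≠ 0 := by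
            have : ContinuousAt (fun q : (Fin d → ℝ) × ℝ => Dd et P (q.1, σ q)) a := by
              refine ContinuousAt.comp (g := Dd et P)
                (f := fun q : (Fin d → ℝ) × ℝ => (q.1, σ q)) ?_ (continuousAt_fst.prodMk hσc)
              exact (Dd_contDiffAt (S.sm _ hx1)).continuousAt
            refine this.eventually_ne ?_
            rw [hσa]; exact hregs
          refine ⟨A, mem_nhdsWithin_of_mem_nhds hA, _, inter_mem hN (inter_mem (hO.mem_nhds haO)
            (hT1'.and (ev1.and (ev2.and ev3)))), fun W h1 h2 h3 => ?_⟩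
          have hWO : ∀ q ∈ W, q ∈ O := fun q hq => (h3 hq).2.1
          have hWΩ : ∀ q ∈ W, q.1 ∈ Ω := fun q hq => (hOΩ q (hWO q hq)).1
          have hσs : ∀ q ∈ W, ContDiffAt ℝ ∞ σ q := by
            intro q hq
            exact ContDiffAt.comp (g := T) (f := fun q : (Fin d → ℝ) × ℝ => (q.1, P q)) q
              (h3 hq).2.2.1.1 (contDiffAt_fst.prodMk (S.sm q (hWΩ q hq)))
          by_cases hex : ∃ q ∈ W, ∃ i, Dd (ex i) P (q.1, σ q) - Dd (ex i) P q ≠ 0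
          · obtain ⟨q, hq, i, hi⟩ := hex
            have hcW : ContinuousOn (fun q : (Fin d → ℝ) × ℝ =>
                Dd (ex i) P (q.1, σ q) - Dd (ex i) P q) W := by
              intro y hy
              refine ContinuousAt.continuousWithinAt (ContinuousAt.sub ?_
                (Dd_contDiffAt (S.sm y (hWΩ y hy))).continuousAt)
              refine ContinuousAt.comp (g := Dd (ex i) P)
                (f := fun q : (Fin d → ℝ) × ℝ => (q.1, σ q)) ?_
                (continuousAt_fst.prodMk (hσs y hy).continuousAt)
              exact (Dd_contDiffAt (S.sm (y.1, σ y) (hWΩ y hy))).continuousAt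
            refine ⟨_, inter_subset_left, hcW.isOpen_inter_preimage h1 isOpen_ne, ⟨q, hq, hi⟩, ?_⟩
            rintro y ⟨hy, hyi⟩ s' hs' _ hb
            have := huniq y (h3 hy).1 s' hs' hb.1
            rw [this] at hb
            exact hyi (sub_eq_zero.2 (hb.2 i))
          · push Not at hex
            exfalso
            obtain ⟨q0, hq0⟩ := h2
            refine S.core h1 hq0 hWΩ (σ := σ) (fun q hq => (hσs q hq).differentiableAt (by simp))
              (fun q hq => (h3 hq).2.2.1.2) (fun q hq i => sub_eq_zero.1 (hex q hq i))
              (fun q hq => (h3 hq).2.2.2.2.2) (fun q hq => sub_ne_zero.1 (h3 hq).2.2.2.1)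
              (fun q hq => (h3 hq).2.2.2.2.1)
  obtain ⟨N, hN, h⟩ := hmain
  obtain ⟨W', k1, k2, ⟨q, hq⟩, k4⟩ := h (interior (N ∩ O)) isOpen_interior
    ⟨a, mem_interior_iff_mem_nhds.2 (inter_mem hN (hO.mem_nhds haO))⟩
    (interior_subset.trans inter_subset_left)
  exact ⟨q, (interior_subset (k1 hq)).2, k4 q hq⟩

/-- the jet `(x, p, ∇p)` -/
noncomputable def jt {d : ℕ} (P : (Fin d → ℝ) × ℝ → ℝ) (q : (Fin d → ℝ) × ℝ) :
    (Fin d → ℝ) × ℝ × (Fin d → ℝ) := (q.1, P q, fun i => Dd (ex i) P q)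

/-- the vector `(∂ₜp, ∇∂ₜp)` -/
noncomputable def Tv {d : ℕ} (P : (Fin d → ℝ) × ℝ → ℝ) (q : (Fin d → ℝ) × ℝ) :
    ℝ × (Fin d → ℝ) := (Dd et P q, fun i => Dd (ex i) (Dd et P) q)

theorem jt_contDiffAt {d : ℕ} {P : (Fin d → ℝ) × ℝ → ℝ} {q : (Fin d → ℝ) × ℝ}
    (h : ContDiffAt ℝ ∞ P q) : ContDiffAt ℝ ∞ (jt P) q :=
  contDiffAt_fst.prodMk (h.prodMk (contDiffAt_pi.2 fun _ => Dd_contDiffAt h))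

theorem Tv_contDiffAt {d : ℕ} {P : (Fin d → ℝ) × ℝ → ℝ} {q : (Fin d → ℝ) × ℝ}
    (h : ContDiffAt ℝ ∞ P q) : ContDiffAt ℝ ∞ (Tv P) q :=
  (Dd_contDiffAt h).prodMk (contDiffAt_pi.2 fun _ => Dd_contDiffAt (Dd_contDiffAt h))

theorem Sol.findO {d : ℕ} {Ω : Set (Fin d → ℝ)} {f : ((Fin d → ℝ) × ℝ × (Fin d → ℝ)) → ℝ}
    {P : (Fin d → ℝ) × ℝ → ℝ} {om : ℝ} (S : Sol Ω f P om)
    {V : ((Fin d → ℝ) × ℝ) → ℝ × (Fin d → ℝ)} (hV : ContinuousOn V (Ω ×ˢ Icc (0:ℝ) om))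
    (hnc : ∃ q ∈ Ω ×ˢ Icc (0:ℝ) om, LinearIndependent ℝ ![Tv P q, V q]) :
    ∃ O, IsOpen O ∧ O.Nonempty ∧ (∀ q ∈ O, q.1 ∈ Ω ∧ q.2 ∈ Ioo 0 om) ∧
      (∀ q ∈ O, Dd et P q ≠ 0) ∧
      (∀ q ∈ O, ∃ k, Dd et P q * (V q).2 k - Dd (ex k) (Dd et P) q * (V q).1 ≠ 0) := by
  obtain ⟨qh, hqh, hli⟩ := hnc
  have hTc : ContinuousOn (Tv P) (Ω ×ˢ Icc (0:ℝ) om) := fun q hq =>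
    (Tv_contDiffAt (S.sm q hq.1)).continuousAt.continuousWithinAt
  have hpair : ContinuousOn (fun q => ![Tv P q, V q]) (Ω ×ˢ Icc (0:ℝ) om) := by
    rw [continuousOn_pi]
    intro i
    fin_cases i
    · exact hTc
    · exact hV
  set L : Set (Fin 2 → ℝ × (Fin d → ℝ)) := {v | LinearIndependent ℝ v} with hL
  have hLo : IsOpen L := isOpen_setOf_linearIndependent
  set M := (Ω ×ˢ Ioo (0:ℝ) om) ∩ (fun q => ![Tv P q, V q]) ⁻¹' L with hM
  have hMo : IsOpen M :=
    (hpair.mono (prod_mono_right Ioo_subset_Icc_self)).isOpen_inter_preimage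
      (S.op.prod isOpen_Ioo) hLo
  have hMne : M.Nonempty := by
    have h1 : (fun q => ![Tv P q, V q]) ⁻¹' L ∈ 𝓝[Ω ×ˢ Icc (0:ℝ) om] qh :=
      (hpair qh hqh).preimage_mem_nhdsWithin (hLo.mem_nhds hli)
    have h2 : qh ∈ closure (Ω ×ˢ Ioo (0:ℝ) om) := by
      rw [closure_prod_eq, closure_Ioo S.om_pos.ne]
      exact ⟨subset_closure hqh.1, hqh.2⟩
    have h3 : (𝓝[Ω ×ˢ Ioo (0:ℝ) om] qh).NeBot := mem_closure_iff_nhdsWithin_neBot.1 h2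
    have h4 : (fun q => ![Tv P q, V q]) ⁻¹' L ∈ 𝓝[Ω ×ˢ Ioo (0:ℝ) om] qh :=
      nhdsWithin_mono _ (prod_mono_right Ioo_subset_Icc_self) h1
    obtain ⟨q, hq⟩ := h3.nonempty_of_mem (inter_mem self_mem_nhdsWithin h4)
    exact ⟨q, hq⟩
  have hcon : ContinuousOn (Dd et P) M := fun q hq =>
    (Dd_contDiffAt (S.sm q hq.1.1)).continuousAt.continuousWithinAt
  have hex : ∃ q ∈ M, Dd et P q ≠ 0 := by
    by_contra hc
    push Not at hc
    obtain ⟨q, hq⟩ := hMne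
    have hev : Dd et P =ᶠ[𝓝 q] fun _ => 0 := by
      filter_upwards [hMo.mem_nhds hq] with y hy using hc y hy
    have hT : Tv P q = 0 := by
      unfold Tv
      ext i
      · exact hc q hq
      · simp only
        rw [(Dd_congr hev).self_of_nhds, Dd_zero]; rfl
    have h2 : LinearIndependent ℝ ![Tv P q, V q] := hq.2
    exact h2.ne_zero 0 hT
  refine ⟨M ∩ Dd et P ⁻¹' {0}ᶜ, hcon.isOpen_inter_preimage hMo isOpen_compl_singleton, ?_, ?_, ?_, ?_⟩
  · obtain ⟨q, hq, h⟩ := hex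
    exact ⟨q, hq, h⟩
  · exact fun q hq => hq.1.1
  · exact fun q hq => hq.2
  · intro q hq
    by_contra hc
    push Not at hc
    have h2 : LinearIndependent ℝ ![Tv P q, V q] := hq.1.2
    rw [LinearIndependent.pair_iff] at h2
    have h3 := h2 ((V q).1) (-(Dd et P q)) (by
      ext i
      · simp [Tv]; ring
      · simp [Tv]; linarith [hc i])
    exact hq.2 (neg_eq_zero.1 h3.2)

theorem Sol.jt_periodic {d : ℕ} {Ω : Set (Fin d → ℝ)} {f : ((Fin d → ℝ) × ℝ × (Fin d → ℝ)) → ℝ}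
    {P : (Fin d → ℝ) × ℝ → ℝ} {om : ℝ} (S : Sol Ω f P om) {x : Fin d → ℝ} (hx : x ∈ Ω) :
    Function.Periodic (fun t => jt P (x, t)) om := by
  intro t
  have hev : (fun q : (Fin d → ℝ) × ℝ => P (q.1, q.2 + om)) =ᶠ[𝓝 (x, t)] P := by
    filter_upwards [continuous_fst.continuousAt.eventually_mem (S.op.mem_nhds hx)] with y hy
    exact S.per y.1 (subset_closure hy) y.2
  simp only [jt]
  refine Prod.ext rfl (Prod.ext (S.per x (subset_closure hx) t) (funext fun i => ?_))
  have := (Dd_congr (e := ex i) hev).self_of_nhds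
  rw [Dd_shift] at this
  exact this

theorem local_G {d : ℕ} {P : (Fin d → ℝ) × ℝ → ℝ} {q0 : (Fin d → ℝ) × ℝ}
    (hP : ∀ᶠ q in 𝓝 q0, ContDiffAt ℝ ∞ P q) (h0 : Dd et P q0 ≠ 0) (k : Fin d) :
    ∃ G : (Fin d → ℝ) × ℝ × (Fin d → ℝ) → ℝ,
      (∀ᶠ z in 𝓝 (jt P q0), ContDiffAt ℝ ∞ G z) ∧
      (∀ᶠ q in 𝓝 q0, G (jt P q) = 0 ∧ ∀ v : ℝ × (Fin d → ℝ),
        Dd et P q * fderiv ℝ G (jt P q) (0, v)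
          = Dd et P q * v.2 k - Dd (ex k) (Dd et P) q * v.1) := by
  obtain ⟨T, hT0, hT1, hT2⟩ := branch hP h0
  have hP0 := hP.self_of_nhds
  set π : (Fin d → ℝ) × ℝ × (Fin d → ℝ) →L[ℝ] (Fin d → ℝ) × ℝ :=
    (ContinuousLinearMap.fst ℝ _ _).prod
      ((ContinuousLinearMap.fst ℝ _ _).comp (ContinuousLinearMap.snd ℝ _ _)) with hπ
  have hπv : ∀ z, π z = (z.1, z.2.1) := fun z => rfl
  set κ : (Fin d → ℝ) × ℝ × (Fin d → ℝ) →L[ℝ] ℝ :=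
    (ContinuousLinearMap.proj k).comp
      ((ContinuousLinearMap.snd ℝ _ _).comp (ContinuousLinearMap.snd ℝ _ _)) with hκ
  have hκv : ∀ z, κ z = z.2.2 k := fun z => rfl
  set H : (Fin d → ℝ) × ℝ → ℝ := fun y => Dd (ex k) P (y.1, T y) with hH
  have hT00 := hT1.self_of_nhds
  have hcT : Tendsto (fun y : (Fin d → ℝ) × ℝ => (y.1, T y)) (𝓝 (q0.1, P q0)) (𝓝 q0) := by
    have : ContinuousAt (fun y : (Fin d → ℝ) × ℝ => (y.1, T y)) (q0.1, P q0) :=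
      continuousAt_fst.prodMk hT00.1.continuousAt
    have h2 := this.tendsto
    simp only [hT0] at h2
    exact h2
  have hHs : ∀ᶠ y in 𝓝 (q0.1, P q0), ContDiffAt ℝ ∞ H y := by
    filter_upwards [hT1, hcT.eventually hP] with y h1 h2
    exact (Dd_contDiffAt (e := ex k) h2).comp y (contDiffAt_fst.prodMk h1.1)
  have hcP : Tendsto (fun q : (Fin d → ℝ) × ℝ => (q.1, P q)) (𝓝 q0) (𝓝 (q0.1, P q0)) :=
    (continuousAt_fst.prodMk hP0.continuousAt).tendsto
  have hcπ : Tendsto π (𝓝 (jt P q0)) (𝓝 (q0.1, P q0)) := π.continuous.tendsto (jt P q0)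
  refine ⟨fun z => κ z - H (π z), ?_, ?_⟩
  · filter_upwards [hcπ.eventually hHs] with z hz
    exact κ.contDiff.contDiffAt.sub (hz.comp z π.contDiff.contDiffAt)
  · filter_upwards [hP, hT2, hcP.eventually hHs, hcP.eventually hT1.eventually_nhds] with q h1 h2 h3 h4
    have hHq : H (q.1, P q) = Dd (ex k) P q := by
      simp only [hH, h2]
    have h4' := h4.self_of_nhds
    refine ⟨?_, fun v => ?_⟩
    · change Dd (ex k) P q - H (q.1, P q) = 0
      rw [hHq, sub_self]
    · have hd : HasFDerivAt (fun z => κ z - H (π z))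
          (κ - (fderiv ℝ H (q.1, P q)).comp π) (jt P q) := by
        have a1 : HasFDerivAt H (fderiv ℝ H (q.1, P q)) (π (jt P q)) :=
          (h3.differentiableAt (by simp)).hasFDerivAt
        exact κ.hasFDerivAt.sub (a1.comp (jt P q) π.hasFDerivAt)
      rw [hd.fderiv]
      have e1 : Dd et P q * Dd et T (q.1, P q) = 1 := by
        have b1 := Dd_comp_sig (F := P) (σ := T) (q := (q.1, P q)) et
          (by simpa [h2] using h1.differentiableAt (by simp)) (h4'.1.differentiableAt (by simp))
        have b2 : Dd et (fun y : (Fin d → ℝ) × ℝ => P (y.1, T y)) (q.1, P q) = 1 := by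
          have : (fun y : (Fin d → ℝ) × ℝ => P (y.1, T y)) =ᶠ[𝓝 (q.1, P q)] fun y => y.2 := by
            filter_upwards [h4] with y hy using hy.2
          rw [(Dd_congr (e := et) this).self_of_nhds]
          change fderiv ℝ Prod.snd (q.1, P q) et = 1
          rw [fderiv_snd]; rfl
        rw [b2] at b1
        simp only [h2] at b1
        have b3 : Dd ((et : (Fin d → ℝ) × ℝ).1, 0) P q = 0 := by
          simp [Dd, et, ← Prod.zero_eq_mk]
        have b4 : (q.1, q.2) = q := rfl
        rw [b4, b3] at b1
        linarith
      have e2 : Dd et H (q.1, P q) = Dd et T (q.1, P q) * Dd et (Dd (ex k) P) q := by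
        have b1 := Dd_comp_sig (F := Dd (ex k) P) (σ := T) (q := (q.1, P q)) et
          (by simpa [h2] using (Dd_contDiffAt (e := ex k) h1).differentiableAt (by simp))
          (h4'.1.differentiableAt (by simp))
        simp only [h2] at b1
        have b3 : Dd ((et : (Fin d → ℝ) × ℝ).1, 0) (Dd (ex k) P) q = 0 := by
          simp [Dd, et, ← Prod.zero_eq_mk]
        have b4 : (q.1, q.2) = q := rfl
        rw [b4, b3, zero_add] at b1
        exact b1
      have e3 : fderiv ℝ H (q.1, P q) (π (0, v)) = v.1 * Dd et H (q.1, P q) := by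
        have : π (0, v) = v.1 • et := by rw [hπv]; ext <;> simp [et]
        rw [this, map_smul]; rfl
      change Dd et P q * (v.2 k - fderiv ℝ H (q.1, P q) (π (0, v))) = _
      rw [e3, e2, Dd_commAt h1]
      linear_combination (-(v.1 * Dd (ex k) (Dd et P) q)) * e1

theorem integral_ne {d : ℕ} {Ω : Set (Fin d → ℝ)} (hΩ : IsOpen Ω) {om : ℝ} (hom : 0 < om)
    {F : (Fin d → ℝ) × ℝ → ℝ} (hF : ContinuousOn F (Ω ×ˢ Icc 0 om))
    {N : Set ((Fin d → ℝ) × ℝ)} (hN : IsCompact N) (hNs : N ⊆ Ω ×ˢ Icc 0 om)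
    (hz : ∀ q ∈ Ω ×ˢ Icc 0 om, q ∉ N → F q = 0)
    {c : ℝ} (hc : ∀ q ∈ Ω ×ˢ Icc 0 om, 0 ≤ c * F q)
    {q0 : (Fin d → ℝ) × ℝ} (hq0 : q0 ∈ Ω ×ˢ Ioo 0 om) (h0 : 0 < c * F q0) :
    (∫ t in (0:ℝ)..om, ∫ x in Ω, F (x, t)) ≠ 0 := by
  set D := Ω ×ˢ Icc (0:ℝ) om with hD
  have hDm : MeasurableSet D := hΩ.measurableSet.prod measurableSet_Icc
  have hFint : IntegrableOn F D :=
    ((hF.mono hNs).integrableOn_compact hN).of_forall_sdiff_eq_zero hDm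
      (fun q hq => hz q hq.1 hq.2)
  have hpos : 0 < ∫ q in D, c * F q := by
    rw [setIntegral_pos_iff_support_of_nonneg_ae]
    · set U := (Ω ×ˢ Ioo (0:ℝ) om) ∩ (fun q => c * F q) ⁻¹' (Ioi 0) with hU
      have hUo : IsOpen U := by
        refine ContinuousOn.isOpen_inter_preimage ?_ (hΩ.prod isOpen_Ioo) isOpen_Ioi
        exact continuousOn_const.mul (hF.mono (prod_mono_right Ioo_subset_Icc_self))
      refine (hUo.measure_pos volume ⟨q0, hq0, h0⟩).trans_le (measure_mono ?_)
      rintro q ⟨h1, h2⟩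
      exact ⟨ne_of_gt h2, h1.1, Ioo_subset_Icc_self h1.2⟩
    · filter_upwards [ae_restrict_mem hDm] with q hq using hc q hq
    · exact hFint.const_mul c
  rw [integral_const_mul] at hpos
  have hfub : ∫ q in D, F q = ∫ t in (0:ℝ)..om, ∫ x in Ω, F (x, t) := by
    rw [intervalIntegral.integral_of_le hom.le, ← integral_Icc_eq_integral_Ioc, hD,
      Measure.volume_eq_prod, ← Measure.prod_restrict, integral_prod_symm]
    rw [Measure.prod_restrict]
    exact hFint
  rw [← hfub]
  intro h
  rw [h] at hpos
  simp at hpos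

theorem Sol.localize {d : ℕ} {Ω : Set (Fin d → ℝ)} {f : ((Fin d → ℝ) × ℝ × (Fin d → ℝ)) → ℝ}
    {P : (Fin d → ℝ) × ℝ → ℝ} {om : ℝ} (S : Sol Ω f P om) {q0 : (Fin d → ℝ) × ℝ}
    (hq0 : q0.1 ∈ Ω)
    (hu : ∀ s ∈ Icc 0 om, s ≠ q0.2 →
      ¬ (P (q0.1, s) = P q0 ∧ ∀ i, Dd (ex i) P (q0.1, s) = Dd (ex i) P q0))
    {N : Set ((Fin d → ℝ) × ℝ)} (hN : N ∈ 𝓝 q0) :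
    ∀ᶠ z in 𝓝 (jt P q0), ∀ s ∈ Icc 0 om, jt P (z.1, s) = z → (z.1, s) ∈ N := by
  refine isCompact_Icc.eventually_forall_of_forall_eventually ?_
  intro s hs
  by_cases hst : s = q0.2
  · have hc : Tendsto (fun y : ((Fin d → ℝ) × ℝ × (Fin d → ℝ)) × ℝ => (y.1.1, y.2))
        (𝓝 (jt P q0, s)) (𝓝 q0) := by
      have : Continuous (fun y : ((Fin d → ℝ) × ℝ × (Fin d → ℝ)) × ℝ => (y.1.1, y.2)) := by
        fun_prop
      have h := this.tendsto (jt P q0, s)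
      rw [hst] at h ⊢
      exact h
    filter_upwards [hc.eventually hN] with y hy _ using hy
  · have hne : jt P (q0.1, s) ≠ jt P q0 := by
      intro h
      refine hu s hs hst ⟨congrArg (fun z => z.2.1) h, fun i => congrArg (fun z => z.2.2 i) h⟩
    have hc : ContinuousAt (fun y : ((Fin d → ℝ) × ℝ × (Fin d → ℝ)) × ℝ => jt P (y.1.1, y.2))
        (jt P q0, s) := by
      have h1 : ContinuousAt (jt P) (q0.1, s) := (jt_contDiffAt (S.sm (q0.1, s) hq0)).continuousAt
      have h2 : ContinuousAt (fun y : ((Fin d → ℝ) × ℝ × (Fin d → ℝ)) × ℝ => (y.1.1, y.2))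
        (jt P q0, s) := by fun_prop
      exact ContinuousAt.comp (x := (jt P q0, s)) (g := jt P) h1 h2
    have hd : ContinuousAt (fun y : ((Fin d → ℝ) × ℝ × (Fin d → ℝ)) × ℝ =>
        jt P (y.1.1, y.2) - y.1) (jt P q0, s) := hc.sub continuousAt_fst
    have hev := hd.eventually_ne (y := 0) (sub_ne_zero.2 hne)
    filter_upwards [hev] with y hy h
    exact absurd (sub_eq_zero.2 h) hy

theorem Sol.construct {d : ℕ} {Ω : Set (Fin d → ℝ)} {f : ((Fin d → ℝ) × ℝ × (Fin d → ℝ)) → ℝ}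
    {P : (Fin d → ℝ) × ℝ → ℝ} {om : ℝ} (S : Sol Ω f P om)
    {V : ((Fin d → ℝ) × ℝ) → ℝ × (Fin d → ℝ)} (hV : ContinuousOn V (Ω ×ˢ Icc (0:ℝ) om))
    (hnc : ∃ q ∈ Ω ×ˢ Icc (0:ℝ) om, LinearIndependent ℝ ![Tv P q, V q]) :
    ∃ g : (Fin d → ℝ) × ℝ × (Fin d → ℝ) → ℝ, ContDiff ℝ ∞ g ∧
      (∀ q, q.1 ∈ Ω → g (jt P q) = 0) ∧
      (∫ t in (0:ℝ)..om, ∫ x in Ω, fderiv ℝ g (jt P (x, t)) (0, V (x, t))) ≠ 0 := by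
  obtain ⟨O, hO, hOne, hOs, hOt, hOV⟩ := S.findO hV hnc
  obtain ⟨q0, hq0, hu⟩ := S.key hO hOne hOs hOt
  obtain ⟨k, hk⟩ := hOV q0 hq0
  have hPev : ∀ᶠ q in 𝓝 q0, ContDiffAt ℝ ∞ P q := by
    filter_upwards [hO.mem_nhds hq0] with q hq using S.sm q (hOs q hq).1
  obtain ⟨G, hG1, hG2⟩ := local_G hPev (hOt q0 hq0) k
  -- the reduced minor
  set m : (Fin d → ℝ) × ℝ → ℝ := fun q =>
    (V q).2 k - (Dd et P q)⁻¹ * (Dd (ex k) (Dd et P) q * (V q).1) with hm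
  have hOD : O ⊆ Ω ×ˢ Icc (0:ℝ) om := fun q hq => ⟨(hOs q hq).1, Ioo_subset_Icc_self (hOs q hq).2⟩
  have hmc : ContinuousAt m q0 := by
    have hVa : ContinuousAt V q0 := (hV.mono hOD).continuousAt (hO.mem_nhds hq0)
    have hPs := S.sm q0 (hOs q0 hq0).1
    have a1 : ContinuousAt (Dd et P) q0 := (Dd_contDiffAt hPs).continuousAt
    have a2 : ContinuousAt (Dd (ex k) (Dd et P)) q0 :=
      (Dd_contDiffAt (Dd_contDiffAt hPs)).continuousAt
    have a3 : ContinuousAt (fun q => (V q).1) q0 := hVa.fst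
    have a4 : ContinuousAt (fun q => (V q).2 k) q0 := (continuousAt_pi.1 hVa.snd) k
    exact a4.sub ((a1.inv₀ (hOt q0 hq0)).mul (a2.mul a3))
  have hm0 : m q0 ≠ 0 := by
    intro h
    apply hk
    have := hOt q0 hq0
    simp only [hm] at h
    field_simp at h
    linarith
  have hmpos : ∀ᶠ q in 𝓝 q0, 0 < m q0 * m q := by
    have : ContinuousAt (fun q => m q0 * m q) q0 := continuousAt_const.mul hmc
    exact this.eventually (lt_mem_nhds (mul_self_pos.2 hm0))
  have hgood := (hG2.and (hmpos.and (hO.mem_nhds hq0)))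
  obtain ⟨ρ, hρ, hρs⟩ := Metric.nhds_basis_closedBall.eventually_iff.1 hgood
  set N := Metric.closedBall q0 ρ with hN
  have hNO : N ⊆ O := fun q hq => (hρs hq).2.2
  have hNc : IsCompact N := isCompact_closedBall _ _
  have hloc := S.localize (hOs q0 hq0).1 hu (Metric.closedBall_mem_nhds q0 hρ)
  obtain ⟨r, hr, hrs⟩ := Metric.nhds_basis_closedBall.eventually_iff.1 (hloc.and hG1)
  let χ : ContDiffBump (jt P q0) := ⟨r / 2, r, by positivity, by linarith⟩
  have hts : tsupport χ = Metric.closedBall (jt P q0) r := χ.tsupport_eq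
  have hχs : ContDiff ℝ ∞ χ := χ.contDiff
  set g : (Fin d → ℝ) × ℝ × (Fin d → ℝ) → ℝ := fun z => χ z * G z with hg
  have hoff : ∀ z, z ∉ tsupport χ → g =ᶠ[𝓝 z] fun _ => 0 := by
    intro z hz
    filter_upwards [notMem_tsupport_iff_eventuallyEq.1 hz] with y hy
    simp [hg, hy]
  have hgs : ContDiff ℝ ∞ g := by
    rw [contDiff_iff_contDiffAt]
    intro z
    by_cases hz : z ∈ tsupport χ
    · exact hχs.contDiffAt.mul (hrs (hts ▸ hz)).2
    · exact contDiffAt_const.congr_of_eventuallyEq (hoff z hz)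
  have hin : ∀ q ∈ Ω ×ˢ Icc (0:ℝ) om, jt P q ∈ tsupport χ → q ∈ N := by
    intro q hq hz
    exact (hrs (hts ▸ hz)).1 q.2 hq.2 rfl
  have hg0 : ∀ q ∈ Ω ×ˢ Icc (0:ℝ) om, g (jt P q) = 0 := by
    intro q hq
    by_cases hz : jt P q ∈ tsupport χ
    · have := (hρs (hin q hq hz)).1.1
      simp [hg, this]
    · exact (hoff _ hz).self_of_nhds
  set F : (Fin d → ℝ) × ℝ → ℝ := fun q => fderiv ℝ g (jt P q) (0, V q) with hF
  have hF0 : ∀ q ∈ Ω ×ˢ Icc (0:ℝ) om, jt P q ∉ tsupport χ → F q = 0 := by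
    intro q hq hz
    simp [hF, (hoff _ hz).fderiv_eq]
  have hF1 : ∀ q ∈ Ω ×ˢ Icc (0:ℝ) om, jt P q ∈ tsupport χ → F q = χ (jt P q) * m q := by
    intro q hq hz
    have hqN := hin q hq hz
    obtain ⟨⟨hGz, hGd⟩, -, hqO⟩ := hρs hqN
    have hGs := (hrs (hts ▸ hz)).2
    have h1 := (hχs.contDiffAt (x := jt P q)).differentiableAt (by simp)
    have h2 := hGs.differentiableAt (by simp)
    have h3 := (h1.hasFDerivAt.mul h2.hasFDerivAt).fderiv
    have h4 : fderiv ℝ g (jt P q) = χ (jt P q) • fderiv ℝ G (jt P q) := by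
      have : fderiv ℝ g (jt P q) = _ := h3
      rw [this, hGz]; simp
    have h5 := hGd (V q)
    have h6 : fderiv ℝ G (jt P q) (0, V q) = m q := by
      have := hOt q hqO
      simp only [hm]
      field_simp
      linarith
    simp only [hF]
    rw [h4]
    change χ (jt P q) * fderiv ℝ G (jt P q) (0, V q) = _
    rw [h6]
  refine ⟨g, hgs, ?_, ?_⟩
  · intro q hq
    obtain ⟨s, hs, hs2⟩ := (S.jt_periodic hq).exists_mem_Ico₀ S.om_pos q.2
    have e : jt P q = jt P (q.1, s) := hs2
    rw [e]
    exact hg0 (q.1, s) ⟨hq, Ico_subset_Icc_self hs⟩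
  · have hq0D : q0 ∈ Ω ×ˢ Ioo (0:ℝ) om := hOs q0 hq0
    refine integral_ne (F := F) (N := N) (c := m q0) (q0 := q0) S.op S.om_pos ?_ hNc
      (hNO.trans hOD) ?_ ?_ hq0D ?_
    · have h1 : ContinuousOn (fun q => fderiv ℝ g (jt P q)) (Ω ×ˢ Icc (0:ℝ) om) := by
        intro q hq
        have : ContinuousAt (jt P) q := (jt_contDiffAt (S.sm q hq.1)).continuousAt
        exact ((hgs.continuous_fderiv (by simp)).continuousAt.comp this).continuousWithinAt
      exact h1.clm_apply (continuousOn_const.prodMk hV)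
    · intro q hq hqN
      exact hF0 q hq (fun h => hqN (hin q hq h))
    · intro q hq
      by_cases hz : jt P q ∈ tsupport χ
      · rw [hF1 q hq hz]
        have := (hρs (hin q hq hz)).2.1
        have h2 : 0 ≤ χ (jt P q) := χ.nonneg
        nlinarith
      · rw [hF0 q hq hz]; simp
    · have hz : jt P q0 ∈ tsupport χ := by
        rw [hts]; exact Metric.mem_closedBall_self hr.le
      rw [hF1 q0 (hOD hq0) hz]
      have : χ (jt P q0) = 1 := χ.one_of_mem_closedBall (Metric.mem_closedBall_self χ.rIn_pos.le)
      rw [this, one_mul]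
      exact mul_self_pos.2 hm0

theorem final_wrap {d : ℕ} {Ω : Set (Fin d → ℝ)} (hΩo : IsOpen Ω) (hΩc : IsConnected Ω)
    (hΩb : Bornology.IsBounded Ω)
    {f : ((Fin d → ℝ) × ℝ × (Fin d → ℝ)) → ℝ}
    (hf : ContDiffOn ℝ ∞ f (closure Ω ×ˢ ((univ : Set ℝ) ×ˢ (univ : Set (Fin d → ℝ)))))
    {p : (Fin d → ℝ) → ℝ → ℝ}
    (hpsmooth : ContDiffOn ℝ ∞
      (fun q : (Fin d → ℝ) × ℝ => p q.1 q.2) (Ω ×ˢ (univ : Set ℝ)))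
    (hpc : ContinuousOn (fun q : (Fin d → ℝ) × ℝ => p q.1 q.2)
      (closure Ω ×ˢ (univ : Set ℝ)))
    (hpeq : ∀ x ∈ Ω, ∀ t : ℝ,
      deriv (p x) t = lap (fun y => p y t) x
        + f (x, p x t, fun i => pd i (fun y => p y t) x))
    (hpbc : ∀ x ∈ frontier Ω, ∀ t : ℝ, p x t = 0)
    {om : ℝ} (hom : 0 < om)
    (hper : ∀ x ∈ closure Ω, ∀ t : ℝ, p x (t + om) = p x t)
    (hmin : ∀ om' : ℝ, 0 < om' →
      (∀ x ∈ closure Ω, ∀ t : ℝ, p x (t + om') = p x t) → om ≤ om')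
    (hpbnd : ∃ R : ℝ, ∀ x ∈ Ω, ∀ t : ℝ, |p x t| ≤ R ∧ ∀ i, |pd i (fun y => p y t) x| ≤ R)
    {V : ((Fin d → ℝ) × ℝ) → ℝ × (Fin d → ℝ)}
    (hV : ContDiffOn ℝ ∞ V (Ω ×ˢ Set.Icc (0:ℝ) om))
    (hVnc : ∃ q ∈ Ω ×ˢ Set.Icc (0:ℝ) om,
      (∀ c : ℝ, V q ≠
        c • ((deriv (p q.1) q.2, fun i => pd i (fun y => deriv (p y) q.2) q.1) :
          ℝ × (Fin d → ℝ))) ∧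
      (∀ c : ℝ,
        ((deriv (p q.1) q.2, fun i => pd i (fun y => deriv (p y) q.2) q.1) :
          ℝ × (Fin d → ℝ)) ≠ c • V q)) :
    ∃ g : ((Fin d → ℝ) × ℝ × (Fin d → ℝ)) → ℝ,
      ContDiff ℝ ∞ g ∧
      (∀ x ∈ Ω, ∀ t : ℝ, g (x, p x t, fun i => pd i (fun y => p y t) x) = 0) ∧
      (∫ t in (0:ℝ)..om, (∫ x in Ω,
        (fderiv ℝ (fun w : ℝ × (Fin d → ℝ) => g (x, w.1, w.2))
          (p x t, fun i => pd i (fun y => p y t) x)) (V (x, t)))) ≠ 0 := by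
  set P : (Fin d → ℝ) × ℝ → ℝ := fun q => p q.1 q.2 with hP
  have hsm : ∀ q : (Fin d → ℝ) × ℝ, q.1 ∈ Ω → ContDiffAt ℝ ∞ P q := fun q hq =>
    hpsmooth.contDiffAt ((hΩo.prod isOpen_univ).mem_nhds ⟨hq, mem_univ _⟩)
  have hdiff : ∀ q : (Fin d → ℝ) × ℝ, q.1 ∈ Ω → DifferentiableAt ℝ P q := fun q hq =>
    (hsm q hq).differentiableAt (by simp)
  have hdx : ∀ x ∈ Ω, ∀ t i, pd i (fun y => p y t) x = Dd (ex i) P (x, t) := fun x hx t i =>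
    link_pd (F := P) i (hdiff (x, t) hx)
  have hdt : ∀ x ∈ Ω, ∀ t, deriv (p x) t = Dd et P (x, t) := fun x hx t =>
    (link_dt (F := P) (hdiff (x, t) hx)).deriv
  have hjt : ∀ x ∈ Ω, ∀ t, (x, p x t, fun i => pd i (fun y => p y t) x) = jt P (x, t) := by
    intro x hx t
    simp only [jt, hdx x hx t, hP]
  have hlap : ∀ x ∈ Ω, ∀ t, lap (fun y => p y t) x = ∑ i, Dd (ex i) (Dd (ex i) P) (x, t) := by
    intro x hx t
    refine Finset.sum_congr rfl fun i _ => ?_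
    have h1 : pd i (fun y => p y t) =ᶠ[𝓝 x] fun y => Dd (ex i) P (y, t) := by
      filter_upwards [hΩo.mem_nhds hx] with y hy using hdx y hy t i
    rw [pd_congr i h1]
    exact link_pd i ((Dd_contDiffAt (hsm (x, t) hx)).differentiableAt (by simp))
  have hTv : ∀ x ∈ Ω, ∀ t,
      ((deriv (p x) t, fun i => pd i (fun y => deriv (p y) t) x) : ℝ × (Fin d → ℝ))
        = Tv P (x, t) := by
    intro x hx t
    have h1 : (fun y => deriv (p y) t) =ᶠ[𝓝 x] fun y => Dd et P (y, t) := by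
      filter_upwards [hΩo.mem_nhds hx] with y hy using hdt y hy t
    have h2 : ∀ i, pd i (fun y => deriv (p y) t) x = Dd (ex i) (Dd et P) (x, t) := by
      intro i
      rw [pd_congr i h1]
      exact link_pd i ((Dd_contDiffAt (hsm (x, t) hx)).differentiableAt (by simp))
    simp only [Tv, hdt x hx t, h2]
  have S : Sol Ω f P om :=
    { op := hΩo
      conn := hΩc.isPreconnected
      bdd := hΩb
      hf := hf
      sm := hsm
      cont := hpc
      eq := by
        rintro ⟨x, t⟩ hx
        have h := hpeq x hx t
        rw [hdt x hx t, hlap x hx t, hjt x hx t] at h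
        exact h
      bc := hpbc
      om_pos := hom
      per := hper
      min := hmin
      bnd := by
        obtain ⟨R, hR⟩ := hpbnd
        refine ⟨R, ?_⟩
        rintro ⟨x, t⟩ hx
        refine ⟨(hR x hx t).1, fun i => ?_⟩
        rw [← hdx x hx t i]
        exact (hR x hx t).2 i }
  have hnc : ∃ q ∈ Ω ×ˢ Icc (0:ℝ) om, LinearIndependent ℝ ![Tv P q, V q] := by
    obtain ⟨⟨x, t⟩, hq, h1, h2⟩ := hVnc
    refine ⟨(x, t), hq, ?_⟩
    have e := hTv x hq.1 t
    simp only at h1 h2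
    rw [e] at h1 h2
    rw [LinearIndependent.pair_iff]
    intro a b hab
    by_cases hb : b = 0
    · subst hb
      refine ⟨?_, rfl⟩
      by_contra ha
      refine h2 0 ?_
      simpa [ha] using hab
    · exfalso
      refine h1 (-(b⁻¹ * a)) ?_
      have : b • V (x, t) = -(a • Tv P (x, t)) := by
        rw [eq_neg_iff_add_eq_zero, add_comm]; exact hab
      rw [neg_smul, mul_smul, ← smul_neg, ← this, smul_smul, inv_mul_cancel₀ hb, one_smul]
  obtain ⟨g, hg, hg0, hgi⟩ := S.construct hV.continuousOn hnc
  refine ⟨g, hg, ?_, ?_⟩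
  · intro x hx t
    rw [hjt x hx t]
    exact hg0 (x, t) hx
  · have hsl : ∀ t, ∫ x in Ω, (fderiv ℝ (fun w : ℝ × (Fin d → ℝ) => g (x, w.1, w.2))
          (p x t, fun i => pd i (fun y => p y t) x)) (V (x, t))
        = ∫ x in Ω, fderiv ℝ g (jt P (x, t)) (0, V (x, t)) := by
      intro t
      refine setIntegral_congr_fun hΩo.measurableSet ?_
      intro x hx
      simp only
      have e := hjt x hx t
      set y : ℝ × (Fin d → ℝ) := (p x t, fun i => pd i (fun y => p y t) x) with hy
      rw [← e]
      have h1 : HasFDerivAt g (fderiv ℝ g (x, y)) (x, y) :=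
        ((hg.contDiffAt).differentiableAt (by simp)).hasFDerivAt
      have h2 : HasFDerivAt (fun w : ℝ × (Fin d → ℝ) => (x, w))
          (ContinuousLinearMap.inr ℝ (Fin d → ℝ) (ℝ × (Fin d → ℝ))) y :=
        hasFDerivAt_prodMk_right x y
      have h3 := (h1.comp y h2).fderiv
      have h4 : fderiv ℝ (fun w : ℝ × (Fin d → ℝ) => g (x, w.1, w.2)) y = _ := h3
      rw [h4]
      rfl
    simp only [hsl]
    exact hgi

end Helpers

/-- Proposition `prop-constr`: construction of a perturbation `g`
vanishing along a periodic orbit whose derivative pairs nontrivially with `V`. -/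
theorem perturbation_vanishing_on_periodic_orbit
    (d : ℕ) (hd : 2 ≤ d) (γ : NNReal) (hγ0 : 0 < γ) (hγ1 : γ ≤ 1)
    (Ω : Set (Fin d → ℝ)) (hΩo : IsOpen Ω) (hΩc : IsConnected Ω)
    (hΩb : Bornology.IsBounded Ω) (hΩreg : HasC2HolderBoundary Ω γ)
    (f : ((Fin d → ℝ) × ℝ × (Fin d → ℝ)) → ℝ)
    (hf : ContDiffOn ℝ (⊤ : ℕ∞) f
      (closure Ω ×ˢ ((univ : Set ℝ) ×ˢ (univ : Set (Fin d → ℝ)))))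
    -- `p` is a classical periodic solution, smooth on `Ω × ℝ`, of minimal period `ω`
    (p : (Fin d → ℝ) → ℝ → ℝ)
    (hpsmooth : ContDiffOn ℝ (⊤ : ℕ∞)
      (fun q : (Fin d → ℝ) × ℝ => p q.1 q.2) (Ω ×ˢ (univ : Set ℝ)))
    (hpc : ContinuousOn (fun q : (Fin d → ℝ) × ℝ => p q.1 q.2)
      (closure Ω ×ˢ (univ : Set ℝ)))
    (hpx : ∀ t : ℝ, ContDiffOn ℝ 2 (fun x => p x t) Ω)
    (hpt : ∀ x ∈ Ω, ContDiff ℝ 1 (p x))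
    (hpeq : ∀ x ∈ Ω, ∀ t : ℝ,
      deriv (p x) t = lap (fun y => p y t) x
        + f (x, p x t, fun i => pd i (fun y => p y t) x))
    (hpbc : ∀ x ∈ frontier Ω, ∀ t : ℝ, p x t = 0)
    (ω : ℝ) (hω : 0 < ω)
    (hper : ∀ x ∈ closure Ω, ∀ t : ℝ, p x (t + ω) = p x t)
    (hmin : ∀ ω' : ℝ, 0 < ω' → (∀ x ∈ closure Ω, ∀ t : ℝ, p x (t + ω') = p x t) → ω ≤ ω')
    (hpbnd : ∃ R : ℝ, ∀ x ∈ Ω, ∀ t : ℝ, |p x t| ≤ R ∧ ∀ i, |pd i (fun y => p y t) x| ≤ R)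
    -- `V` is smooth on `Ω × [0,ω]`, with values in `ℝ^{d+1} = ℝ × ℝ^d`,
    -- not everywhere colinear to `(∂ₜp, ∇∂ₜp)`
    (V : ((Fin d → ℝ) × ℝ) → ℝ × (Fin d → ℝ))
    (hV : ContDiffOn ℝ (⊤ : ℕ∞) V (Ω ×ˢ Set.Icc (0:ℝ) ω))
    (hVnc : ∃ q ∈ Ω ×ˢ Set.Icc (0:ℝ) ω,
      (∀ c : ℝ, V q ≠
        c • ((deriv (p q.1) q.2, fun i => pd i (fun y => deriv (p y) q.2) q.1) :
          ℝ × (Fin d → ℝ))) ∧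
      (∀ c : ℝ,
        ((deriv (p q.1) q.2, fun i => pd i (fun y => deriv (p y) q.2) q.1) :
          ℝ × (Fin d → ℝ)) ≠ c • V q)) :
    ∃ g : ((Fin d → ℝ) × ℝ × (Fin d → ℝ)) → ℝ,
      ContDiff ℝ (⊤ : ℕ∞) g ∧
      -- (i) `g` vanishes along the orbit
      (∀ x ∈ Ω, ∀ t : ℝ, g (x, p x t, fun i => pd i (fun y => p y t) x) = 0) ∧
      -- (ii) the pairing of `(D_u g, D_{∇u} g)` with `V` has nonzero integral
      (∫ t in (0:ℝ)..ω, (∫ x in Ω,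
        (fderiv ℝ (fun w : ℝ × (Fin d → ℝ) => g (x, w.1, w.2))
          (p x t, fun i => pd i (fun y => p y t) x)) (V (x, t)))) ≠ 0 := by
  exact final_wrap hΩo hΩc hΩb hf hpsmooth hpc hpeq hpbc hω hper hmin hpbnd hV hVnc
end

section
/- Let U be an open set of ℝ^p and let f : U → ℝ^q be a map of class C^s with s > max(p − q, 0). Then the set of critical values of f, i.e. the set of points y ∈ ℝ^q such that there exists x ∈ U with f(x) = y and the derivative Df(x) : ℝ^p → ℝ^q not surjective, has Lebesgue measure zero in ℝ^q. -/
open Set MeasureTheory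

open Filter Topology Asymptotics Module
open scoped NNReal ENNReal MeasureTheory

theorem sard_null_of_local {E : Type*} [TopologicalSpace E] [SecondCountableTopology E] {n : ℕ}
    (A : Set E) (h : E → (Fin n → ℝ))
    (H : ∀ x ∈ A, ∃ W ∈ 𝓝[A] x, volume (h '' (A ∩ W)) = 0) : volume (h '' A) = 0 := by
  choose! W hW hW0 using H
  obtain ⟨t, htA, htc, ht⟩ := TopologicalSpace.countable_cover_nhdsWithin hW
  have : h '' A ⊆ ⋃ x ∈ t, h '' (A ∩ W x) := by
    rintro _ ⟨y, hy, rfl⟩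
    obtain ⟨x, hx, hyx⟩ := mem_iUnion₂.1 (ht hy)
    exact mem_iUnion₂.2 ⟨x, hx, y, ⟨hy, hyx⟩, rfl⟩
  exact measure_mono_null this ((measure_biUnion_null_iff htc).2 fun x hx => hW0 x (htA hx))

theorem sard_null_bdd {E : Type*} [NormedAddCommGroup E] [NormedSpace ℝ E] [FiniteDimensional ℝ E]
    {n s : ℕ} (hn : 0 < n) (hs : 0 < s) (hd : finrank ℝ E ≤ s * n) (A : Set E) (R : ℝ)
    (hA : A ⊆ Metric.closedBall 0 R) (h : E → (Fin n → ℝ))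
    (ho : ∀ x ∈ A, (fun y => h y - h x) =o[𝓝 x] fun y => ‖y - x‖ ^ s) :
    volume (h '' A) = 0 := by
  borelize E
  set B := Metric.closedBall (0 : E) R with hB
  have hBm : MeasurableSet B := Metric.isClosed_closedBall.measurableSet
  set μ : Measure E := μH[(s : ℝ≥0) * (n : ℝ)] with hμ
  have hfin : μ B < ⊤ := by
    refine lt_of_le_of_lt (Measure.hausdorffMeasure_mono (d₁ := finrank ℝ E) ?_ B) ?_
    · push_cast; exact_mod_cast hd
    · exact (isCompact_closedBall (0 : E) R).measure_lt_top
  have hvol : (volume : Measure (Fin n → ℝ)) = μH[(n : ℝ)] := by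
    rw [← hausdorffMeasure_pi_real, Fintype.card_fin]
  have key : ∀ ε : ℝ≥0, 0 < ε → volume (h '' A) ≤ (ε : ℝ≥0∞) ^ (n : ℝ) * μ B := by
    intro ε hε
    let S : ℕ → Set E := fun j =>
      {x | x ∈ A ∧ ∀ y, dist y x < 1 / ((j : ℝ) + 1) → ‖h y - h x‖ ≤ ε * ‖y - x‖ ^ s}
    have hSm : Monotone S := by
      intro i j hij x hx
      refine ⟨hx.1, fun y hy => hx.2 y (hy.trans_le ?_)⟩
      exact one_div_le_one_div_of_le (by positivity) (by exact_mod_cast Nat.succ_le_succ hij)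
    have hSA : A = ⋃ j, S j := by
      apply subset_antisymm
      · intro x hx
        have := (ho x hx).def (c := ε) (by exact_mod_cast hε)
        obtain ⟨δ, hδ, hδ'⟩ := Metric.eventually_nhds_iff.1 this
        obtain ⟨j, hj⟩ := exists_nat_one_div_lt hδ
        refine mem_iUnion.2 ⟨j, hx, fun y hy => ?_⟩
        simpa using hδ' (hy.trans hj)
      · exact iUnion_subset fun j x hx => hx.1
    have hSj : ∀ j, volume (h '' S j) ≤ (ε : ℝ≥0∞) ^ (n : ℝ) * μ B := by
      intro j
      set δ : ℝ := 1 / ((j : ℝ) + 1) with hδ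
      have hδ0 : 0 < δ := by positivity
      let D : ℕ → Set E := disjointed fun i => Metric.ball (TopologicalSpace.denseSeq E i) (δ / 2)
      have hDm : ∀ i, MeasurableSet (D i) := fun i =>
        MeasurableSet.disjointed (fun _ => Metric.isOpen_ball.measurableSet) i
      have hDU : ⋃ i, D i = univ := by
        rw [iUnion_disjointed]
        refine eq_univ_of_forall fun x => ?_
        obtain ⟨i, hi⟩ := (TopologicalSpace.denseRange_denseSeq E).exists_dist_lt x (half_pos hδ0)
        exact mem_iUnion.2 ⟨i, hi⟩
      have hD : ∀ i, volume (h '' (S j ∩ D i)) ≤ (ε : ℝ≥0∞) ^ (n : ℝ) * μ (B ∩ D i) := by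
        intro i
        have hol : HolderOnWith ε (s : ℝ≥0) h (S j ∩ D i) := by
          intro x hx y hy
          have hxb := disjointed_subset _ _ hx.2
          have hyb := disjointed_subset _ _ hy.2
          have hxy : dist x y < δ := by
            have := dist_triangle_right x y (TopologicalSpace.denseSeq E i)
            have h1 := Metric.mem_ball.1 hxb
            have h2 := Metric.mem_ball.1 hyb
            linarith
          have := hy.1.2 x hxy
          rw [← dist_eq_norm, ← dist_eq_norm] at this
          rw [edist_dist, edist_dist, NNReal.coe_natCast, ENNReal.rpow_natCast,
            ← ENNReal.ofReal_pow dist_nonneg, ← ENNReal.ofReal_coe_nnreal,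
            ← ENNReal.ofReal_mul ε.coe_nonneg]
          exact ENNReal.ofReal_le_ofReal this
        rw [hvol]
        refine (hol.hausdorffMeasure_image_le (by exact_mod_cast hs) (Nat.cast_nonneg n)).trans ?_
        gcongr
        exact fun x hx => hA hx.1
      calc volume (h '' S j) = volume (⋃ i, h '' (S j ∩ D i)) := by
            rw [← image_iUnion, ← inter_iUnion, hDU, inter_univ]
        _ ≤ ∑' i, volume (h '' (S j ∩ D i)) := measure_iUnion_le _
        _ ≤ ∑' i, (ε : ℝ≥0∞) ^ (n : ℝ) * μ (B ∩ D i) := ENNReal.tsum_le_tsum hD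
        _ = (ε : ℝ≥0∞) ^ (n : ℝ) * ∑' i, μ (B ∩ D i) := ENNReal.tsum_mul_left
        _ = (ε : ℝ≥0∞) ^ (n : ℝ) * μ (⋃ i, B ∩ D i) := by
            rw [measure_iUnion]
            · exact fun i k hik => ((disjoint_disjointed _) hik).mono
                inter_subset_right inter_subset_right
            · exact fun i => hBm.inter (hDm i)
        _ = _ := by rw [← inter_iUnion, hDU, inter_univ]
    rw [hSA, image_iUnion, Monotone.measure_iUnion (fun i j hij => image_mono (hSm hij))]
    exact iSup_le hSj
  have hlim : Tendsto (fun ε : ℝ≥0 => (ε : ℝ≥0∞) ^ (n : ℝ) * μ B) (𝓝[>] 0) (𝓝 0) := by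
    have h1 : Tendsto (fun ε : ℝ≥0 => (ε : ℝ≥0∞) ^ n) (𝓝[>] 0) (𝓝 0) := by
      have : Tendsto (fun ε : ℝ≥0 => ((ε ^ n : ℝ≥0) : ℝ≥0∞)) (𝓝 0) (𝓝 ((0 ^ n : ℝ≥0) : ℝ≥0∞)) :=
        ENNReal.tendsto_coe.2 ((continuous_pow n).tendsto 0)
      simp only [zero_pow hn.ne', ENNReal.coe_zero, ENNReal.coe_pow] at this
      exact this.mono_left nhdsWithin_le_nhds
    have := ENNReal.Tendsto.mul_const (b := μ B) h1 (Or.inr hfin.ne)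
    simpa using this
  refine le_antisymm (ge_of_tendsto hlim ?_) zero_le
  filter_upwards [self_mem_nhdsWithin] with ε hε using key ε hε

theorem sard_null {E : Type*} [NormedAddCommGroup E] [NormedSpace ℝ E] [FiniteDimensional ℝ E]
    {n s : ℕ} (hn : 0 < n) (hs : 0 < s) (hd : finrank ℝ E ≤ s * n) (A : Set E)
    (h : E → (Fin n → ℝ))
    (ho : ∀ x ∈ A, (fun y => h y - h x) =o[𝓝 x] fun y => ‖y - x‖ ^ s) :
    volume (h '' A) = 0 := by
  refine sard_null_of_local A h fun x hx => ⟨Metric.closedBall 0 (‖x‖ + 1), ?_, ?_⟩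
  · refine mem_nhdsWithin_of_mem_nhds ?_
    refine mem_of_superset (Metric.ball_mem_nhds x one_pos) fun y hy => ?_
    rw [mem_closedBall_zero_iff]
    rw [mem_ball_iff_norm] at hy
    have := norm_le_norm_add_norm_sub' y x
    linarith
  · exact sard_null_bdd hn hs hd _ _ inter_subset_right h fun y hy => ho y hy.1

/-- Integration of a little-o estimate on the derivative. -/
theorem sard_integrate {E' E V : Type*} [NormedAddCommGroup E'] [NormedSpace ℝ E']
    [NormedAddCommGroup E] [NormedSpace ℝ E] [NormedAddCommGroup V] [NormedSpace ℝ V]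
    (ψ : E' → E) (F : E → V) (b : E') (j : ℕ) (hψ : ContDiffAt ℝ 1 ψ b)
    (hF : ContDiffAt ℝ 1 F (ψ b))
    (ho : (fun y => fderiv ℝ F (ψ y)) =o[𝓝 b] fun y => ‖y - b‖ ^ j) :
    (fun y => F (ψ y) - F (ψ b)) =o[𝓝 b] fun y => ‖y - b‖ ^ (j + 1) := by
  have hD : (fun y => fderiv ℝ (F ∘ ψ) y) =o[𝓝 b] fun y => ‖y - b‖ ^ j := by
    have h1 : ∀ᶠ y in 𝓝 b, ContDiffAt ℝ 1 ψ y := hψ.eventually (by simp)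
    have h2 : ∀ᶠ y in 𝓝 b, ContDiffAt ℝ 1 F (ψ y) :=
      hψ.continuousAt.eventually (hF.eventually (by simp))
    have h3 : (fun y => fderiv ℝ ψ y) =O[𝓝 b] fun _ => (1 : ℝ) := by
      have : ContinuousAt (fderiv ℝ ψ) b :=
        (hψ.fderiv_right (m := 0) (by simp)).continuousAt
      exact this.isBigO_one ℝ
    have h4 : (fun y => ‖fderiv ℝ F (ψ y)‖ * ‖fderiv ℝ ψ y‖) =o[𝓝 b] fun y => ‖y - b‖ ^ j := by
      simpa using ho.norm_left.mul_isBigO h3.norm_left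
    refine IsBigO.trans_isLittleO (IsBigO.of_bound 1 ?_) h4
    filter_upwards [h1, h2] with y hy1 hy2
    rw [fderiv_comp y (hy2.differentiableAt (by simp)) (hy1.differentiableAt (by simp)), one_mul,
      Real.norm_of_nonneg (by positivity)]
    exact ContinuousLinearMap.opNorm_comp_le _ _
  have hdiff : ∀ᶠ y in 𝓝 b, DifferentiableAt ℝ (F ∘ ψ) y := by
    filter_upwards [(hF.comp b hψ).eventually (by simp)] with y hy
    exact hy.differentiableAt (by simp)
  refine IsLittleO.of_bound fun c hc => ?_
  obtain ⟨δ, hδ, H⟩ := Metric.eventually_nhds_iff_ball.1 (hdiff.and (hD.def hc))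
  filter_upwards [Metric.ball_mem_nhds b hδ] with y hy
  have hsub : Metric.closedBall b ‖y - b‖ ⊆ Metric.ball b δ :=
    Metric.closedBall_subset_ball (by simpa [dist_eq_norm] using hy)
  have := (convex_closedBall b ‖y - b‖).norm_image_sub_le_of_norm_fderiv_le (𝕜 := ℝ) (f := F ∘ ψ)
    (C := c * ‖y - b‖ ^ j) (fun z hz => (H z (hsub hz)).1) (fun z hz => ?_)
    (Metric.mem_closedBall_self (norm_nonneg _)) (y := y) (by simp [dist_eq_norm])
  · simpa [pow_succ, mul_assoc] using this
  · refine (H z (hsub hz)).2.trans ?_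
    rw [Real.norm_of_nonneg (by positivity)]
    have : ‖z - b‖ ≤ ‖y - b‖ := by simpa [dist_eq_norm] using hz
    gcongr

/-- Local straightening of a submersion to the reals. -/
theorem sard_straighten {E : Type*} [NormedAddCommGroup E] [NormedSpace ℝ E]
    [FiniteDimensional ℝ E] (f : E → ℝ) (x : E) (k : ℕ) (hk : k ≠ 0) (hf : ContDiffAt ℝ k f x)
    (hne : fderiv ℝ f x ≠ 0) :
    ∃ (L : E →L[ℝ] ℝ) (v : E) (Φ Ψ : E → E), L v = 1 ∧ (∀ y, L (Φ y) = f y) ∧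
      ∀ᶠ y in 𝓝 x, Ψ (Φ y) = y ∧ ContDiffAt ℝ k Ψ (Φ y) ∧ ∀ᶠ z in 𝓝 (Φ y), Φ (Ψ z) = z := by
  set L := fderiv ℝ f x with hL
  have hk' : (k : WithTop ℕ∞) ≠ 0 := by exact_mod_cast hk
  obtain ⟨v₀, hv₀⟩ : ∃ v₀, L v₀ ≠ 0 := by
    by_contra! h
    exact hne (ContinuousLinearMap.ext h)
  set v := (L v₀)⁻¹ • v₀ with hv
  have hLv : L v = 1 := by simp [hv, hv₀]
  set Φ : E → E := fun y => y + (f y - L y) • v with hΦ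
  have hΦc : ContDiffAt ℝ k Φ x := by
    refine contDiffAt_id.add ((hf.sub L.contDiff.contDiffAt).smul contDiffAt_const)
  have hΦd : HasFDerivAt Φ ((ContinuousLinearEquiv.refl ℝ E : E ≃L[ℝ] E) : E →L[ℝ] E) x := by
    have h1 : HasFDerivAt f L x := (hf.differentiableAt hk').hasFDerivAt
    have h2 := (hasFDerivAt_id x).add ((h1.sub L.hasFDerivAt).smul_const v)
    refine h2.congr_fderiv ?_
    ext w
    simp
  let e := hΦc.toOpenPartialHomeomorph Φ hΦd hk'
  have hex : x ∈ e.source := hΦc.mem_toOpenPartialHomeomorph_source hΦd hk'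
  have hΨ : ContDiffAt ℝ k e.symm (Φ x) := hΦc.to_localInverse hΦd hk'
  refine ⟨L, v, Φ, e.symm, hLv, fun y => by simp [hΦ, hLv], ?_⟩
  filter_upwards [e.open_source.mem_nhds hex,
    hΦc.continuousAt.eventually (hΨ.eventually (by simp))] with y hy hy2
  refine ⟨e.left_inv hy, hy2, ?_⟩
  have : e y ∈ e.target := e.map_source hy
  filter_upwards [e.open_target.mem_nhds this] with z hz
  exact e.right_inv hz

/-- Estimates of order `j` for `F` give estimates of order `l + j` for `h`, along any `C^1` map. -/
def SardGain {E V G : Type} [NormedAddCommGroup E] [NormedSpace ℝ E] [NormedAddCommGroup V]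
    [NormedAddCommGroup G] (A : Set E) (h : E → G) (F : E → V) (l : ℕ) : Prop :=
  ∀ (E' : Type) [NormedAddCommGroup E'] [NormedSpace ℝ E'] (ψ : E' → E) (b : E') (j : ℕ),
    ContDiffAt ℝ 1 ψ b → ψ b ∈ A → ((fun y => F (ψ y)) =o[𝓝 b] fun y => ‖y - b‖ ^ j) →
    (fun y => h (ψ y) - h (ψ b)) =o[𝓝 b] fun y => ‖y - b‖ ^ (j + l)

theorem sard_finrank_ker {E : Type*} [NormedAddCommGroup E] [NormedSpace ℝ E]
    [FiniteDimensional ℝ E] (L : E →L[ℝ] ℝ) (v : E) (hv : L v = 1) :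
    finrank ℝ (LinearMap.ker (L : E →ₗ[ℝ] ℝ)) + 1 = finrank ℝ E := by
  have h1 := LinearMap.finrank_range_add_finrank_ker (L : E →ₗ[ℝ] ℝ)
  have h2 : LinearMap.range (L : E →ₗ[ℝ] ℝ) = ⊤ := by
    rw [LinearMap.range_eq_top]
    exact fun c => ⟨c • v, by simp [hv]⟩
  rw [h2, finrank_top, finrank_self] at h1
  omega

theorem sard_flat {n : ℕ} (hn : 0 < n) : ∀ (k m : ℕ) (E V : Type)
    [NormedAddCommGroup E] [NormedSpace ℝ E] [FiniteDimensional ℝ E]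
    [NormedAddCommGroup V] [NormedSpace ℝ V] (A : Set E) (h : E → (Fin n → ℝ)) (F : E → V) (l : ℕ),
    finrank ℝ E = m → 0 < l → finrank ℝ E ≤ (l + k) * n → (∀ x ∈ A, ContDiffAt ℝ k F x) →
    (∀ x ∈ A, F x = 0) → SardGain A h F l → volume (h '' A) = 0 := by
  intro k
  induction k with
  | zero =>
    intro m E V _ _ _ _ _ A h F l _ hl hd hF hF0 hG
    refine sard_null hn hl hd A h fun x hx => ?_
    have := hG E id x 0 contDiffAt_id hx ?_
    · simpa using this
    · simp only [pow_zero, id]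
      rw [isLittleO_one_iff]
      have := (hF x hx).continuousAt.tendsto
      rwa [hF0 x hx] at this
  | succ k ihk =>
    intro m
    induction m with
    | zero =>
      intro E V _ _ _ _ _ A h F l hm hl hd hF hF0 hG
      have : Subsingleton E := finrank_zero_iff.1 hm
      have : Nonempty (Fin n) := ⟨⟨0, hn⟩⟩
      have hc : (h '' A).Countable := (Set.toFinite (h '' A)).countable
      exact hc.measure_zero _
    | succ m ihm =>
      intro E V _ _ _ _ _ A h F l hm hl hd hF hF0 hG
      have hsplit : h '' A ⊆ h '' {x ∈ A | fderiv ℝ F x ≠ 0} ∪ h '' {x ∈ A | fderiv ℝ F x = 0} := by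
        rintro _ ⟨x, hx, rfl⟩
        by_cases hx0 : fderiv ℝ F x = 0
        · exact Or.inr ⟨x, ⟨hx, hx0⟩, rfl⟩
        · exact Or.inl ⟨x, ⟨hx, hx0⟩, rfl⟩
      refine measure_mono_null hsplit (measure_union_null ?_ ?_)
      · refine sard_null_of_local _ h fun x hx => ?_
        obtain ⟨hxA, hx0⟩ := hx
        obtain ⟨w, hw⟩ : ∃ w, fderiv ℝ F x w ≠ 0 := by
          by_contra! h
          exact hx0 (ContinuousLinearMap.ext h)
        obtain ⟨g, -, hg⟩ := exists_dual_vector ℝ _ (norm_ne_zero_iff.2 hw)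
        have hgF : ContDiffAt ℝ (k + 1 : ℕ) (fun y => g (F y)) x :=
          g.contDiff.contDiffAt.comp x (hF x hxA)
        have hne : fderiv ℝ (fun y => g (F y)) x ≠ 0 := by
          have h1 : HasFDerivAt (fun y => g (F y)) (g.comp (fderiv ℝ F x)) x :=
            g.hasFDerivAt.comp x ((hF x hxA).differentiableAt (by simp)).hasFDerivAt
          rw [h1.fderiv]
          intro h0
          have := congrArg (fun T => T w) h0
          simp [hg] at this
          exact hw this
        obtain ⟨L, v, Φ, Ψ, hLv, hLΦ, hev⟩ := sard_straighten _ x (k + 1) (by simp) hgF hne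
        refine ⟨_, mem_nhdsWithin_of_mem_nhds hev, ?_⟩
        let K := LinearMap.ker (L : E →ₗ[ℝ] ℝ)
        let φ : K → E := fun w => Ψ w
        let Apull : Set K := {w | Ψ w ∈ A ∧ ContDiffAt ℝ (k + 1 : ℕ) Ψ (w : E)}
        have hφ : ∀ w ∈ Apull, ContDiffAt ℝ (k + 1 : ℕ) φ w := fun w hw =>
          ContDiffAt.comp w hw.2 K.subtypeL.contDiff.contDiffAt
        have hK := sard_finrank_ker L v hLv
        refine measure_mono_null (t := (fun w => h (φ w)) '' Apull) ?_
          (ihm K V Apull (fun w => h (φ w)) (fun w => F (φ w)) l ?_ hl ?_ ?_ ?_ ?_)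
        · rintro _ ⟨y, ⟨⟨hyA, -⟩, hy1, hy2, -⟩, rfl⟩
          refine ⟨⟨Φ y, ?_⟩, ⟨?_, hy2⟩, ?_⟩
          · change L (Φ y) = 0
            rw [hLΦ, hF0 y hyA, map_zero]
          · simpa [hy1] using hyA
          · simp [φ, hy1]
        · change finrank ℝ (LinearMap.ker (L : E →ₗ[ℝ] ℝ)) = m
          omega
        · refine le_trans ?_ hd
          change finrank ℝ (LinearMap.ker (L : E →ₗ[ℝ] ℝ)) ≤ _
          omega
        · exact fun w hw => ContDiffAt.comp w (hF _ hw.1) (hφ w hw)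
        · exact fun w hw => hF0 _ hw.1
        · intro E' _ _ ψ b j hψ hb ho
          exact hG E' (fun y => φ (ψ y)) b j
            (((hφ _ hb).of_le (by exact_mod_cast Nat.le_add_left 1 k)).comp b hψ) hb.1 ho
      · refine ihk _ E (E →L[ℝ] V) _ h (fderiv ℝ F) (l + 1) rfl (by omega) ?_ ?_ ?_ ?_
        · convert hd using 2
          ring
        · exact fun x hx => (hF x hx.1).fderiv_right (by simp)
        · exact fun x hx => hx.2
        · intro E' _ _ ψ b j hψ hb ho
          have h1 := sard_integrate ψ F b j hψ
            ((hF _ hb.1).of_le (by exact_mod_cast Nat.le_add_left 1 k)) ho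
          simp only [hF0 _ hb.1, sub_zero] at h1
          have := hG E' ψ b (j + 1) hψ hb.1 h1
          rwa [add_assoc, add_comm 1 l] at this

theorem sard_isClosed_not_surjective {E : Type*} [NormedAddCommGroup E] [NormedSpace ℝ E]
    {n : ℕ} : IsClosed {T : E →L[ℝ] (Fin n → ℝ) | ¬ Function.Surjective T} := by
  rw [← isOpen_compl_iff]
  have : {T : E →L[ℝ] (Fin n → ℝ) | ¬ Function.Surjective T}ᶜ =
      {T : E →L[ℝ] (Fin n → ℝ) | Function.Surjective T} := by
    ext T; simp
  rw [this, isOpen_iff_mem_nhds]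
  intro T hT
  obtain ⟨S, hS⟩ := (T : E →ₗ[ℝ] (Fin n → ℝ)).exists_rightInverse_of_surjective
    (LinearMap.range_eq_top.2 hT)
  let S' : (Fin n → ℝ) →L[ℝ] E := ⟨S, S.continuous_of_finiteDimensional⟩
  have hc : Continuous fun T' : E →L[ℝ] (Fin n → ℝ) => T'.comp S' :=
    continuous_id.clm_comp continuous_const
  have h1 : T.comp S' = 1 := by
    ext1 w
    exact congrArg (fun R => R w) hS
  have h2 : {R : (Fin n → ℝ) →L[ℝ] (Fin n → ℝ) | IsUnit R} ∈ 𝓝 (T.comp S') :=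
    Units.isOpen.mem_nhds (by rw [h1]; exact isUnit_one)
  filter_upwards [hc.continuousAt.preimage_mem_nhds h2] with T' hT'
  obtain ⟨R, hR⟩ := IsUnit.exists_right_inv hT'
  intro w
  exact ⟨S' (R w), congrArg (fun R => R w) hR⟩

theorem sard_general {s : ℕ} (hs : 0 < s) : ∀ (q : ℕ) (E : Type)
    [NormedAddCommGroup E] [NormedSpace ℝ E] [FiniteDimensional ℝ E] (A : Set E)
    (f : E → (Fin q → ℝ)), finrank ℝ E < s + q → (∀ x ∈ A, ContDiffAt ℝ s f x) →
    (∀ x ∈ A, ¬ Function.Surjective (fderiv ℝ f x)) → volume (f '' A) = 0 := by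
  intro q
  induction q with
  | zero =>
    intro E _ _ _ A f _ _ hA
    have : A = ∅ := by
      refine eq_empty_of_forall_notMem fun x hx => hA x hx fun w => ⟨0, Subsingleton.elim _ _⟩
    simp [this]
  | succ q ih =>
    intro E _ _ _ A f hd hf hA
    have hs0 : (s : WithTop ℕ∞) ≠ 0 := by exact_mod_cast hs.ne'
    have hs1 : (1 : WithTop ℕ∞) ≤ s := by exact_mod_cast hs
    have hsplit : f '' A ⊆ f '' {x ∈ A | fderiv ℝ f x ≠ 0} ∪ f '' {x ∈ A | fderiv ℝ f x = 0} := by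
      rintro _ ⟨x, hx, rfl⟩
      by_cases hx0 : fderiv ℝ f x = 0
      · exact Or.inr ⟨x, ⟨hx, hx0⟩, rfl⟩
      · exact Or.inl ⟨x, ⟨hx, hx0⟩, rfl⟩
    refine measure_mono_null hsplit (measure_union_null ?_ ?_)
    · refine sard_null_of_local _ f fun x hx => ?_
      obtain ⟨hxA, hx0⟩ := hx
      have hfx := hf x hxA
      obtain ⟨i, hi⟩ : ∃ i, fderiv ℝ (fun y => f y i) x ≠ 0 := by
        by_contra! h
        apply hx0
        have h1 : HasFDerivAt f (fderiv ℝ f x) x := (hfx.differentiableAt hs0).hasFDerivAt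
        ext w i
        have h2 := (hasFDerivAt_pi'.1 h1 i).fderiv
        rw [h i] at h2
        have := congrArg (fun T => T w) h2
        simpa using this.symm
      obtain ⟨L, v, Φ, Ψ, hLv, hLΦ, hev⟩ :=
        sard_straighten (fun y => f y i) x s hs.ne' (contDiffAt_pi.1 hfx i) hi
      obtain ⟨W, hWx, hWsub, hWc⟩ := local_compact_nhds (hev.and (hfx.eventually (by simp)))
      refine ⟨W, mem_nhdsWithin_of_mem_nhds hWx, ?_⟩
      set C : Set E := W ∩ (fderiv ℝ f) ⁻¹' {T | ¬ Function.Surjective T} with hC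
      have hCc : IsCompact C := by
        refine hWc.of_isClosed_subset ?_ inter_subset_left
        refine ContinuousOn.preimage_isClosed_of_isClosed ?_ hWc.isClosed
          sard_isClosed_not_surjective
        exact fun y hy => ((hWsub hy).2.fderiv_right (m := 0)
          (by simpa using hs1)).continuousAt.continuousWithinAt
      have hfC : IsCompact (f '' C) := hCc.image_of_continuousOn
        fun y hy => (hWsub hy.1).2.continuousAt.continuousWithinAt
      refine measure_mono_null (t := f '' C) (image_mono fun y hy => ⟨hy.2, hA y hy.1.1⟩) ?_
      have hmp := (volume_preserving_piFinSuccAbove (fun _ : Fin (q + 1) => ℝ) i).symm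
      rw [← hmp.measure_preimage_equiv, Measure.volume_eq_prod,
        Measure.measure_prod_null ((MeasurableEquiv.measurable _) hfC.measurableSet)]
      refine Eventually.of_forall fun u => ?_
      let K := LinearMap.ker (L : E →ₗ[ℝ] ℝ)
      let φ : K → E := fun w => Ψ ((w : E) + u • v)
      let Apull : Set K := {w | φ w ∈ C ∧ ContDiffAt ℝ s Ψ ((w : E) + u • v) ∧
        ∀ᶠ z in 𝓝 ((w : E) + u • v), Φ (Ψ z) = z}
      let g : K → (Fin q → ℝ) := fun w k => f (φ w) (i.succAbove k)
      have hK := sard_finrank_ker L v hLv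
      have hfφ : ∀ w ∈ Apull, ContDiffAt ℝ s (fun w => f (φ w)) w := by
        intro w hw
        refine ContDiffAt.comp w (hWsub hw.1.1).2 ?_
        exact ContDiffAt.comp w hw.2.1 (K.subtypeL.contDiff.contDiffAt.add contDiffAt_const)
      refine measure_mono_null (t := g '' Apull) ?_ (ih K Apull g ?_ ?_ ?_)
      · rintro t ⟨y, hyC, hy⟩
        have hy : f y = i.insertNth u t := hy
        obtain ⟨⟨hy1, hy2, hy3⟩, -⟩ := hWsub hyC.1
        have hLy : L (Φ y) = u := by rw [hLΦ, hy]; simp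
        have hadd : Φ y - u • v + u • v = Φ y := sub_add_cancel _ _
        have hmem : Φ y - u • v ∈ K := by
          change L (Φ y - u • v) = 0
          simp [hLy, hLv]
        refine ⟨⟨Φ y - u • v, hmem⟩, ⟨?_, ?_, ?_⟩, ?_⟩
        · simpa [φ, hy1] using hyC
        · simpa using hy2
        · simpa only [hadd] using hy3
        · ext k
          simp [g, φ, hy1, hy]
      · change finrank ℝ (LinearMap.ker (L : E →ₗ[ℝ] ℝ)) < _
        omega
      · exact fun w hw => contDiffAt_pi.2 fun k => contDiffAt_pi.1 (hfφ w hw) (i.succAbove k)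
      · intro w hw hsurj
        set z : E := (w : E) + u • v with hz
        obtain ⟨hwC, hΨ, hΦΨ⟩ := hw
        have hfd : HasFDerivAt f (fderiv ℝ f (Ψ z)) (Ψ z) :=
          ((hWsub hwC.1).2.differentiableAt hs0).hasFDerivAt
        have hΨd : HasFDerivAt Ψ (fderiv ℝ Ψ z) z := (hΨ.differentiableAt hs0).hasFDerivAt
        set T : E →L[ℝ] (Fin (q + 1) → ℝ) := (fderiv ℝ f (Ψ z)).comp (fderiv ℝ Ψ z) with hT
        have hTd : HasFDerivAt (fun z => f (Ψ z)) T z := hfd.comp z hΨd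
        have hTi : ∀ a, T a i = L a := by
          have h1 := hasFDerivAt_pi'.1 hTd i
          have h2 : HasFDerivAt (fun z => f (Ψ z) i) L z := by
            refine L.hasFDerivAt.congr_of_eventuallyEq ?_
            filter_upwards [hΦΨ] with a ha
            rw [← hLΦ, ha]
          intro a
          exact congrArg (fun R => R a) (h1.unique h2)
        have hgd : ∀ a : K, ∀ k, fderiv ℝ g w a k = T a (i.succAbove k) := by
          have h1 : HasFDerivAt (fun w : K => (w : E) + u • v) K.subtypeL w :=
            K.subtypeL.hasFDerivAt.add_const _
          have h2 : HasFDerivAt (fun w : K => f (φ w)) (T.comp K.subtypeL) w :=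
            HasFDerivAt.comp (g := fun z => f (Ψ z)) w hTd h1
          have h3 : HasFDerivAt g (ContinuousLinearMap.pi fun k =>
              (ContinuousLinearMap.proj (i.succAbove k)).comp (T.comp K.subtypeL)) w :=
            hasFDerivAt_pi.2 fun k => hasFDerivAt_pi'.1 h2 (i.succAbove k)
          intro a k
          rw [h3.fderiv]
          rfl
        refine hwC.2 ?_
        have hTs : Function.Surjective T := by
          intro t
          obtain ⟨a, ha⟩ := hsurj fun k => (t - T (t i • v)) (i.succAbove k)
          refine ⟨t i • v + a, ?_⟩
          ext k
          rcases Fin.eq_self_or_eq_succAbove i k with rfl | ⟨k, rfl⟩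
          · have : L a = 0 := a.2
            rw [hTi]
            simp [hLv, this]
          · have h1 := congrFun ha k
            rw [hgd] at h1
            rw [map_add, Pi.add_apply, h1]
            simp
        intro t
        obtain ⟨a, ha⟩ := hTs t
        exact ⟨fderiv ℝ Ψ z a, ha⟩
    · refine sard_flat (Nat.succ_pos q) (s - 1) _ E (E →L[ℝ] (Fin (q + 1) → ℝ)) _ f
        (fderiv ℝ f) 1 rfl one_pos ?_ ?_ ?_ ?_
      · have : 1 + (s - 1) = s := by omega
        rw [this]
        nlinarith
      · refine fun x hx => (hf x hx.1).fderiv_right ?_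
        have : (s - 1) + 1 = s := by omega
        exact_mod_cast this.le
      · exact fun x hx => hx.2
      · intro E' _ _ ψ b j hψ hb ho
        exact sard_integrate ψ f b j hψ ((hf _ hb.1).of_le hs1) ho

/-- Sard's theorem, Theorem `th-sard`: if `f : U ⊆ ℝ^p → ℝ^q` is of
class `C^s` with `s > max (p - q) 0`, then the set of critical values of `f` has
Lebesgue measure zero in `ℝ^q`. -/
theorem sard_theorem
    (p q s : ℕ) (hs₁ : (p : ℤ) - (q : ℤ) < (s : ℤ)) (hs₂ : 0 < s)
    (U : Set (Fin p → ℝ)) (hU : IsOpen U)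
    (f : (Fin p → ℝ) → (Fin q → ℝ)) (hf : ContDiffOn ℝ s f U) :
    volume {y : Fin q → ℝ | ∃ x ∈ U, f x = y ∧
      ¬ Function.Surjective (fderiv ℝ f x : (Fin p → ℝ) →L[ℝ] (Fin q → ℝ))} = 0 := by
  have := sard_general hs₂ q (Fin p → ℝ) {x ∈ U | ¬ Function.Surjective (fderiv ℝ f x)} f
    (by rw [finrank_fin_fun]; omega) (fun x hx => hf.contDiffAt (hU.mem_nhds hx.1))
    (fun x hx => hx.2)
  refine measure_mono_null ?_ this
  rintro y ⟨x, hxU, rfl, hx⟩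
  exact ⟨x, ⟨hxU, hx⟩, rfl⟩
end
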